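/- arXiv:2009.12593 — 3 statements merged into one kernel-verified Lean document; each statement's English description precedes it below -/
import Mathlib

section
/- Let H be a disconnected 𝒫₄-free 3-graph on n vertices in which every vertex lies in at least one edge. Then |H| ≤ C(n−3,3) + 1 if 6 ≤ n ≤ 9; |H| ≤ C(n−6,3) + 20 if 10 ≤ n ≤ 12; and |H| ≤ C(n−4,2) + 3 if n ≥ 13. -/
open Finset

/-- `H` is a 3-graph on the vertex set `V`: every edge is a 3-element subset of `V`. -/
def ThreeGraphOn (V : Finset ℕ) (H : Finset (Finset ℕ)) : Prop :=
  ∀ e ∈ H, e ⊆ V ∧ e.card = 3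

/-- Four edges form a 3-uniform minimal 4-path: `aᵢ ∩ aⱼ ≠ ∅ ↔ |i - j| ≤ 1`. -/
def IsMinPath4 (a₀ a₁ a₂ a₃ : Finset ℕ) : Prop :=
  (a₀ ∩ a₁).Nonempty ∧ (a₁ ∩ a₂).Nonempty ∧ (a₂ ∩ a₃).Nonempty ∧
    a₀ ∩ a₂ = ∅ ∧ a₀ ∩ a₃ = ∅ ∧ a₁ ∩ a₃ = ∅

/-- `H` contains no minimal 4-path. -/
def P4Free (H : Finset (Finset ℕ)) : Prop :=
  ¬∃ a₀ ∈ H, ∃ a₁ ∈ H, ∃ a₂ ∈ H, ∃ a₃ ∈ H, IsMinPath4 a₀ a₁ a₂ a₃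

/-- `H` is connected on `V`: every partition of `V` into two nonempty parts
is crossed by an edge of `H`. -/
def ConnectedHG (V : Finset ℕ) (H : Finset (Finset ℕ)) : Prop :=
  ∀ U W : Finset ℕ, U ∪ W = V → Disjoint U W → U.Nonempty → W.Nonempty →
    ∃ e ∈ H, (e ∩ U).Nonempty ∧ (e ∩ W).Nonempty



/-- path-freeness in terms of disjointness -/
def PF {α : Type*} (H : Finset (Finset α)) : Prop :=
  ∀ X ∈ H, ∀ Y ∈ H, ∀ Z ∈ H, ∀ W ∈ H, Disjoint X Y → Disjoint Y Z → Disjoint Z W →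
    ¬ Disjoint X Z → ¬ Disjoint Y W → ¬ Disjoint X W → False

lemma PF.mono {α : Type*} {H K : Finset (Finset α)} (h : PF H) (hK : K ⊆ H) : PF K :=
  fun X hX Y hY Z hZ W hW => h X (hK hX) Y (hK hY) Z (hK hZ) W (hK hW)

lemma P4Free.pf {H : Finset (Finset ℕ)} (h : P4Free H) : PF H := by
  intro X hX Y hY Z hZ W hW h1 h2 h3 h4 h5 h6
  apply h
  refine ⟨Y, hY, W, hW, X, hX, Z, hZ, ?_, ?_, ?_, ?_, ?_, ?_⟩
  · rwa [← not_disjoint_iff_nonempty_inter]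
  · rw [← not_disjoint_iff_nonempty_inter]; exact fun h => h6 h.symm
  · rwa [← not_disjoint_iff_nonempty_inter]
  · rw [← disjoint_iff_inter_eq_empty]; exact h1.symm
  · rwa [← disjoint_iff_inter_eq_empty]
  · rw [← disjoint_iff_inter_eq_empty]; exact h3.symm

def bb (m : ℕ) : ℕ :=
  if m ≤ 6 then m.choose 3 else if m = 7 then 20 else if m = 8 then 28 else
  if m = 9 then 35 else (m-1).choose 2 + 2

/-- pull back along an embedding -/
def pull {m : ℕ} (ψ : Fin m ↪ ℕ) (H : Finset (Finset ℕ)) : Finset (Finset (Fin m)) :=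
  univ.filter (fun e => e.map ψ ∈ H)

lemma mem_pull {m : ℕ} {ψ : Fin m ↪ ℕ} {H : Finset (Finset ℕ)} {e} :
    e ∈ pull ψ H ↔ e.map ψ ∈ H := by simp [pull]

lemma pull_card {m : ℕ} {ψ : Fin m ↪ ℕ} {V : Finset ℕ} {H : Finset (Finset ℕ)}
    (hψ : univ.map ψ = V) (hH : ThreeGraphOn V H) : (pull ψ H).card = H.card := by
  have : (pull ψ H).map (mapEmbedding ψ).toEmbedding = H := by
    ext e
    simp only [mem_map, mem_pull]
    constructor
    · rintro ⟨a, ha, rfl⟩; simpa using ha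
    · intro he
      have hs : e ⊆ univ.map ψ := by rw [hψ]; exact (hH e he).1
      obtain ⟨u, -, rfl⟩ := subset_map_iff.1 hs
      exact ⟨u, he, by simp⟩
  rw [← this]
  rw [card_map, this]

lemma pull_pf {m : ℕ} {ψ : Fin m ↪ ℕ} {H : Finset (Finset ℕ)} (h : PF H) : PF (pull ψ H) := by
  intro X hX Y hY Z hZ W hW h1 h2 h3 h4 h5 h6
  rw [mem_pull] at hX hY hZ hW
  refine h _ hX _ hY _ hZ _ hW ?_ ?_ ?_ ?_ ?_ ?_ <;> simpa [Finset.disjoint_map]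

lemma pull_sized {m : ℕ} {ψ : Fin m ↪ ℕ} {V : Finset ℕ} {H : Finset (Finset ℕ)}
    (hH : ThreeGraphOn V H) : ∀ e ∈ pull ψ H, e.card = 3 := by
  intro e he
  rw [mem_pull] at he
  simpa using (hH _ he).2

lemma exists_emb {V : Finset ℕ} {m : ℕ} (hV : V.card = m) :
    ∃ ψ : Fin m ↪ ℕ, univ.map ψ = V :=
  ⟨(V.orderEmbOfFin hV).toEmbedding, by simp⟩

def Itg (H : Finset (Finset ℕ)) : Prop := ∀ e ∈ H, ∀ f ∈ H, ¬ Disjoint e f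

lemma ekr {V : Finset ℕ} {m : ℕ} {H : Finset (Finset ℕ)} (hV : V.card = m) (hm : 6 ≤ m)
    (hH : ThreeGraphOn V H) (hI : Itg H) : H.card ≤ (m-1).choose 2 := by
  obtain ⟨ψ, hψ⟩ := exists_emb hV
  rw [← pull_card hψ hH]
  refine erdos_ko_rado (r := 3) ?_ ?_ (by omega)
  · intro e he f hf hd
    have he' := mem_pull.1 (mem_coe.1 he)
    have hf' := mem_pull.1 (mem_coe.1 hf)
    exact hI _ he' _ hf' (by simpa using hd)
  · intro e he
    exact pull_sized hH e (by simpa using he)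

lemma card_le_choose {V : Finset ℕ} {H : Finset (Finset ℕ)}
    (hH : ThreeGraphOn V H) : H.card ≤ V.card.choose 3 := by
  rw [← card_powersetCard]
  apply card_le_card
  intro e he
  rw [mem_powersetCard]; exact hH e he

lemma ThreeGraphOn.mono {V : Finset ℕ} {H K : Finset (Finset ℕ)}
    (hH : ThreeGraphOn V H) (h : K ⊆ H) : ThreeGraphOn V K := fun e he => hH e (h he)


set_option synthInstance.maxSize 100000 in
set_option synthInstance.maxHeartbeats 0 in
set_option maxRecDepth 100000 in
set_option maxHeartbeats 0 in
lemma c8_bool : ∀ a0 a1 a2 a3 a4 a5 a6 a7 : Bool,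
    (a0 && a3 && a6 && a2) = false →
    (a0 && a3 && a7 && a2) = false →
    (a0 && a5 && a1 && a6) = false →
    (a0 && a5 && a2 && a7) = false →
    (a1 && a4 && a0 && a3) = false →
    (a1 && a4 && a7 && a2) = false →
    (a1 && a6 && a2 && a7) = false →
    (a1 && a6 && a3 && a7) = false →
    (a2 && a5 && a0 && a3) = false →
    (a2 && a5 && a0 && a4) = false →
    (a2 && a5 && a1 && a4) = false →
    (a2 && a6 && a1 && a4) = false →
    (a3 && a6 && a1 && a5) = false →
    (a3 && a6 && a2 && a5) = false →
    (a3 && a7 && a2 && a5) = false →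
    (a4 && a7 && a2 && a6) = false →
    (a4 && a7 && a3 && a6) = false →
    (a5 && a0 && a3 && a6) = false →
    (a5 && a0 && a3 && a7) = false →
    (a5 && a0 && a4 && a7) = false →
    (a5 && a1 && a4 && a7) = false →
    (a6 && a1 && a4 && a7) = false →
    a0.toNat + a1.toNat + a2.toNat + a3.toNat + a4.toNat + a5.toNat + a6.toNat + a7.toNat ≤ 4 := by
  decide +kernel

def cyc8 : Fin 7 → Fin 8 → Fin 8 :=
  ![![0,1,2,3,4,5,6,7], ![0,1,3,4,7,2,5,6], ![0,2,3,6,1,4,7,5], ![0,1,5,3,2,7,6,4],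
    ![0,4,3,6,5,1,2,7], ![0,3,7,1,5,4,2,6], ![0,4,2,1,6,7,3,5]]

def arc8 (c : Fin 7) (i : Fin 8) : Finset (Fin 8) := {cyc8 c i, cyc8 c (i+1), cyc8 c (i+2)}

lemma arc8_disj : ∀ c : Fin 7, ∀ i j : Fin 8, Disjoint (arc8 c i) (arc8 c j) ↔
    (j - i = 3 ∨ j - i = 4 ∨ j - i = 5) := by
  decide +kernel

lemma arc8_surj : ∀ e ∈ powersetCard 3 (univ : Finset (Fin 8)), ∃ c i, arc8 c i = e := by
  decide +kernel

lemma m8_cycle (H : Finset (Finset (Fin 8))) (hp : PF H) (c : Fin 7) :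
    (univ.filter (fun i => arc8 c i ∈ H)).card ≤ 4 := by
  have K : ∀ i j k l : Fin 8, ((j - i = 3 ∨ j - i = 4 ∨ j - i = 5) ∧
     (k - j = 3 ∨ k - j = 4 ∨ k - j = 5) ∧ (l - k = 3 ∨ l - k = 4 ∨ l - k = 5) ∧
     ¬ (k - i = 3 ∨ k - i = 4 ∨ k - i = 5) ∧ ¬ (l - j = 3 ∨ l - j = 4 ∨ l - j = 5) ∧
     ¬ (l - i = 3 ∨ l - i = 4 ∨ l - i = 5)) →
     (decide (arc8 c i ∈ H) && decide (arc8 c j ∈ H) && decide (arc8 c k ∈ H) &&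
       decide (arc8 c l ∈ H)) = false := by
    intro i j k l ⟨h1, h2, h3, h4, h5, h6⟩
    rw [← arc8_disj c] at h1 h2 h3 h4 h5 h6
    rw [Bool.eq_false_iff]
    intro hh
    simp only [Bool.and_eq_true, decide_eq_true_eq] at hh
    obtain ⟨⟨⟨a, b⟩, d⟩, e⟩ := hh
    exact hp _ a _ b _ d _ e h1 h2 h3 h4 h5 h6
  have := c8_bool _ _ _ _ _ _ _ _
    (K 0 3 6 2 (by decide))
    (K 0 3 7 2 (by decide))
    (K 0 5 1 6 (by decide))
    (K 0 5 2 7 (by decide))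
    (K 1 4 0 3 (by decide))
    (K 1 4 7 2 (by decide))
    (K 1 6 2 7 (by decide))
    (K 1 6 3 7 (by decide))
    (K 2 5 0 3 (by decide))
    (K 2 5 0 4 (by decide))
    (K 2 5 1 4 (by decide))
    (K 2 6 1 4 (by decide))
    (K 3 6 1 5 (by decide))
    (K 3 6 2 5 (by decide))
    (K 3 7 2 5 (by decide))
    (K 4 7 2 6 (by decide))
    (K 4 7 3 6 (by decide))
    (K 5 0 3 6 (by decide))
    (K 5 0 3 7 (by decide))
    (K 5 0 4 7 (by decide))
    (K 5 1 4 7 (by decide))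
    (K 6 1 4 7 (by decide))
  rw [card_filter]
  simp only [Fin.sum_univ_eight]
  refine le_trans (le_of_eq ?_) this
  simp only [Bool.toNat, Bool.cond_decide]

lemma m8_fin (H : Finset (Finset (Fin 8))) (hp : PF H) (h3 : ∀ e ∈ H, e.card = 3) :
    H.card ≤ 28 := by
  have h1 : H ⊆ (univ.biUnion fun c : Fin 7 =>
      (univ.filter (fun i => arc8 c i ∈ H)).image (arc8 c)) := by
    intro e he
    obtain ⟨c, i, rfl⟩ := arc8_surj e (by simp [mem_powersetCard, h3 e he])
    simp only [mem_biUnion, mem_image, mem_filter, mem_univ, true_and]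
    exact ⟨c, i, he, rfl⟩
  refine (card_le_card h1).trans (card_biUnion_le.trans ?_)
  calc _ ≤ ∑ c : Fin 7, 4 := by
        apply sum_le_sum
        intro c _
        exact card_image_le.trans (m8_cycle H hp c)
    _ = 28 := by simp

lemma m8 {V : Finset ℕ} {H : Finset (Finset ℕ)} (hV : V.card = 8)
    (hH : ThreeGraphOn V H) (hp : PF H) : H.card ≤ 28 := by
  obtain ⟨ψ, hψ⟩ := exists_emb hV
  rw [← pull_card hψ hH]
  exact m8_fin _ (pull_pf hp) (pull_sized hH)

set_option linter.unusedVariables false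

def L7 : List (Finset (Fin 7)) := [{0,1,2}, {0,1,3}, {0,1,4}, {0,1,5}, {0,1,6}, {0,2,3}, {0,2,4}, {0,2,5}, {0,2,6}, {0,3,4}, {0,3,5}, {0,3,6}, {0,4,5}, {0,4,6}, {0,5,6}, {1,2,3}, {1,2,4}, {1,2,5}, {1,2,6}, {1,3,4}, {1,3,5}, {1,3,6}, {1,4,5}, {1,4,6}, {1,5,6}, {2,3,4}, {2,3,5}, {2,3,6}, {2,4,5}, {2,4,6}, {2,5,6}, {3,4,5}, {3,4,6}, {3,5,6}, {4,5,6}]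

lemma L7_surj : ∀ e ∈ powersetCard 3 (univ : Finset (Fin 7)), e ∈ L7 := by
  decide +kernel

lemma card_le_list {α : Type*} [DecidableEq α] (l : List α) : ∀ (H : Finset α), (∀ e ∈ H, e ∈ l) →
    H.card ≤ (l.map (fun e => if e ∈ H then 1 else 0)).sum := by
  induction l with
  | nil => intro H h; simp [eq_empty_of_forall_notMem (s := H) (by simpa using h)]
  | cons a l ih =>
    intro H h
    have h1 := ih (H.erase a) (by intro e he; rw [mem_erase] at he; have := h e he.2; simp_all)
    have h2 : (l.map (fun e => if e ∈ H.erase a then 1 else 0)).sum ≤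
        (l.map (fun e => if e ∈ H then 1 else 0)).sum := by
      apply List.sum_le_sum
      intro e _
      by_cases h1 : e ∈ H.erase a
      · simp [h1, (mem_erase.1 h1).2]
      · simp [h1]
    rw [card_erase_eq_ite] at h1
    rw [List.map_cons, List.sum_cons]
    split_ifs at h1 ⊢ <;> omega

def t7 (H : Finset (Finset (Fin 7))) (i j k : Fin 7) : ℕ := if ({i, j, k} : Finset (Fin 7)) ∈ H then 1 else 0

lemma t7_le (H : Finset (Finset (Fin 7))) (i j k : Fin 7) : t7 H i j k ≤ 1 := by
  unfold t7; split_ifs <;> simp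

lemma t7_total (H : Finset (Finset (Fin 7))) (h3 : ∀ e ∈ H, e.card = 3) :
    H.card ≤ t7 H 0 1 2 + t7 H 0 1 3 + t7 H 0 1 4 + t7 H 0 1 5 + t7 H 0 1 6 + t7 H 0 2 3 + t7 H 0 2 4 + t7 H 0 2 5 + t7 H 0 2 6 + t7 H 0 3 4 + t7 H 0 3 5 + t7 H 0 3 6 + t7 H 0 4 5 + t7 H 0 4 6 + t7 H 0 5 6 + t7 H 1 2 3 + t7 H 1 2 4 + t7 H 1 2 5 + t7 H 1 2 6 + t7 H 1 3 4 + t7 H 1 3 5 + t7 H 1 3 6 + t7 H 1 4 5 + t7 H 1 4 6 + t7 H 1 5 6 + t7 H 2 3 4 + t7 H 2 3 5 + t7 H 2 3 6 + t7 H 2 4 5 + t7 H 2 4 6 + t7 H 2 5 6 + t7 H 3 4 5 + t7 H 3 4 6 + t7 H 3 5 6 + t7 H 4 5 6 := by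
  have h := card_le_list L7 H (fun e he => L7_surj e (by simp [mem_powersetCard, h3 e he]))
  refine h.trans (le_of_eq ?_)
  unfold L7 t7
  simp only [List.map_cons, List.sum_cons, List.map_nil, List.sum_nil, add_zero, add_assoc]

lemma t7_path {H : Finset (Finset (Fin 7))} (hp : PF H) (a b c d e f g h i j k l : Fin 7)
    (hh : Disjoint ({a,b,c} : Finset (Fin 7)) {d,e,f} ∧ Disjoint ({d,e,f} : Finset (Fin 7)) {g,h,i} ∧
      Disjoint ({g,h,i} : Finset (Fin 7)) {j,k,l} ∧ ¬ Disjoint ({a,b,c} : Finset (Fin 7)) {g,h,i} ∧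
      ¬ Disjoint ({d,e,f} : Finset (Fin 7)) {j,k,l} ∧ ¬ Disjoint ({a,b,c} : Finset (Fin 7)) {j,k,l}) :
    t7 H a b c + t7 H d e f + t7 H g h i + t7 H j k l ≤ 3 := by
  obtain ⟨h1, h2, h3, h4, h5, h6⟩ := hh
  unfold t7
  split_ifs <;> first | omega | (exfalso; exact hp _ ‹_› _ ‹_› _ ‹_› _ ‹_› h1 h2 h3 h4 h5 h6)

lemma c6sum (x1 x2 x3 x4 x5 x6 : ℕ) (h1 : x1+x2+x3+x4 ≤ 3) (h2 : x2+x3+x4+x5 ≤ 3)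
    (h3 : x3+x4+x5+x6 ≤ 3) (h4 : x4+x5+x6+x1 ≤ 3) (h5 : x5+x6+x1+x2 ≤ 3)
    (h6 : x6+x1+x2+x3 ≤ 3) : x1+x2+x3+x4+x5+x6 ≤ 4 := by omega

lemma ab_lem (a1 a2 a3 b1 b2 b3 u1 u2 u3 w1 w2 w3 : ℕ)
    (ha1 : a1 ≤ 1) (ha2 : a2 ≤ 1) (ha3 : a3 ≤ 1) (hb1 : b1 ≤ 1) (hb2 : b2 ≤ 1) (hb3 : b3 ≤ 1)
    (hu1 : u1 ≤ 1) (hu2 : u2 ≤ 1) (hu3 : u3 ≤ 1) (hw1 : w1 ≤ 1) (hw2 : w2 ≤ 1) (hw3 : w3 ≤ 1)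
    (h1 : w1 + a1 + b2 + u2 ≤ 3)
    (h2 : w1 + a1 + b3 + u3 ≤ 3)
    (h3 : w2 + a2 + b1 + u1 ≤ 3)
    (h4 : w2 + a2 + b3 + u3 ≤ 3)
    (h5 : w3 + a3 + b1 + u1 ≤ 3)
    (h6 : w3 + a3 + b2 + u2 ≤ 3)
    (h7 : u1 + b1 + a2 + b3 ≤ 3)
    (h8 : w1 + a1 + b2 + a3 ≤ 3)
    (h9 : u1 + b1 + a3 + b2 ≤ 3)
    (h10 : w1 + a1 + b3 + a2 ≤ 3)
    (h11 : u2 + b2 + a1 + b3 ≤ 3)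
    (h12 : w2 + a2 + b1 + a3 ≤ 3)
    (h13 : u2 + b2 + a3 + b1 ≤ 3)
    (h14 : w2 + a2 + b3 + a1 ≤ 3)
    (h15 : u3 + b3 + a1 + b2 ≤ 3)
    (h16 : w3 + a3 + b1 + a2 ≤ 3)
    (h17 : u3 + b3 + a2 + b1 ≤ 3)
    (h18 : w3 + a3 + b2 + a1 ≤ 3)
    (h : 5 ≤ u1+u2+u3+w1+w2+w3) : a1+a2+a3+b1+b2+b3 ≤ 3 := by
  have e1 : u1 = 0 ∨ u1 = 1 := by omega
  have e2 : u2 = 0 ∨ u2 = 1 := by omega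
  have e3 : u3 = 0 ∨ u3 = 1 := by omega
  have e4 : w1 = 0 ∨ w1 = 1 := by omega
  have e5 : w2 = 0 ∨ w2 = 1 := by omega
  have e6 : w3 = 0 ∨ w3 = 1 := by omega
  rcases e1 with rfl | rfl <;> rcases e2 with rfl | rfl <;> rcases e3 with rfl | rfl <;>
  rcases e4 with rfl | rfl <;> rcases e5 with rfl | rfl <;> rcases e6 with rfl | rfl <;>
  first | (exfalso; clear * - h; omega) | omega

set_option maxHeartbeats 1000000 in
lemma m7_ii_fin (H : Finset (Finset (Fin 7))) (hp : PF H) (h3 : ∀ e ∈ H, e.card = 3)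
    (hB : {3,4,5} ∈ H) (hA : {0,1,2} ∈ H) (hA' : {0,1,6} ∈ H) : H.card ≤ 19 := by
  have tot := t7_total H h3
  have l1 : t7 H 3 4 5 = 1 := by simp [t7, hB]
  have l2 : t7 H 0 1 2 = 1 := by simp [t7, hA]
  have l3 : t7 H 0 1 6 = 1 := by simp [t7, hA']
  have spq := c6sum _ _ _ _ _ _ (t7_path hp 0 1 3 2 4 6 0 1 5 2 3 6 (by decide)) (t7_path hp 2 4 6 0 1 5 2 3 6 0 1 4 (by decide)) (t7_path hp 0 1 5 2 3 6 0 1 4 2 5 6 (by decide)) (t7_path hp 2 3 6 0 1 4 2 5 6 0 1 3 (by decide)) (t7_path hp 0 1 4 2 5 6 0 1 3 2 4 6 (by decide)) (t7_path hp 2 5 6 0 1 3 2 4 6 0 1 5 (by decide))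
  have sab := c6sum _ _ _ _ _ _ (t7_path hp 0 2 3 1 4 6 0 2 5 1 3 6 (by decide)) (t7_path hp 1 4 6 0 2 5 1 3 6 0 2 4 (by decide)) (t7_path hp 0 2 5 1 3 6 0 2 4 1 5 6 (by decide)) (t7_path hp 1 3 6 0 2 4 1 5 6 0 2 3 (by decide)) (t7_path hp 0 2 4 1 5 6 0 2 3 1 4 6 (by decide)) (t7_path hp 1 5 6 0 2 3 1 4 6 0 2 5 (by decide))
  have scd := c6sum _ _ _ _ _ _ (t7_path hp 0 3 6 1 2 4 0 5 6 1 2 3 (by decide)) (t7_path hp 1 2 4 0 5 6 1 2 3 0 4 6 (by decide)) (t7_path hp 0 5 6 1 2 3 0 4 6 1 2 5 (by decide)) (t7_path hp 1 2 3 0 4 6 1 2 5 0 3 6 (by decide)) (t7_path hp 0 4 6 1 2 5 0 3 6 1 2 4 (by decide)) (t7_path hp 1 2 5 0 3 6 1 2 4 0 5 6 (by decide))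
  have k1 := t7_path hp 0 1 2 3 4 5 1 2 6 0 3 4 (by decide)
  have k2 := t7_path hp 0 1 2 3 4 5 1 2 6 0 3 5 (by decide)
  have k3 := t7_path hp 0 1 2 3 4 5 1 2 6 0 4 5 (by decide)
  have k4 := t7_path hp 0 1 2 3 4 5 0 2 6 1 3 4 (by decide)
  have k5 := t7_path hp 0 1 2 3 4 5 0 2 6 1 3 5 (by decide)
  have k6 := t7_path hp 0 1 2 3 4 5 0 2 6 1 4 5 (by decide)
  have k7 := t7_path hp 0 1 2 3 4 5 0 1 6 2 3 4 (by decide)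
  have k8 := t7_path hp 0 1 2 3 4 5 0 1 6 2 3 5 (by decide)
  have k9 := t7_path hp 0 1 2 3 4 5 0 1 6 2 4 5 (by decide)
  have k10 := t7_path hp 0 1 6 3 4 5 0 1 2 3 4 6 (by decide)
  have k11 := t7_path hp 0 1 6 3 4 5 0 1 2 3 5 6 (by decide)
  have k12 := t7_path hp 0 1 6 3 4 5 0 1 2 4 5 6 (by decide)
  have lq0 := t7_le H 1 2 6
  have lu03 := t7_le H 0 4 5
  have lu04 := t7_le H 0 3 5
  have lu05 := t7_le H 0 3 4
  have lq1 := t7_le H 0 2 6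
  have lu13 := t7_le H 1 4 5
  have lu14 := t7_le H 1 3 5
  have lu15 := t7_le H 1 3 4
  by_cases hq : 1 ≤ t7 H 1 2 6 + t7 H 0 2 6
  · omega
  by_cases hs : t7 H 0 4 5 + t7 H 0 3 5 + t7 H 0 3 4 + t7 H 1 4 5 + t7 H 1 3 5 + t7 H 1 3 4 ≤ 4
  · omega
  have zab := ab_lem _ _ _ _ _ _ _ _ _ _ _ _ (t7_le H 0 2 3) (t7_le H 0 2 4) (t7_le H 0 2 5) (t7_le H 1 3 6) (t7_le H 1 4 6) (t7_le H 1 5 6) (t7_le H 0 4 5) (t7_le H 0 3 5) (t7_le H 0 3 4) (t7_le H 1 4 5) (t7_le H 1 3 5) (t7_le H 1 3 4) 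
    (t7_path hp 1 4 5 0 2 3 1 4 6 0 3 5 (by decide))
    (t7_path hp 1 4 5 0 2 3 1 5 6 0 3 4 (by decide))
    (t7_path hp 1 3 5 0 2 4 1 3 6 0 4 5 (by decide))
    (t7_path hp 1 3 5 0 2 4 1 5 6 0 3 4 (by decide))
    (t7_path hp 1 3 4 0 2 5 1 3 6 0 4 5 (by decide))
    (t7_path hp 1 3 4 0 2 5 1 4 6 0 3 5 (by decide))
    (t7_path hp 0 4 5 1 3 6 0 2 4 1 5 6 (by decide))
    (t7_path hp 1 4 5 0 2 3 1 4 6 0 2 5 (by decide))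
    (t7_path hp 0 4 5 1 3 6 0 2 5 1 4 6 (by decide))
    (t7_path hp 1 4 5 0 2 3 1 5 6 0 2 4 (by decide))
    (t7_path hp 0 3 5 1 4 6 0 2 3 1 5 6 (by decide))
    (t7_path hp 1 3 5 0 2 4 1 3 6 0 2 5 (by decide))
    (t7_path hp 0 3 5 1 4 6 0 2 5 1 3 6 (by decide))
    (t7_path hp 1 3 5 0 2 4 1 5 6 0 2 3 (by decide))
    (t7_path hp 0 3 4 1 5 6 0 2 3 1 4 6 (by decide))
    (t7_path hp 1 3 4 0 2 5 1 3 6 0 2 4 (by decide))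
    (t7_path hp 0 3 4 1 5 6 0 2 4 1 3 6 (by decide))
    (t7_path hp 1 3 4 0 2 5 1 4 6 0 2 3 (by decide))
    (by omega)
  have zcd := ab_lem _ _ _ _ _ _ _ _ _ _ _ _ (t7_le H 0 3 6) (t7_le H 0 4 6) (t7_le H 0 5 6) (t7_le H 1 2 3) (t7_le H 1 2 4) (t7_le H 1 2 5) (t7_le H 0 4 5) (t7_le H 0 3 5) (t7_le H 0 3 4) (t7_le H 1 4 5) (t7_le H 1 3 5) (t7_le H 1 3 4) 
    (t7_path hp 1 4 5 0 3 6 1 2 4 0 3 5 (by decide))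
    (t7_path hp 1 4 5 0 3 6 1 2 5 0 3 4 (by decide))
    (t7_path hp 1 3 5 0 4 6 1 2 3 0 4 5 (by decide))
    (t7_path hp 1 3 5 0 4 6 1 2 5 0 3 4 (by decide))
    (t7_path hp 1 3 4 0 5 6 1 2 3 0 4 5 (by decide))
    (t7_path hp 1 3 4 0 5 6 1 2 4 0 3 5 (by decide))
    (t7_path hp 0 4 5 1 2 3 0 4 6 1 2 5 (by decide))
    (t7_path hp 1 4 5 0 3 6 1 2 4 0 5 6 (by decide))
    (t7_path hp 0 4 5 1 2 3 0 5 6 1 2 4 (by decide))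
    (t7_path hp 1 4 5 0 3 6 1 2 5 0 4 6 (by decide))
    (t7_path hp 0 3 5 1 2 4 0 3 6 1 2 5 (by decide))
    (t7_path hp 1 3 5 0 4 6 1 2 3 0 5 6 (by decide))
    (t7_path hp 0 3 5 1 2 4 0 5 6 1 2 3 (by decide))
    (t7_path hp 1 3 5 0 4 6 1 2 5 0 3 6 (by decide))
    (t7_path hp 0 3 4 1 2 5 0 3 6 1 2 4 (by decide))
    (t7_path hp 1 3 4 0 5 6 1 2 3 0 4 6 (by decide))
    (t7_path hp 0 3 4 1 2 5 0 4 6 1 2 3 (by decide))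
    (t7_path hp 1 3 4 0 5 6 1 2 4 0 3 6 (by decide))
    (by omega)
  omega

set_option linter.unusedVariables false

lemma t7_match {H : Finset (Finset (Fin 7))} (hm : ∀ X ∈ H, ∀ Y ∈ H, ∀ Z ∈ H, Disjoint X Y → Disjoint Y Z → X = Z)
    (a b c d e f g h i : Fin 7)
    (hh : Disjoint ({a,b,c} : Finset (Fin 7)) {d,e,f} ∧ Disjoint ({d,e,f} : Finset (Fin 7)) {g,h,i} ∧
      ({a,b,c} : Finset (Fin 7)) ≠ {g,h,i}) :
    t7 H a b c + t7 H d e f + t7 H g h i ≤ 2 := by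
  obtain ⟨h1, h2, h3⟩ := hh
  unfold t7
  split_ifs <;> first | omega | (exfalso; exact h3 (hm _ ‹_› _ ‹_› _ ‹_› h1 h2))

lemma c6sum' (x1 x2 x3 x4 x5 x6 : ℕ) (h1 : x1+x2+x3 ≤ 2) (h2 : x2+x3+x4 ≤ 2)
    (h3 : x3+x4+x5 ≤ 2) (h4 : x4+x5+x6 ≤ 2) (h5 : x5+x6+x1 ≤ 2)
    (h6 : x6+x1+x2 ≤ 2) : x1+x2+x3+x4+x5+x6 ≤ 4 := by omega

set_option maxHeartbeats 1000000 in
lemma rook (s00 z00 s01 z01 s02 z02 s10 z10 s11 z11 s12 z12 s20 z20 s21 z21 s22 z22 : ℕ)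
    (l00 : s00 ≤ 2) (m00 : z00 ≤ 1)
    (l01 : s01 ≤ 2) (m01 : z01 ≤ 1)
    (l02 : s02 ≤ 2) (m02 : z02 ≤ 1)
    (l10 : s10 ≤ 2) (m10 : z10 ≤ 1)
    (l11 : s11 ≤ 2) (m11 : z11 ≤ 1)
    (l12 : s12 ≤ 2) (m12 : z12 ≤ 1)
    (l20 : s20 ≤ 2) (m20 : z20 ≤ 1)
    (l21 : s21 ≤ 2) (m21 : z21 ≤ 1)
    (l22 : s22 ≤ 2) (m22 : z22 ≤ 1)
    (h0001 : s00 + z01 ≤ 2)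
    (h0002 : s00 + z02 ≤ 2)
    (h0010 : s00 + z10 ≤ 2)
    (h0020 : s00 + z20 ≤ 2)
    (h0100 : s01 + z00 ≤ 2)
    (h0102 : s01 + z02 ≤ 2)
    (h0111 : s01 + z11 ≤ 2)
    (h0121 : s01 + z21 ≤ 2)
    (h0200 : s02 + z00 ≤ 2)
    (h0201 : s02 + z01 ≤ 2)
    (h0212 : s02 + z12 ≤ 2)
    (h0222 : s02 + z22 ≤ 2)
    (h1000 : s10 + z00 ≤ 2)
    (h1011 : s10 + z11 ≤ 2)
    (h1012 : s10 + z12 ≤ 2)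
    (h1020 : s10 + z20 ≤ 2)
    (h1101 : s11 + z01 ≤ 2)
    (h1110 : s11 + z10 ≤ 2)
    (h1112 : s11 + z12 ≤ 2)
    (h1121 : s11 + z21 ≤ 2)
    (h1202 : s12 + z02 ≤ 2)
    (h1210 : s12 + z10 ≤ 2)
    (h1211 : s12 + z11 ≤ 2)
    (h1222 : s12 + z22 ≤ 2)
    (h2000 : s20 + z00 ≤ 2)
    (h2010 : s20 + z10 ≤ 2)
    (h2021 : s20 + z21 ≤ 2)
    (h2022 : s20 + z22 ≤ 2)
    (h2101 : s21 + z01 ≤ 2)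
    (h2111 : s21 + z11 ≤ 2)
    (h2120 : s21 + z20 ≤ 2)
    (h2122 : s21 + z22 ≤ 2)
    (h2202 : s22 + z02 ≤ 2)
    (h2212 : s22 + z12 ≤ 2)
    (h2220 : s22 + z20 ≤ 2)
    (h2221 : s22 + z21 ≤ 2)
    (h1 : 1 ≤ z00 + z01 + z02 + z10 + z11 + z12 + z20 + z21 + z22) (h6 : z00 + z01 + z02 + z10 + z11 + z12 + z20 + z21 + z22 ≤ 6) : s00 + s01 + s02 + s10 + s11 + s12 + s20 + s21 + s22 + (z00 + z01 + z02 + z10 + z11 + z12 + z20 + z21 + z22) ≤ 17 := by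
  by_cases c0001 : z00 + z01 = 2
  · have e1 : z00 = 1 := by clear * - m00 m01 c0001; omega
    have e2 : z01 = 1 := by clear * - m00 m01 c0001; omega
    have : s00 + s01 + s02 + s10 + s11 + s12 + s20 + s21 + s22 ≤ 11 := by clear * - h0001 h0100 h0200 h0201 h1000 h1101 h2000 h2101 l00 l01 l02 l10 l11 l12 l20 l21 l22 e1 e2; omega
    clear * - this h6; omega
  by_cases c0002 : z00 + z02 = 2
  · have e1 : z00 = 1 := by clear * - m00 m02 c0002; omega
    have e2 : z02 = 1 := by clear * - m00 m02 c0002; omega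
    have : s00 + s01 + s02 + s10 + s11 + s12 + s20 + s21 + s22 ≤ 11 := by clear * - h0002 h0100 h0102 h0200 h1000 h1202 h2000 h2202 l00 l01 l02 l10 l11 l12 l20 l21 l22 e1 e2; omega
    clear * - this h6; omega
  by_cases c0010 : z00 + z10 = 2
  · have e1 : z00 = 1 := by clear * - m00 m10 c0010; omega
    have e2 : z10 = 1 := by clear * - m00 m10 c0010; omega
    have : s00 + s01 + s02 + s10 + s11 + s12 + s20 + s21 + s22 ≤ 11 := by clear * - h0010 h0100 h0200 h1000 h1110 h1210 h2000 h2010 l00 l01 l02 l10 l11 l12 l20 l21 l22 e1 e2; omega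
    clear * - this h6; omega
  by_cases c0020 : z00 + z20 = 2
  · have e1 : z00 = 1 := by clear * - m00 m20 c0020; omega
    have e2 : z20 = 1 := by clear * - m00 m20 c0020; omega
    have : s00 + s01 + s02 + s10 + s11 + s12 + s20 + s21 + s22 ≤ 11 := by clear * - h0020 h0100 h0200 h1000 h1020 h2000 h2120 h2220 l00 l01 l02 l10 l11 l12 l20 l21 l22 e1 e2; omega
    clear * - this h6; omega
  by_cases c0102 : z01 + z02 = 2
  · have e1 : z01 = 1 := by clear * - m01 m02 c0102; omega
    have e2 : z02 = 1 := by clear * - m01 m02 c0102; omega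
    have : s00 + s01 + s02 + s10 + s11 + s12 + s20 + s21 + s22 ≤ 11 := by clear * - h0001 h0002 h0102 h0201 h1101 h1202 h2101 h2202 l00 l01 l02 l10 l11 l12 l20 l21 l22 e1 e2; omega
    clear * - this h6; omega
  by_cases c0111 : z01 + z11 = 2
  · have e1 : z01 = 1 := by clear * - m01 m11 c0111; omega
    have e2 : z11 = 1 := by clear * - m01 m11 c0111; omega
    have : s00 + s01 + s02 + s10 + s11 + s12 + s20 + s21 + s22 ≤ 11 := by clear * - h0001 h0111 h0201 h1011 h1101 h1211 h2101 h2111 l00 l01 l02 l10 l11 l12 l20 l21 l22 e1 e2; omega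
    clear * - this h6; omega
  by_cases c0121 : z01 + z21 = 2
  · have e1 : z01 = 1 := by clear * - m01 m21 c0121; omega
    have e2 : z21 = 1 := by clear * - m01 m21 c0121; omega
    have : s00 + s01 + s02 + s10 + s11 + s12 + s20 + s21 + s22 ≤ 11 := by clear * - h0001 h0121 h0201 h1101 h1121 h2021 h2101 h2221 l00 l01 l02 l10 l11 l12 l20 l21 l22 e1 e2; omega
    clear * - this h6; omega
  by_cases c0212 : z02 + z12 = 2
  · have e1 : z02 = 1 := by clear * - m02 m12 c0212; omega
    have e2 : z12 = 1 := by clear * - m02 m12 c0212; omega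
    have : s00 + s01 + s02 + s10 + s11 + s12 + s20 + s21 + s22 ≤ 11 := by clear * - h0002 h0102 h0212 h1012 h1112 h1202 h2202 h2212 l00 l01 l02 l10 l11 l12 l20 l21 l22 e1 e2; omega
    clear * - this h6; omega
  by_cases c0222 : z02 + z22 = 2
  · have e1 : z02 = 1 := by clear * - m02 m22 c0222; omega
    have e2 : z22 = 1 := by clear * - m02 m22 c0222; omega
    have : s00 + s01 + s02 + s10 + s11 + s12 + s20 + s21 + s22 ≤ 11 := by clear * - h0002 h0102 h0222 h1202 h1222 h2022 h2122 h2202 l00 l01 l02 l10 l11 l12 l20 l21 l22 e1 e2; omega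
    clear * - this h6; omega
  by_cases c1011 : z10 + z11 = 2
  · have e1 : z10 = 1 := by clear * - m10 m11 c1011; omega
    have e2 : z11 = 1 := by clear * - m10 m11 c1011; omega
    have : s00 + s01 + s02 + s10 + s11 + s12 + s20 + s21 + s22 ≤ 11 := by clear * - h0010 h0111 h1011 h1110 h1210 h1211 h2010 h2111 l00 l01 l02 l10 l11 l12 l20 l21 l22 e1 e2; omega
    clear * - this h6; omega
  by_cases c1012 : z10 + z12 = 2
  · have e1 : z10 = 1 := by clear * - m10 m12 c1012; omega
    have e2 : z12 = 1 := by clear * - m10 m12 c1012; omega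
    have : s00 + s01 + s02 + s10 + s11 + s12 + s20 + s21 + s22 ≤ 11 := by clear * - h0010 h0212 h1012 h1110 h1112 h1210 h2010 h2212 l00 l01 l02 l10 l11 l12 l20 l21 l22 e1 e2; omega
    clear * - this h6; omega
  by_cases c1020 : z10 + z20 = 2
  · have e1 : z10 = 1 := by clear * - m10 m20 c1020; omega
    have e2 : z20 = 1 := by clear * - m10 m20 c1020; omega
    have : s00 + s01 + s02 + s10 + s11 + s12 + s20 + s21 + s22 ≤ 11 := by clear * - h0010 h0020 h1020 h1110 h1210 h2010 h2120 h2220 l00 l01 l02 l10 l11 l12 l20 l21 l22 e1 e2; omega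
    clear * - this h6; omega
  by_cases c1112 : z11 + z12 = 2
  · have e1 : z11 = 1 := by clear * - m11 m12 c1112; omega
    have e2 : z12 = 1 := by clear * - m11 m12 c1112; omega
    have : s00 + s01 + s02 + s10 + s11 + s12 + s20 + s21 + s22 ≤ 11 := by clear * - h0111 h0212 h1011 h1012 h1112 h1211 h2111 h2212 l00 l01 l02 l10 l11 l12 l20 l21 l22 e1 e2; omega
    clear * - this h6; omega
  by_cases c1121 : z11 + z21 = 2
  · have e1 : z11 = 1 := by clear * - m11 m21 c1121; omega
    have e2 : z21 = 1 := by clear * - m11 m21 c1121; omega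
    have : s00 + s01 + s02 + s10 + s11 + s12 + s20 + s21 + s22 ≤ 11 := by clear * - h0111 h0121 h1011 h1121 h1211 h2021 h2111 h2221 l00 l01 l02 l10 l11 l12 l20 l21 l22 e1 e2; omega
    clear * - this h6; omega
  by_cases c1222 : z12 + z22 = 2
  · have e1 : z12 = 1 := by clear * - m12 m22 c1222; omega
    have e2 : z22 = 1 := by clear * - m12 m22 c1222; omega
    have : s00 + s01 + s02 + s10 + s11 + s12 + s20 + s21 + s22 ≤ 11 := by clear * - h0212 h0222 h1012 h1112 h1222 h2022 h2122 h2212 l00 l01 l02 l10 l11 l12 l20 l21 l22 e1 e2; omega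
    clear * - this h6; omega
  by_cases c2021 : z20 + z21 = 2
  · have e1 : z20 = 1 := by clear * - m20 m21 c2021; omega
    have e2 : z21 = 1 := by clear * - m20 m21 c2021; omega
    have : s00 + s01 + s02 + s10 + s11 + s12 + s20 + s21 + s22 ≤ 11 := by clear * - h0020 h0121 h1020 h1121 h2021 h2120 h2220 h2221 l00 l01 l02 l10 l11 l12 l20 l21 l22 e1 e2; omega
    clear * - this h6; omega
  by_cases c2022 : z20 + z22 = 2
  · have e1 : z20 = 1 := by clear * - m20 m22 c2022; omega
    have e2 : z22 = 1 := by clear * - m20 m22 c2022; omega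
    have : s00 + s01 + s02 + s10 + s11 + s12 + s20 + s21 + s22 ≤ 11 := by clear * - h0020 h0222 h1020 h1222 h2022 h2120 h2122 h2220 l00 l01 l02 l10 l11 l12 l20 l21 l22 e1 e2; omega
    clear * - this h6; omega
  by_cases c2122 : z21 + z22 = 2
  · have e1 : z21 = 1 := by clear * - m21 m22 c2122; omega
    have e2 : z22 = 1 := by clear * - m21 m22 c2122; omega
    have : s00 + s01 + s02 + s10 + s11 + s12 + s20 + s21 + s22 ≤ 11 := by clear * - h0121 h0222 h1121 h1222 h2021 h2022 h2122 h2221 l00 l01 l02 l10 l11 l12 l20 l21 l22 e1 e2; omega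
    clear * - this h6; omega
  have f00 : z00 = 1 → s00 + s01 + s02 + s10 + s11 + s12 + s20 + s21 + s22 ≤ 14 := by intro e; clear * - e h0100 h0200 h1000 h2000 l00 l01 l02 l10 l11 l12 l20 l21 l22; omega
  have f01 : z01 = 1 → s00 + s01 + s02 + s10 + s11 + s12 + s20 + s21 + s22 ≤ 14 := by intro e; clear * - e h0001 h0201 h1101 h2101 l00 l01 l02 l10 l11 l12 l20 l21 l22; omega
  have f02 : z02 = 1 → s00 + s01 + s02 + s10 + s11 + s12 + s20 + s21 + s22 ≤ 14 := by intro e; clear * - e h0002 h0102 h1202 h2202 l00 l01 l02 l10 l11 l12 l20 l21 l22; omega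
  have f10 : z10 = 1 → s00 + s01 + s02 + s10 + s11 + s12 + s20 + s21 + s22 ≤ 14 := by intro e; clear * - e h0010 h1110 h1210 h2010 l00 l01 l02 l10 l11 l12 l20 l21 l22; omega
  have f11 : z11 = 1 → s00 + s01 + s02 + s10 + s11 + s12 + s20 + s21 + s22 ≤ 14 := by intro e; clear * - e h0111 h1011 h1211 h2111 l00 l01 l02 l10 l11 l12 l20 l21 l22; omega
  have f12 : z12 = 1 → s00 + s01 + s02 + s10 + s11 + s12 + s20 + s21 + s22 ≤ 14 := by intro e; clear * - e h0212 h1012 h1112 h2212 l00 l01 l02 l10 l11 l12 l20 l21 l22; omega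
  have f20 : z20 = 1 → s00 + s01 + s02 + s10 + s11 + s12 + s20 + s21 + s22 ≤ 14 := by intro e; clear * - e h0020 h1020 h2120 h2220 l00 l01 l02 l10 l11 l12 l20 l21 l22; omega
  have f21 : z21 = 1 → s00 + s01 + s02 + s10 + s11 + s12 + s20 + s21 + s22 ≤ 14 := by intro e; clear * - e h0121 h1121 h2021 h2221 l00 l01 l02 l10 l11 l12 l20 l21 l22; omega
  have f22 : z22 = 1 → s00 + s01 + s02 + s10 + s11 + s12 + s20 + s21 + s22 ≤ 14 := by intro e; clear * - e h0222 h1222 h2022 h2122 l00 l01 l02 l10 l11 l12 l20 l21 l22; omega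
  have r0 : z00 + z01 + z02 ≤ 1 := by clear * - c0001 c0002 c0102 m00 m01 m02; omega
  have r1 : z10 + z11 + z12 ≤ 1 := by clear * - c1011 c1012 c1112 m10 m11 m12; omega
  have r2 : z20 + z21 + z22 ≤ 1 := by clear * - c2021 c2022 c2122 m20 m21 m22; omega
  have k : z00 = 1 ∨ z01 = 1 ∨ z02 = 1 ∨ z10 = 1 ∨ z11 = 1 ∨ z12 = 1 ∨ z20 = 1 ∨ z21 = 1 ∨ z22 = 1 := by clear * - h1 m00 m01 m02 m10 m11 m12 m20 m21 m22; omega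
  have kk : s00 + s01 + s02 + s10 + s11 + s12 + s20 + s21 + s22 ≤ 14 := (fun k => Or.elim k f00 (fun k => Or.elim k f01 (fun k => Or.elim k f02 (fun k => Or.elim k f10 (fun k => Or.elim k f11 (fun k => Or.elim k f12 (fun k => Or.elim k f20 (fun k => Or.elim k f21 f22)))))))) k
  clear * - kk r0 r1 r2; omega

set_option maxHeartbeats 1000000 in
lemma m7_iii_fin (H : Finset (Finset (Fin 7))) (h3 : ∀ e ∈ H, e.card = 3)
    (hm : ∀ X ∈ H, ∀ Y ∈ H, ∀ Z ∈ H, Disjoint X Y → Disjoint Y Z → X = Z)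
    (hA : {0,1,2} ∈ H) (hB : {3,4,5} ∈ H) (h6 : ∃ e ∈ H, 6 ∈ e) : H.card ≤ 19 := by
  have tot := t7_total H h3
  have l1 : t7 H 3 4 5 = 1 := by simp [t7, hB]
  have l2 : t7 H 0 1 2 = 1 := by simp [t7, hA]
  have d01 := (t7_match hm 0 1 6 3 4 5 0 1 2 (by decide))
  have d02 := (t7_match hm 0 2 6 3 4 5 0 1 2 (by decide))
  have d12 := (t7_match hm 1 2 6 3 4 5 0 1 2 (by decide))
  have d34 := (t7_match hm 3 4 6 0 1 2 3 4 5 (by decide))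
  have d35 := (t7_match hm 3 5 6 0 1 2 3 4 5 (by decide))
  have d45 := (t7_match hm 4 5 6 0 1 2 3 4 5 (by decide))
  have ex : 1 ≤ t7 H 0 1 6 + t7 H 0 2 6 + t7 H 1 2 6 + t7 H 3 4 6 + t7 H 3 5 6 + t7 H 4 5 6 + t7 H 0 3 6 + t7 H 0 4 6 + t7 H 0 5 6 + t7 H 1 3 6 + t7 H 1 4 6 + t7 H 1 5 6 + t7 H 2 3 6 + t7 H 2 4 6 + t7 H 2 5 6 := by
    obtain ⟨e, he, h6e⟩ := h6
    have := (by decide +kernel : ∀ e ∈ powersetCard 3 (univ : Finset (Fin 7)), 6 ∈ e → e = {0,1,6} ∨ e = {0,2,6} ∨ e = {1,2,6} ∨ e = {3,4,6} ∨ e = {3,5,6} ∨ e = {4,5,6} ∨ e = {0,3,6} ∨ e = {0,4,6} ∨ e = {0,5,6} ∨ e = {1,3,6} ∨ e = {1,4,6} ∨ e = {1,5,6} ∨ e = {2,3,6} ∨ e = {2,4,6} ∨ e = {2,5,6}) e (by simp [mem_powersetCard, h3 e he]) h6e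
    have hh : ∀ i j k : Fin 7, e = {i,j,k} → t7 H i j k = 1 := by
      rintro i j k rfl; simp [t7, he]
    rcases this with h | h | h | h | h | h | h | h | h | h | h | h | h | h | h <;> have := hh _ _ _ h <;> omega
  have rx0 := c6sum' _ _ _ _ _ _ (t7_match hm 1 2 3 0 4 6 1 2 5 (by decide)) (t7_match hm 0 4 6 1 2 5 0 3 6 (by decide)) (t7_match hm 1 2 5 0 3 6 1 2 4 (by decide)) (t7_match hm 0 3 6 1 2 4 0 5 6 (by decide)) (t7_match hm 1 2 4 0 5 6 1 2 3 (by decide)) (t7_match hm 0 5 6 1 2 3 0 4 6 (by decide))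
  have ry0 := c6sum' _ _ _ _ _ _ (t7_match hm 0 4 5 1 3 6 2 4 5 (by decide)) (t7_match hm 1 3 6 2 4 5 0 3 6 (by decide)) (t7_match hm 2 4 5 0 3 6 1 4 5 (by decide)) (t7_match hm 0 3 6 1 4 5 2 3 6 (by decide)) (t7_match hm 1 4 5 2 3 6 0 4 5 (by decide)) (t7_match hm 2 3 6 0 4 5 1 3 6 (by decide))
  have rx1 := c6sum' _ _ _ _ _ _ (t7_match hm 0 2 3 1 4 6 0 2 5 (by decide)) (t7_match hm 1 4 6 0 2 5 1 3 6 (by decide)) (t7_match hm 0 2 5 1 3 6 0 2 4 (by decide)) (t7_match hm 1 3 6 0 2 4 1 5 6 (by decide)) (t7_match hm 0 2 4 1 5 6 0 2 3 (by decide)) (t7_match hm 1 5 6 0 2 3 1 4 6 (by decide))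
  have ry1 := c6sum' _ _ _ _ _ _ (t7_match hm 0 3 5 1 4 6 2 3 5 (by decide)) (t7_match hm 1 4 6 2 3 5 0 4 6 (by decide)) (t7_match hm 2 3 5 0 4 6 1 3 5 (by decide)) (t7_match hm 0 4 6 1 3 5 2 4 6 (by decide)) (t7_match hm 1 3 5 2 4 6 0 3 5 (by decide)) (t7_match hm 2 4 6 0 3 5 1 4 6 (by decide))
  have rx2 := c6sum' _ _ _ _ _ _ (t7_match hm 0 1 3 2 4 6 0 1 5 (by decide)) (t7_match hm 2 4 6 0 1 5 2 3 6 (by decide)) (t7_match hm 0 1 5 2 3 6 0 1 4 (by decide)) (t7_match hm 2 3 6 0 1 4 2 5 6 (by decide)) (t7_match hm 0 1 4 2 5 6 0 1 3 (by decide)) (t7_match hm 2 5 6 0 1 3 2 4 6 (by decide))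
  have ry2 := c6sum' _ _ _ _ _ _ (t7_match hm 0 3 4 1 5 6 2 3 4 (by decide)) (t7_match hm 1 5 6 2 3 4 0 5 6 (by decide)) (t7_match hm 2 3 4 0 5 6 1 3 4 (by decide)) (t7_match hm 0 5 6 1 3 4 2 5 6 (by decide)) (t7_match hm 1 3 4 2 5 6 0 3 4 (by decide)) (t7_match hm 2 5 6 0 3 4 1 5 6 (by decide))
  by_cases hz : t7 H 0 3 6 + t7 H 0 4 6 + t7 H 0 5 6 + t7 H 1 3 6 + t7 H 1 4 6 + t7 H 1 5 6 + t7 H 2 3 6 + t7 H 2 4 6 + t7 H 2 5 6 ≤ 6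
  · have := rook (t7 H 1 2 3 + t7 H 0 4 5) (t7 H 0 3 6) (t7 H 1 2 4 + t7 H 0 3 5) (t7 H 0 4 6) (t7 H 1 2 5 + t7 H 0 3 4) (t7 H 0 5 6) (t7 H 0 2 3 + t7 H 1 4 5) (t7 H 1 3 6) (t7 H 0 2 4 + t7 H 1 3 5) (t7 H 1 4 6) (t7 H 0 2 5 + t7 H 1 3 4) (t7 H 1 5 6) (t7 H 0 1 3 + t7 H 2 4 5) (t7 H 2 3 6) (t7 H 0 1 4 + t7 H 2 3 5) (t7 H 2 4 6) (t7 H 0 1 5 + t7 H 2 3 4) (t7 H 2 5 6)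
      (add_le_add (t7_le H 1 2 3) (t7_le H 0 4 5)) (t7_le H 0 3 6)
      (add_le_add (t7_le H 1 2 4) (t7_le H 0 3 5)) (t7_le H 0 4 6)
      (add_le_add (t7_le H 1 2 5) (t7_le H 0 3 4)) (t7_le H 0 5 6)
      (add_le_add (t7_le H 0 2 3) (t7_le H 1 4 5)) (t7_le H 1 3 6)
      (add_le_add (t7_le H 0 2 4) (t7_le H 1 3 5)) (t7_le H 1 4 6)
      (add_le_add (t7_le H 0 2 5) (t7_le H 1 3 4)) (t7_le H 1 5 6)
      (add_le_add (t7_le H 0 1 3) (t7_le H 2 4 5)) (t7_le H 2 3 6)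
      (add_le_add (t7_le H 0 1 4) (t7_le H 2 3 5)) (t7_le H 2 4 6)
      (add_le_add (t7_le H 0 1 5) (t7_le H 2 3 4)) (t7_le H 2 5 6)
      (le_trans (le_of_eq (by ring)) (t7_match hm 0 4 5 1 2 3 0 4 6 (by decide)))
      (le_trans (le_of_eq (by ring)) (t7_match hm 0 4 5 1 2 3 0 5 6 (by decide)))
      (le_trans (le_of_eq (by ring)) (t7_match hm 1 2 3 0 4 5 1 3 6 (by decide)))
      (le_trans (le_of_eq (by ring)) (t7_match hm 1 2 3 0 4 5 2 3 6 (by decide)))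
      (le_trans (le_of_eq (by ring)) (t7_match hm 0 3 5 1 2 4 0 3 6 (by decide)))
      (le_trans (le_of_eq (by ring)) (t7_match hm 0 3 5 1 2 4 0 5 6 (by decide)))
      (le_trans (le_of_eq (by ring)) (t7_match hm 1 2 4 0 3 5 1 4 6 (by decide)))
      (le_trans (le_of_eq (by ring)) (t7_match hm 1 2 4 0 3 5 2 4 6 (by decide)))
      (le_trans (le_of_eq (by ring)) (t7_match hm 0 3 4 1 2 5 0 3 6 (by decide)))
      (le_trans (le_of_eq (by ring)) (t7_match hm 0 3 4 1 2 5 0 4 6 (by decide)))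
      (le_trans (le_of_eq (by ring)) (t7_match hm 1 2 5 0 3 4 1 5 6 (by decide)))
      (le_trans (le_of_eq (by ring)) (t7_match hm 1 2 5 0 3 4 2 5 6 (by decide)))
      (le_trans (le_of_eq (by ring)) (t7_match hm 0 2 3 1 4 5 0 3 6 (by decide)))
      (le_trans (le_of_eq (by ring)) (t7_match hm 1 4 5 0 2 3 1 4 6 (by decide)))
      (le_trans (le_of_eq (by ring)) (t7_match hm 1 4 5 0 2 3 1 5 6 (by decide)))
      (le_trans (le_of_eq (by ring)) (t7_match hm 0 2 3 1 4 5 2 3 6 (by decide)))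
      (le_trans (le_of_eq (by ring)) (t7_match hm 0 2 4 1 3 5 0 4 6 (by decide)))
      (le_trans (le_of_eq (by ring)) (t7_match hm 1 3 5 0 2 4 1 3 6 (by decide)))
      (le_trans (le_of_eq (by ring)) (t7_match hm 1 3 5 0 2 4 1 5 6 (by decide)))
      (le_trans (le_of_eq (by ring)) (t7_match hm 0 2 4 1 3 5 2 4 6 (by decide)))
      (le_trans (le_of_eq (by ring)) (t7_match hm 0 2 5 1 3 4 0 5 6 (by decide)))
      (le_trans (le_of_eq (by ring)) (t7_match hm 1 3 4 0 2 5 1 3 6 (by decide)))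
      (le_trans (le_of_eq (by ring)) (t7_match hm 1 3 4 0 2 5 1 4 6 (by decide)))
      (le_trans (le_of_eq (by ring)) (t7_match hm 0 2 5 1 3 4 2 5 6 (by decide)))
      (le_trans (le_of_eq (by ring)) (t7_match hm 0 1 3 2 4 5 0 3 6 (by decide)))
      (le_trans (le_of_eq (by ring)) (t7_match hm 0 1 3 2 4 5 1 3 6 (by decide)))
      (le_trans (le_of_eq (by ring)) (t7_match hm 2 4 5 0 1 3 2 4 6 (by decide)))
      (le_trans (le_of_eq (by ring)) (t7_match hm 2 4 5 0 1 3 2 5 6 (by decide)))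
      (le_trans (le_of_eq (by ring)) (t7_match hm 0 1 4 2 3 5 0 4 6 (by decide)))
      (le_trans (le_of_eq (by ring)) (t7_match hm 0 1 4 2 3 5 1 4 6 (by decide)))
      (le_trans (le_of_eq (by ring)) (t7_match hm 2 3 5 0 1 4 2 3 6 (by decide)))
      (le_trans (le_of_eq (by ring)) (t7_match hm 2 3 5 0 1 4 2 5 6 (by decide)))
      (le_trans (le_of_eq (by ring)) (t7_match hm 0 1 5 2 3 4 0 5 6 (by decide)))
      (le_trans (le_of_eq (by ring)) (t7_match hm 0 1 5 2 3 4 1 5 6 (by decide)))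
      (le_trans (le_of_eq (by ring)) (t7_match hm 2 3 4 0 1 5 2 3 6 (by decide)))
      (le_trans (le_of_eq (by ring)) (t7_match hm 2 3 4 0 1 5 2 4 6 (by decide)))
      (by omega) (by omega)
    omega
  · omega

lemma lab7 {V : Finset ℕ} (hV : V.card = 7) (x0 x1 x2 x3 x4 x5 x6 : ℕ)
    (h : V = {x0, x1, x2, x3, x4, x5, x6}) : ∃ ψ : Fin 7 ↪ ℕ, univ.map ψ = V ∧
    ψ 0 = x0 ∧ ψ 1 = x1 ∧ ψ 2 = x2 ∧ ψ 3 = x3 ∧ ψ 4 = x4 ∧ ψ 5 = x5 ∧ ψ 6 = x6 := by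
  have him : univ.image ![x0, x1, x2, x3, x4, x5, x6] = V := by
    rw [h]; ext a; simp [Fin.exists_fin_succ, eq_comm]
  have hinj : Function.Injective ![x0, x1, x2, x3, x4, x5, x6] := by
    have := (card_image_iff (s := univ) (f := ![x0, x1, x2, x3, x4, x5, x6])).1 (by rw [him, hV]; simp)
    simpa using this
  refine ⟨⟨_, hinj⟩, ?_, rfl, rfl, rfl, rfl, rfl, rfl, rfl⟩
  rw [map_eq_image]; exact him

lemma m7 {V : Finset ℕ} {H : Finset (Finset ℕ)} (hV : V.card = 7) (hH : ThreeGraphOn V H) (hp : PF H)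
    (hmin : ∀ v ∈ V, ∃ e ∈ H, v ∈ e) : H.card ≤ 19 := by
  by_cases hI : Itg H
  · have := ekr hV (by norm_num) hH hI
    have e : Nat.choose (7-1) 2 = 15 := rfl
    omega
  by_cases hm : ∀ X ∈ H, ∀ Y ∈ H, ∀ Z ∈ H, Disjoint X Y → Disjoint Y Z → X = Z
  · unfold Itg at hI
    push Not at hI
    obtain ⟨A, hA, B, hB, hd⟩ := hI
    obtain ⟨x0, x1, x2, -, -, -, rfl⟩ := card_eq_three.1 (hH A hA).2
    obtain ⟨x3, x4, x5, -, -, -, rfl⟩ := card_eq_three.1 (hH B hB).2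
    have hc : (V \ ({x0,x1,x2} ∪ {x3,x4,x5})).card = 1 := by
      rw [card_sdiff_of_subset (union_subset (hH _ hA).1 (hH _ hB).1), card_union_of_disjoint hd,
        (hH _ hA).2, (hH _ hB).2, hV]
    obtain ⟨x6, h6⟩ := card_eq_one.1 hc
    have hVe : V = {x0, x1, x2, x3, x4, x5, x6} := by
      rw [← union_sdiff_of_subset (union_subset (hH _ hA).1 (hH _ hB).1), h6]
      ext; simp; tauto
    obtain ⟨ψ, hψ, e0, e1, e2, e3, e4, e5, e6⟩ := lab7 hV _ _ _ _ _ _ _ hVe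
    rw [← pull_card hψ hH]
    apply m7_iii_fin _ (pull_sized hH)
    · intro X hX Y hY Z hZ h1 h2
      have := hm _ (mem_pull.1 hX) _ (mem_pull.1 hY) _ (mem_pull.1 hZ) (by simpa) (by simpa)
      simpa using this
    · rw [mem_pull]; simpa [e0, e1, e2]
    · rw [mem_pull]; simpa [e3, e4, e5]
    · obtain ⟨e, he, h6⟩ := hmin x6 (by rw [hVe]; simp)
      have hs : e ⊆ univ.map ψ := by rw [hψ]; exact (hH e he).1
      obtain ⟨u, -, rfl⟩ := subset_map_iff.1 hs
      refine ⟨u, mem_pull.2 he, ?_⟩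
      rw [← e6] at h6
      simpa using h6
  · push Not at hm
    obtain ⟨X, hX, B, hB, Z, hZ, h1, h2, hne⟩ := hm
    have hXZ : (X ∪ Z) ⊆ V \ B := by
      intro a ha
      rw [mem_sdiff]
      rcases mem_union.1 ha with h | h
      · exact ⟨(hH X hX).1 h, disjoint_left.1 h1 h⟩
      · exact ⟨(hH Z hZ).1 h, disjoint_right.1 h2 h⟩
    have hcB : (V \ B).card = 4 := by
      rw [card_sdiff_of_subset (hH _ hB).1, (hH _ hB).2, hV]
    have hcu := card_le_card hXZ
    have hcX := (hH X hX).2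
    have hcZ := (hH Z hZ).2
    have hui := card_union_add_card_inter X Z
    have hi : (X ∩ Z).card < 3 := by
      by_contra hh
      apply hne
      have i1 : X ∩ Z = X := eq_of_subset_of_card_le inter_subset_left (by omega)
      have i2 : X ∩ Z = Z := eq_of_subset_of_card_le inter_subset_right (by omega)
      rw [← i1, i2]
    have hi2 : (X ∩ Z).card = 2 := by omega
    obtain ⟨x0, x1, -, h01⟩ := card_eq_two.1 hi2
    have hx2 : (X \ Z).card = 1 := by have := card_sdiff_add_card_inter X Z; omega
    have hx6 : (Z \ X).card = 1 := by
      have := card_sdiff_add_card_inter Z X; rw [inter_comm] at this; omega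
    obtain ⟨x2, hx2⟩ := card_eq_one.1 hx2
    obtain ⟨x6, hx6⟩ := card_eq_one.1 hx6
    obtain ⟨x3, x4, x5, -, -, -, rfl⟩ := card_eq_three.1 (hH B hB).2
    have eX : X = {x0, x1, x2} := by
      rw [← sdiff_union_inter X Z, h01, hx2]; ext; simp; tauto
    have eZ : Z = {x0, x1, x6} := by
      rw [← sdiff_union_inter Z X, inter_comm, h01, hx6]; ext; simp; tauto
    have hVe : V = {x0, x1, x2, x3, x4, x5, x6} := by
      have : X ∪ Z = V \ {x3,x4,x5} := eq_of_subset_of_card_le hXZ (by omega)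
      rw [← sdiff_union_of_subset (hH _ hB).1, ← this, eX, eZ]
      ext; simp; tauto
    obtain ⟨ψ, hψ, e0, e1, e2, e3, e4, e5, e6⟩ := lab7 hV _ _ _ _ _ _ _ hVe
    rw [← pull_card hψ hH]
    apply m7_ii_fin _ (pull_pf hp) (pull_sized hH)
    · rw [mem_pull]; simpa [e3, e4, e5]
    · rw [mem_pull]; simpa [e0, e1, e2, ← eX]
    · rw [mem_pull]; simpa [e0, e1, e6, ← eZ]

lemma m7' {V : Finset ℕ} {H : Finset (Finset ℕ)} (hV : V.card = 7) (hH : ThreeGraphOn V H) (hp : PF H) :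
    H.card ≤ 20 := by
  by_cases hmin : ∀ v ∈ V, ∃ e ∈ H, v ∈ e
  · have := m7 hV hH hp hmin; omega
  · push Not at hmin
    obtain ⟨v, hv, h⟩ := hmin
    have : ThreeGraphOn (V.erase v) H := by
      intro e he
      refine ⟨?_, (hH e he).2⟩
      intro a ha
      rw [mem_erase]
      exact ⟨fun hav => h e he (hav ▸ ha), (hH e he).1 ha⟩
    have h2 := card_le_choose this
    rw [card_erase_of_mem hv, hV] at h2
    exact h2

set_option linter.unusedVariables false

def Splits {α : Type*} [DecidableEq α] (R : α → α → Prop) (S : Finset α) : Prop :=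
  ∃ X Y : Finset α, X.Nonempty ∧ Y.Nonempty ∧ Disjoint X Y ∧ X ∪ Y = S ∧
    ((∀ x ∈ X, ∀ y ∈ Y, R x y) ∨ (∀ x ∈ X, ∀ y ∈ Y, ¬ R x y))

def NoP {α : Type*} (R : α → α → Prop) (S : Finset α) : Prop :=
  ∀ a ∈ S, ∀ b ∈ S, ∀ c ∈ S, ∀ d ∈ S, R a b → R b c → R c d → ¬ R a c → ¬ R b d → ¬ R a d → False

lemma NoP.compl {α : Type*} {R : α → α → Prop} {S : Finset α} (hs : ∀ a b, R a b → R b a)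
    (h : NoP R S) : NoP (fun a b => ¬ R a b) S := by
  intro a ha b hb c hc d hd h1 h2 h3 h4 h5 h6
  simp only [not_not] at h4 h5 h6
  exact h c hc a ha d hd b hb (hs _ _ h4) h6 (hs _ _ h5) h3 h1 (fun h => h2 (hs _ _ h))

lemma Splits.of_compl {α : Type*} [DecidableEq α] {R : α → α → Prop} {S : Finset α}
    (h : Splits (fun a b => ¬ R a b) S) : Splits R S := by
  obtain ⟨X, Y, h1, h2, h3, h4, h5⟩ := h
  refine ⟨X, Y, h1, h2, h3, h4, ?_⟩
  rcases h5 with h | h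
  · right; exact h
  · left; simpa using h

lemma cograph_step_aux {α : Type*} [DecidableEq α] {R : α → α → Prop} (hs : ∀ a b, R a b → R b a)
    {X Y : Finset α} {v : α} (hp : NoP R (insert v (X ∪ Y)))
    (hX : X.Nonempty) (hY : Y.Nonempty) (hd : Disjoint X Y) (hv : v ∉ X ∪ Y)
    (hc : ∀ x ∈ X, ∀ y ∈ Y, ¬ R x y) {a b : α} (ha : a ∈ X) (hb : b ∈ X) (hab : R a b)
    (hva : R v a) (hvb : ¬ R v b) : Splits R (insert v (X ∪ Y)) := by
  refine ⟨insert v X, Y, insert_nonempty _ _, hY, ?_, ?_, Or.inr ?_⟩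
  · rw [disjoint_insert_left]; exact ⟨fun h => hv (mem_union_right _ h), hd⟩
  · rw [insert_union]
  · intro x hx y hy
    rcases mem_insert.1 hx with rfl | hx
    · intro hxy
      refine hp b (by simp [hb]) a (by simp [ha]) x (by simp) y (by simp [hy]) (hs _ _ hab) (hs _ _ hva) hxy
        (fun h => hvb (hs _ _ h)) (hc a ha y hy) (hc b hb y hy)
    · exact hc x hx y hy

lemma cograph_step {α : Type*} [DecidableEq α] {R : α → α → Prop} (hs : ∀ a b, R a b → R b a)
    {X Y : Finset α} {v : α} (hp : NoP R (insert v (X ∪ Y)))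
    (hX : X.Nonempty) (hY : Y.Nonempty) (hd : Disjoint X Y) (hv : v ∉ X ∪ Y)
    (hc : ∀ x ∈ X, ∀ y ∈ Y, ¬ R x y) : Splits R (insert v (X ∪ Y)) := by
  classical
  by_cases hM : ∀ b ∈ X ∪ Y, R v b
  · refine ⟨{v}, X ∪ Y, by simp, hX.mono subset_union_left, by simpa using hv, rfl, Or.inl ?_⟩
    intro x hx y hy
    rw [mem_singleton.1 hx]; exact hM y hy
  push Not at hM
  obtain ⟨b0, hb0, hvb0⟩ := hM
  by_cases hE : ∃ a ∈ X ∪ Y, ∃ b ∈ X ∪ Y, R v a ∧ ¬ R v b ∧ R a b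
  · obtain ⟨a, ha, b, hb, h1, h2, h3⟩ := hE
    rcases mem_union.1 ha with ha | ha <;> rcases mem_union.1 hb with hb | hb
    · exact cograph_step_aux hs hp hX hY hd hv hc ha hb h3 h1 h2
    · exact absurd h3 (hc _ ha _ hb)
    · exact absurd (hs _ _ h3) (hc _ hb _ ha)
    · rw [union_comm] at hp hv ⊢
      exact cograph_step_aux hs hp hY hX hd.symm hv (fun x hx y hy h => hc y hy x hx (hs _ _ h))
        ha hb h3 h1 h2
  · push Not at hE
    refine ⟨insert v ((X ∪ Y).filter (fun a => R v a)), (X ∪ Y).filter (fun a => ¬ R v a),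
      insert_nonempty _ _, ⟨b0, by rw [mem_filter]; exact ⟨hb0, hvb0⟩⟩, ?_, ?_, Or.inr ?_⟩
    · rw [disjoint_insert_left]
      refine ⟨fun h => hv (mem_filter.1 h).1, disjoint_filter_filter_not _ _ _⟩
    · rw [insert_union, filter_union_filter_not_eq]
    · intro x hx y hy
      rw [mem_filter] at hy
      rcases mem_insert.1 hx with rfl | hx
      · exact hy.2
      · rw [mem_filter] at hx
        exact hE x hx.1 y hy.1 hx.2 hy.2

lemma cograph {α : Type*} [DecidableEq α] {R : α → α → Prop} (hs : ∀ a b, R a b → R b a)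
    (S : Finset α) : NoP R S → 2 ≤ S.card → Splits R S := by
  induction S using Finset.induction_on with
  | empty => intro _ h; simp at h
  | insert v S hv ih =>
    intro hp h2
    by_cases h1 : 2 ≤ S.card
    · obtain ⟨X, Y, hX, hY, hd, rfl, hc⟩ := ih (fun a ha b hb c hc d hd => hp a (mem_insert_of_mem ha)
        b (mem_insert_of_mem hb) c (mem_insert_of_mem hc) d (mem_insert_of_mem hd)) h1
      rcases hc with hc | hc
      · apply Splits.of_compl
        exact cograph_step (fun a b h h' => h (hs _ _ h')) (hp.compl hs) hX hY hd hv
          (fun x hx y hy h => h (hc x hx y hy))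
      · exact cograph_step hs hp hX hY hd hv hc
    · rw [card_insert_of_notMem hv] at h2
      obtain ⟨w, rfl⟩ := card_eq_one.1 (show S.card = 1 by omega)
      refine ⟨{v}, {w}, by simp, by simp, by simpa using hv, rfl, ?_⟩
      by_cases h : R v w
      · left; simpa using h
      · right; simpa using h

structure IsSplit (H P Q : Finset (Finset ℕ)) : Prop where
  hP : P ⊆ H
  hQ : Q ⊆ H
  neP : P.Nonempty
  neQ : Q.Nonempty
  disj : ∀ a ∈ P, ∀ b ∈ Q, Disjoint a b
  meetP : ∀ h ∈ H \ (P ∪ Q), ∀ k ∈ P, ¬ Disjoint h k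
  meetQ : ∀ h ∈ H \ (P ∪ Q), ∀ k ∈ Q, ¬ Disjoint h k

lemma IsSplit.symm {H P Q : Finset (Finset ℕ)} (h : IsSplit H P Q) : IsSplit H Q P :=
  ⟨h.hQ, h.hP, h.neQ, h.neP, fun a ha b hb => (h.disj b hb a ha).symm,
    by rw [union_comm]; exact h.meetQ, by rw [union_comm]; exact h.meetP⟩

lemma split_exists {H : Finset (Finset ℕ)} (hp : PF H) {A B : Finset ℕ} (hA : A ∈ H) (hB : B ∈ H)
    (hne : A ≠ B) (hd : Disjoint A B) : ∃ P Q, IsSplit H P Q ∧ A ∈ P ∪ Q ∧ B ∈ P ∪ Q := by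
  classical
  let good : Finset (Finset ℕ) → Prop := fun K => A ∈ K ∧ B ∈ K ∧ ∀ h ∈ H \ K, ∀ k ∈ K, ¬ Disjoint h k
  obtain ⟨K, hK, hmin⟩ := exists_min_image (H.powerset.filter good) card
    ⟨H, by simp [good, hA, hB]; tauto⟩
  rw [mem_filter, mem_powerset] at hK
  obtain ⟨hKH, hAK, hBK, hK⟩ := hK
  have hns : NoP (fun a b : Finset ℕ => Disjoint a b) K := hp.mono hKH
  obtain ⟨X, Y, hX, hY, hdXY, hu, hc⟩ := cograph (fun a b h => h.symm) K hns
    (one_lt_card.2 ⟨A, hAK, B, hBK, hne⟩)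
  rcases hc with hc | hc
  · refine ⟨X, Y, ⟨?_, ?_, hX, hY, hc, ?_, ?_⟩, by rwa [hu], by rwa [hu]⟩
    · exact (subset_union_left.trans hu.subset).trans hKH
    · exact (subset_union_right.trans hu.subset).trans hKH
    · intro h hh k hk; rw [hu] at hh; exact hK h hh k (hu ▸ mem_union_left _ hk)
    · intro h hh k hk; rw [hu] at hh; exact hK h hh k (hu ▸ mem_union_right _ hk)
  · exfalso
    have key : ∀ X Y : Finset (Finset ℕ), X ∪ Y = K → Disjoint X Y → Y.Nonempty →
        (∀ x ∈ X, ∀ y ∈ Y, ¬ Disjoint x y) → A ∈ X → B ∈ X → False := by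
      intro X Y hu hdXY hY hc hA hB
      have hXK : X ⊆ K := subset_union_left.trans hu.subset
      have h1 := hmin X (by
        rw [mem_filter, mem_powerset]
        refine ⟨hXK.trans hKH, hA, hB, ?_⟩
        intro h hh k hk
        rw [mem_sdiff] at hh
        by_cases hk' : h ∈ K
        · rw [← hu, mem_union] at hk'
          exact fun hd => hc k hk h (hk'.resolve_left hh.2) hd.symm
        · exact hK h (mem_sdiff.2 ⟨hh.1, hk'⟩) k (hXK hk))
      rw [← hu, card_union_of_disjoint hdXY] at h1
      have := hY.card_pos
      omega
    have hA' : A ∈ X ∪ Y := by rwa [hu]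
    have hB' : B ∈ X ∪ Y := by rwa [hu]
    rcases mem_union.1 hA' with h1 | h1 <;> rcases mem_union.1 hB' with h2 | h2
    · exact key X Y hu hdXY hY hc h1 h2
    · exact hc _ h1 _ h2 hd
    · exact hc _ h2 _ h1 hd.symm
    · exact key Y X (by rw [union_comm, hu]) hdXY.symm hX (fun x hx y hy h => hc y hy x hx h.symm) h1 h2


lemma choose_aux (a b : ℕ) (hb : 1 ≤ b) :
    (b : ℚ) * (((a + (b - 1)).choose a : ℕ) : ℚ)⁻¹ = (a + b : ℚ) * (((a + b).choose a : ℕ) : ℚ)⁻¹ := by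
  obtain ⟨c, rfl⟩ : ∃ c, b = c + 1 := ⟨b - 1, by omega⟩
  have h := Nat.add_one_mul_choose_eq (a + c) c
  have e1 : (a + c).choose a = (a + c).choose c := by rw [Nat.choose_symm_add]
  have e2 : (a + (c + 1)).choose a = (a + c).succ.choose c.succ := by
    rw [Nat.choose_symm_add]; rfl
  have p1 : 0 < (a + c).choose c := Nat.choose_pos (by omega)
  have p2 : 0 < (a + c).succ.choose c.succ := Nat.choose_pos (by omega)
  rw [show c + 1 - 1 = c by omega, e1, e2]
  have h' : ((a + c).succ : ℚ) * ((a + c).choose c : ℚ) = ((a+c).succ.choose c.succ : ℚ) * (c.succ : ℚ) := by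
    exact_mod_cast h
  have p1' : ((a + c).choose c : ℚ) ≠ 0 := by positivity
  have p2' : ((a + c).succ.choose c.succ : ℚ) ≠ 0 := by positivity
  field_simp
  push_cast at h' ⊢
  linarith

lemma bollobas {ι : Type*} [DecidableEq ι] : ∀ (n : ℕ) (X : Finset ℕ), X.card = n → ∀ (S : Finset ι) (A B : ι → Finset ℕ),
    (∀ i ∈ S, A i ⊆ X) → (∀ i ∈ S, B i ⊆ X) → (∀ i ∈ S, Disjoint (A i) (B i)) →
    (∀ i ∈ S, ∀ j ∈ S, i ≠ j → ¬ Disjoint (A i) (B j)) →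
    ∑ i ∈ S, ((((A i).card + (B i).card).choose (A i).card : ℕ) : ℚ)⁻¹ ≤ 1 := by
  intro n
  induction n with
  | zero =>
    intro X hX S A B hA hB hd hc
    have hX0 : X = ∅ := card_eq_zero.1 hX
    have hS : S.card ≤ 1 := by
      rw [card_le_one]
      intro i hi j hj
      by_contra hij
      apply hc i hi j hj hij
      have : A i = ∅ := by have := hA i hi; rw [hX0] at this; exact subset_empty.1 this
      rw [this]; exact disjoint_empty_left _
    calc _ ≤ ∑ i ∈ S, (1 : ℚ) := by
          apply sum_le_sum
          intro i hi
          have : A i = ∅ := by have := hA i hi; rw [hX0] at this; exact subset_empty.1 this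
          simp [this]
      _ = S.card := by simp
      _ ≤ 1 := by exact_mod_cast hS
  | succ n ih =>
    intro X hX S A B hA hB hd hc
    by_cases hE : ∃ i ∈ S, B i = ∅
    · obtain ⟨i, hi, hBi⟩ := hE
      have : S = {i} := by
        ext j
        rw [mem_singleton]
        constructor
        · intro hj
          by_contra hij
          exact hc j hj i hi hij (by rw [hBi]; exact disjoint_empty_right _)
        · rintro rfl; exact hi
      rw [this]
      simp [hBi]
    push Not at hE
    have hE' : ∀ i ∈ S, 1 ≤ (B i).card := fun i hi => (hE i hi).card_pos
    have step : ∀ x ∈ X, ∑ i ∈ S.filter (fun i => x ∉ A i),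
        ((((A i).card + ((B i).erase x).card).choose (A i).card : ℕ) : ℚ)⁻¹ ≤ 1 := by
      intro x hx
      apply ih (X.erase x) (by rw [card_erase_of_mem hx, hX]; rfl) _ A (fun i => (B i).erase x)
      · intro i hi
        rw [mem_filter] at hi
        exact subset_erase.2 ⟨hA i hi.1, hi.2⟩
      · intro i hi
        exact erase_subset_erase _ (hB i (mem_filter.1 hi).1)
      · intro i hi
        exact (hd i (mem_filter.1 hi).1).mono_right (erase_subset _ _)
      · intro i hi j hj hij
        rw [mem_filter] at hi hj
        have := hc i hi.1 j hj.1 hij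
        rw [not_disjoint_iff] at this ⊢
        obtain ⟨y, hy, hy'⟩ := this
        exact ⟨y, hy, mem_erase.2 ⟨fun h => hi.2 (h ▸ hy), hy'⟩⟩
    have hsum := sum_le_sum step
    simp only [sum_const, hX, nsmul_eq_mul, mul_one] at hsum
    have hsw : ∑ x ∈ X, ∑ i ∈ S.filter (fun i => x ∉ A i),
        ((((A i).card + ((B i).erase x).card).choose (A i).card : ℕ) : ℚ)⁻¹ =
        ∑ i ∈ S, ∑ x ∈ X.filter (fun x => x ∉ A i),
        ((((A i).card + ((B i).erase x).card).choose (A i).card : ℕ) : ℚ)⁻¹ := by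
      simp only [sum_filter]
      exact sum_comm
    rw [hsw] at hsum
    have hi : ∀ i ∈ S, ∑ x ∈ X.filter (fun x => x ∉ A i),
        ((((A i).card + ((B i).erase x).card).choose (A i).card : ℕ) : ℚ)⁻¹ =
        ((n + 1 : ℕ) : ℚ) * ((((A i).card + (B i).card).choose (A i).card : ℕ) : ℚ)⁻¹ := by
      intro i hi
      have hsplit : X.filter (fun x => x ∉ A i) = B i ∪ (X \ (A i ∪ B i)) := by
        ext x
        simp only [mem_filter, mem_union, mem_sdiff]
        constructor
        · rintro ⟨h1, h2⟩
          by_cases h : x ∈ B i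
          · exact Or.inl h
          · exact Or.inr ⟨h1, by tauto⟩
        · rintro (h | h)
          · exact ⟨hB i hi h, disjoint_right.1 (hd i hi) h⟩
          · exact ⟨h.1, by tauto⟩
      have hdis : Disjoint (B i) (X \ (A i ∪ B i)) := by
        rw [disjoint_left]; intro x hx hx'; simp [hx] at hx'
      rw [hsplit, sum_union hdis]
      have e1 : ∑ x ∈ B i, ((((A i).card + ((B i).erase x).card).choose (A i).card : ℕ) : ℚ)⁻¹ =
          ((B i).card : ℚ) * ((((A i).card + ((B i).card - 1)).choose (A i).card : ℕ) : ℚ)⁻¹ := by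
        rw [← nsmul_eq_mul, ← sum_const]
        apply sum_congr rfl
        intro x hx
        rw [card_erase_of_mem hx]
      have e2 : ∑ x ∈ X \ (A i ∪ B i), ((((A i).card + ((B i).erase x).card).choose (A i).card : ℕ) : ℚ)⁻¹ =
          ((X \ (A i ∪ B i)).card : ℚ) * ((((A i).card + (B i).card).choose (A i).card : ℕ) : ℚ)⁻¹ := by
        rw [← nsmul_eq_mul, ← sum_const]
        apply sum_congr rfl
        intro x hx
        rw [erase_eq_of_notMem]
        intro h; simp [h] at hx
      have hc : ((X \ (A i ∪ B i)).card : ℚ) = ((n + 1 : ℕ) : ℚ) - ((A i).card + (B i).card) := by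
        have h1 := card_sdiff_add_card_eq_card (union_subset (hA i hi) (hB i hi))
        rw [card_union_of_disjoint (hd i hi), hX] at h1
        rw [← h1]; push_cast; ring
      rw [e1, e2, choose_aux _ _ (hE' i hi), hc]
      ring
    rw [sum_congr rfl hi, ← mul_sum] at hsum
    have : (0 : ℚ) < ((n + 1 : ℕ) : ℚ) := by positivity
    nlinarith

lemma bollobas3 {ι : Type*} [DecidableEq ι] (S : Finset ι) (A B : ι → Finset ℕ)
    (hA : ∀ i ∈ S, (A i).card = 3) (hB : ∀ i ∈ S, (B i).card = 3) (hd : ∀ i ∈ S, Disjoint (A i) (B i))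
    (hc : ∀ i ∈ S, ∀ j ∈ S, i ≠ j → ¬ Disjoint (A i) (B j)) : S.card ≤ 20 := by
  have h := bollobas _ (S.biUnion (fun i => A i ∪ B i)) rfl S A B
    (fun i hi => subset_union_left.trans (subset_biUnion_of_mem (fun i => A i ∪ B i) hi))
    (fun i hi => subset_union_right.trans (subset_biUnion_of_mem (fun i => A i ∪ B i) hi)) hd hc
  rw [sum_congr rfl (g := fun _ => ((20 : ℚ))⁻¹) (by
    intro i hi; rw [hA i hi, hB i hi]; norm_num [Nat.choose])] at h
  simp only [sum_const, nsmul_eq_mul] at h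
  have : (S.card : ℚ) ≤ 20 := by linarith
  exact_mod_cast this


lemma ch2 (n : ℕ) : 2 * (n+1).choose 2 = (n+1) * n := by
  have := Nat.add_one_mul_choose_eq n 1
  simp at this
  omega

lemma bb9 : bb 9 = 35 := by decide
lemma bb10 {m : ℕ} (hm : 10 ≤ m) : bb m = (m-1).choose 2 + 2 := by
  unfold bb
  rw [if_neg (by omega), if_neg (by omega), if_neg (by omega), if_neg (by omega)]

/-- quadratic lower bound -/
lemma bb_quad {m : ℕ} (hm : 10 ≤ m) : 2 * bb m = (m-1) * (m-2) + 4 := by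
  rw [bb10 hm]
  obtain ⟨k, rfl⟩ : ∃ k, m = k + 2 := ⟨m - 2, by omega⟩
  have := ch2 k
  simp only [show k + 2 - 1 = k + 1 by omega, show k + 2 - 2 = k by omega]
  omega

lemma bb_ge {m : ℕ} (hm : 9 ≤ m) : 3 * m + 4 ≤ bb m ∧ 35 ≤ bb m := by
  rcases Nat.lt_or_ge m 10 with h | h
  · have : m = 9 := by omega
    subst this; rw [bb9]; omega
  · have h1 := bb_quad h
    obtain ⟨k, rfl⟩ : ∃ k, m = k + 10 := ⟨m - 10, by omega⟩
    simp only [show k + 10 - 1 = k + 9 by omega, show k + 10 - 2 = k + 8 by omega] at h1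
    constructor <;> nlinarith

lemma bb_ge2 {m : ℕ} (hm : 9 ≤ m) : (m-1).choose 2 + 2 ≤ bb m := by
  rcases Nat.lt_or_ge m 10 with h | h
  · have : m = 9 := by omega
    subst this; rw [bb9]; decide
  · rw [bb10 h]

lemma pair_eq {p : Finset ℕ} {a b : ℕ} (ha : a ∈ p) (hb : b ∈ p) (hab : a ≠ b) (hp : p.card = 2) :
    p = {a, b} := by
  symm
  apply eq_of_subset_of_card_le
  · intro z hz; simp at hz; rcases hz with rfl | rfl
    exacts [ha, hb]
  · rw [hp, card_pair hab]

lemma triple_eq {p : Finset ℕ} {a b c : ℕ} (ha : a ∈ p) (hb : b ∈ p) (hc : c ∈ p) (hab : a ≠ b)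
    (hac : a ≠ c) (hbc : b ≠ c) (hp : p.card = 3) : p = {a, b, c} := by
  symm
  apply eq_of_subset_of_card_le
  · intro z hz; simp at hz; rcases hz with rfl | rfl | rfl
    exacts [ha, hb, hc]
  · rw [hp, card_eq_three.2 ⟨a, b, c, hab, hac, hbc, rfl⟩]

lemma cross_pair {W : Finset ℕ} {L L' : Finset (Finset ℕ)} (hL : ∀ p ∈ L, p ⊆ W ∧ p.card = 2)
    (hL' : ∀ p ∈ L', p ⊆ W ∧ p.card = 2) (hW : 4 ≤ W.card) (hc : ∀ p ∈ L, ∀ q ∈ L', ¬ Disjoint p q)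
    (h2 : 2 ≤ L'.card) : L.card ≤ W.card := by
  obtain ⟨g, hg, g', hg', hne⟩ := one_lt_card.1 h2
  by_cases hd : Disjoint g g'
  · have : L ⊆ (g ×ˢ g').image (fun z => {z.1, z.2}) := by
      intro p hp
      obtain ⟨a, hap, hag⟩ := not_disjoint_iff.1 (hc p hp _ hg)
      obtain ⟨b, hbp, hbg⟩ := not_disjoint_iff.1 (hc p hp _ hg')
      rw [mem_image]
      refine ⟨(a, b), mem_product.2 ⟨hag, hbg⟩, (pair_eq hap hbp ?_ (hL p hp).2).symm⟩
      rintro rfl; exact disjoint_left.1 hd hag hbg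
    refine (card_le_card this).trans (card_image_le.trans ?_)
    rw [card_product, (hL' g hg).2, (hL' g' hg').2]; exact hW
  · obtain ⟨c, hcg, hcg'⟩ := not_disjoint_iff.1 hd
    obtain ⟨a, ha⟩ : ∃ a, g.erase c = {a} := card_eq_one.1 (by rw [card_erase_of_mem hcg, (hL' g hg).2])
    obtain ⟨b, hb⟩ : ∃ a, g'.erase c = {a} := card_eq_one.1 (by rw [card_erase_of_mem hcg', (hL' g' hg').2])
    have eg : g = {c, a} := by rw [← insert_erase hcg, ha]
    have eg' : g' = {c, b} := by rw [← insert_erase hcg', hb]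
    have hcW : c ∈ W := (hL' g hg).1 hcg
    have : L ⊆ insert {a, b} ((W.erase c).image (fun z => {c, z})) := by
      intro p hp
      have h1 := hc p hp _ hg
      have h2 := hc p hp _ hg'
      rw [mem_insert, mem_image]
      by_cases hcp : c ∈ p
      · right
        obtain ⟨z, hz⟩ : ∃ a, p.erase c = {a} := card_eq_one.1 (by rw [card_erase_of_mem hcp, (hL p hp).2])
        have ez : p = {c, z} := by rw [← insert_erase hcp, hz]
        have hzp : z ∈ p.erase c := by rw [hz]; simp
        exact ⟨z, mem_erase.2 ⟨(mem_erase.1 hzp).1, (hL p hp).1 (mem_erase.1 hzp).2⟩, ez.symm⟩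
      · left
        have hab : a ≠ b := by rintro rfl; exact hne (by rw [eg, eg'])
        rw [eg] at h1; rw [eg'] at h2
        simp [hcp] at h1 h2
        exact pair_eq h1 h2 hab (hL p hp).2
    have h1 := card_le_card this
    have h2 := card_insert_le {a, b} ((W.erase c).image (fun z => ({c, z} : Finset ℕ)))
    have h3 : ((W.erase c).image (fun z => ({c, z} : Finset ℕ))).card ≤ _ := card_image_le
    rw [card_erase_of_mem hcW] at h3
    omega

lemma cross_single {W : Finset ℕ} {L : Finset (Finset ℕ)} (hL : ∀ p ∈ L, p ⊆ W ∧ p.card = 2)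
    {g : Finset ℕ} (hg : g ⊆ W ∧ g.card = 2) (hc : ∀ p ∈ L, ¬ Disjoint p g) : L.card + 2 ≤ 2 * W.card := by
  have : L ⊆ g.biUnion (fun c => (W.erase c).image (fun z => {c, z})) := by
    intro p hp
    obtain ⟨c, hcp, hcg⟩ := not_disjoint_iff.1 (hc p hp)
    obtain ⟨z, hz⟩ : ∃ a, p.erase c = {a} := card_eq_one.1 (by rw [card_erase_of_mem hcp, (hL p hp).2])
    have ez : p = {c, z} := by rw [← insert_erase hcp, hz]
    have hzp : z ∈ p.erase c := by rw [hz]; simp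
    rw [mem_biUnion]
    refine ⟨c, hcg, mem_image.2 ⟨z, mem_erase.2 ⟨(mem_erase.1 hzp).1, (hL p hp).1 (mem_erase.1 hzp).2⟩, ez.symm⟩⟩
  have h1 := (card_le_card this).trans (card_biUnion_le_card_mul g _ (W.card - 1) (by
    intro c hc
    refine card_image_le.trans ?_
    rw [card_erase_of_mem (hg.1 hc)]))
  rw [hg.2] at h1
  have := card_pos.2 ⟨_, hg.1 (card_pos.1 (by rw [hg.2]; norm_num) : g.Nonempty).choose_spec⟩
  omega

/-- degree bound when there is no 2-cover -/
lemma deg_le {I : Finset (Finset ℕ)} (h3 : ∀ e ∈ I, e.card = 3) (hI : Itg I)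
    (h2 : ∀ x y, ∃ e ∈ I, x ∉ e ∧ y ∉ e) (x : ℕ) : (I.filter (fun e => x ∈ e)).card ≤ 9 := by
  choose E hE hx hy using h2
  have : I.filter (fun e => x ∈ e) ⊆ (E x x).biUnion (fun a => (E x a).image (fun b => {x, a, b})) := by
    intro e he
    rw [mem_filter] at he
    obtain ⟨a, ha, ha'⟩ := not_disjoint_iff.1 (hI e he.1 _ (hE x x))
    obtain ⟨b, hb, hb'⟩ := not_disjoint_iff.1 (hI e he.1 _ (hE x a))
    rw [mem_biUnion]
    refine ⟨a, ha', mem_image.2 ⟨b, hb', ?_⟩⟩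
    have hxa : x ≠ a := by rintro rfl; exact hx x x ha'
    have hxb : x ≠ b := by rintro rfl; exact hx x a hb'
    have hab : a ≠ b := by rintro rfl; exact hy x a hb'
    exact (triple_eq he.2 ha hb hxa hxb hab (h3 e he.1)).symm
  refine (card_le_card this).trans ((card_biUnion_le_card_mul _ _ 3 ?_).trans ?_)
  · intro a _; exact card_image_le.trans (h3 _ (hE x a)).le
  · rw [h3 _ (hE x x)]

lemma no_cover_bound {I : Finset (Finset ℕ)} (h3 : ∀ e ∈ I, e.card = 3) (hI : Itg I)
    (h2 : ∀ x y, ∃ e ∈ I, x ∉ e ∧ y ∉ e) : I.card ≤ 25 := by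
  obtain ⟨E, hE, -⟩ := h2 0 0
  have hs : ∑ e ∈ I, (E ∩ e).card = ∑ v ∈ E, (I.filter (fun e => v ∈ e)).card := by
    simp only [card_eq_sum_ones, sum_filter]
    rw [sum_comm]
    apply sum_congr rfl
    intro e _
    rw [← sum_filter]
    apply sum_congr _ (fun _ _ => rfl)
    ext; simp
  have hu : ∑ v ∈ E, (I.filter (fun e => v ∈ e)).card ≤ 27 := by
    have := sum_le_card_nsmul E (fun v => (I.filter (fun e => v ∈ e)).card) 9 (fun v _ => deg_le h3 hI h2 v)
    rw [h3 E hE] at this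
    simpa using this
  have hl : (I.erase E).card + 3 ≤ ∑ e ∈ I, (E ∩ e).card := by
    rw [← sum_erase_add _ _ hE, inter_self, h3 E hE]
    gcongr
    rw [card_eq_sum_ones]
    apply sum_le_sum
    intro e he
    rw [Nat.one_le_iff_ne_zero, ← Nat.pos_iff_ne_zero, card_pos]
    rw [← not_disjoint_iff_nonempty_inter]
    exact hI E hE e (mem_erase.1 he).2
  rw [card_erase_of_mem hE] at hl
  omega


lemma card_link {I : Finset (Finset ℕ)} {x : ℕ} (h : ∀ e ∈ I, x ∈ e) :
    (I.image (fun e => e.erase x)).card = I.card := by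
  apply card_image_of_injOn
  intro e he f hf hef
  have := congrArg (insert x) hef
  simpa [insert_erase (h e he), insert_erase (h f hf)] using this

lemma star_count {V : Finset ℕ} {I : Finset (Finset ℕ)} {x : ℕ} (hV : ThreeGraphOn V I) (hx : x ∈ V)
    (h : ∀ e ∈ I, x ∈ e) (M : Finset (Finset ℕ)) (hM : M ⊆ powersetCard 2 (V.erase x))
    (hIM : ∀ e ∈ I, e.erase x ∉ M) : I.card + M.card ≤ (V.card - 1).choose 2 := by
  rw [← card_link h, ← card_union_of_disjoint, ← card_erase_of_mem hx, ← card_powersetCard]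
  · apply card_le_card
    apply union_subset _ hM
    intro p hp
    obtain ⟨e, he, rfl⟩ := mem_image.1 hp
    rw [mem_powersetCard]
    exact ⟨erase_subset_erase _ (hV e he).1, by rw [card_erase_of_mem (h e he), (hV e he).2]⟩
  · rw [disjoint_left]
    intro p hp
    obtain ⟨e, he, rfl⟩ := mem_image.1 hp
    exact hIM e he

lemma two_cover {V : Finset ℕ} {I : Finset (Finset ℕ)} {x y m : ℕ} (hV : V.card = m) (hm : 6 ≤ m)
    (hT : ThreeGraphOn V I) (hI : Itg I) (hxy : ∀ e ∈ I, x ∈ e ∨ y ∈ e) (hn : ∀ z, ∃ e ∈ I, z ∉ e) :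
    I.card + 6 ≤ 3 * m := by
  have hne : x ≠ y := by
    rintro rfl
    obtain ⟨e, he, h⟩ := hn x
    have := hxy e he; tauto
  obtain ⟨ex, hex, hex'⟩ := hn y
  obtain ⟨ey, hey, hey'⟩ := hn x
  have hxe : x ∈ ex := (hxy _ hex).resolve_right hex'
  have hye : y ∈ ey := (hxy _ hey).resolve_left hey'
  have hxV : x ∈ V := (hT _ hex).1 hxe
  have hyV : y ∈ V := (hT _ hey).1 hye
  set W := (V.erase x).erase y with hW
  have hWc : W.card = m - 2 := by
    rw [hW, card_erase_of_mem (mem_erase.2 ⟨hne.symm, hyV⟩), card_erase_of_mem hxV, hV]; omega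
  set Ixy := I.filter (fun e => x ∈ e ∧ y ∈ e)
  set Ix := I.filter (fun e => x ∈ e ∧ y ∉ e) with hIx
  set Iy := I.filter (fun e => y ∈ e ∧ x ∉ e) with hIy
  have hsum : I.card ≤ Ixy.card + (Ix.card + Iy.card) := by
    have : I ⊆ Ixy ∪ (Ix ∪ Iy) := by
      intro e he
      have := hxy e he
      simp only [Ixy, Ix, Iy, mem_union, mem_filter]
      tauto
    exact (card_le_card this).trans ((card_union_le _ _).trans (by gcongr; exact card_union_le _ _))
  have h1 : Ixy.card ≤ m - 2 := by
    have : Ixy ⊆ W.image (fun z => {x, y, z}) := by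
      intro e he
      simp only [Ixy, mem_filter] at he
      obtain ⟨he, hx, hy⟩ := he
      have : ((e.erase x).erase y).card = 1 := by
        rw [card_erase_of_mem (mem_erase.2 ⟨hne.symm, hy⟩), card_erase_of_mem hx, (hT e he).2]
      obtain ⟨z, hz⟩ := card_eq_one.1 this
      have hz' : z ∈ (e.erase x).erase y := by rw [hz]; simp
      simp only [mem_erase] at hz'
      rw [mem_image]
      refine ⟨z, ?_, ?_⟩
      · simp only [hW, mem_erase]; exact ⟨hz'.1, hz'.2.1, (hT e he).1 hz'.2.2⟩
      · exact (triple_eq hx hy hz'.2.2 hne (Ne.symm hz'.2.1) (Ne.symm hz'.1) (hT e he).2).symm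
    exact (card_le_card this).trans (card_image_le.trans hWc.le)
  have lx : ∀ e ∈ Ix, x ∈ e := fun e he => (mem_filter.1 he).2.1
  have ly : ∀ e ∈ Iy, y ∈ e := fun e he => (mem_filter.1 he).2.1
  set Lx := Ix.image (fun e => e.erase x) with hLx
  set Ly := Iy.image (fun e => e.erase y) with hLy
  have cx : Lx.card = Ix.card := card_link lx
  have cy : Ly.card = Iy.card := card_link ly
  have hLxW : ∀ p ∈ Lx, p ⊆ W ∧ p.card = 2 := by
    intro p hp
    obtain ⟨e, he, rfl⟩ := mem_image.1 hp
    rw [hIx, mem_filter] at he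
    refine ⟨?_, by rw [card_erase_of_mem he.2.1, (hT e he.1).2]⟩
    intro z hz
    rw [mem_erase] at hz
    simp only [hW, mem_erase]
    exact ⟨fun h => he.2.2 (h ▸ hz.2), hz.1, (hT e he.1).1 hz.2⟩
  have hLyW : ∀ p ∈ Ly, p ⊆ W ∧ p.card = 2 := by
    intro p hp
    obtain ⟨e, he, rfl⟩ := mem_image.1 hp
    rw [hIy, mem_filter] at he
    refine ⟨?_, by rw [card_erase_of_mem he.2.1, (hT e he.1).2]⟩
    intro z hz
    rw [mem_erase] at hz
    simp only [hW, mem_erase]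
    exact ⟨hz.1, fun h => he.2.2 (h ▸ hz.2), (hT e he.1).1 hz.2⟩
  have hc : ∀ p ∈ Lx, ∀ q ∈ Ly, ¬ Disjoint p q := by
    intro p hp q hq
    obtain ⟨e, he, rfl⟩ := mem_image.1 hp
    obtain ⟨f, hf, rfl⟩ := mem_image.1 hq
    rw [hIx, mem_filter] at he
    rw [hIy, mem_filter] at hf
    obtain ⟨z, hz, hz'⟩ := not_disjoint_iff.1 (hI e he.1 f hf.1)
    rw [not_disjoint_iff]
    refine ⟨z, mem_erase.2 ⟨fun h => hf.2.2 (h ▸ hz'), hz⟩, mem_erase.2 ⟨fun h => he.2.2 (h ▸ hz), hz'⟩⟩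
  have pX : 1 ≤ Ix.card := card_pos.2 ⟨ex, by rw [hIx, mem_filter]; exact ⟨hex, hxe, hex'⟩⟩
  have pY : 1 ≤ Iy.card := card_pos.2 ⟨ey, by rw [hIy, mem_filter]; exact ⟨hey, hye, hey'⟩⟩
  have sX := cross_single hLxW (hLyW _ (mem_image_of_mem _ (by rw [hIy, mem_filter]; exact ⟨hey, hye, hey'⟩)))
    (fun p hp => hc p hp _ (mem_image_of_mem _ (by rw [hIy, mem_filter]; exact ⟨hey, hye, hey'⟩)))
  have sY := cross_single hLyW (hLxW _ (mem_image_of_mem _ (by rw [hIx, mem_filter]; exact ⟨hex, hxe, hex'⟩)))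
    (fun p hp h => hc _ (mem_image_of_mem _ (by rw [hIx, mem_filter]; exact ⟨hex, hxe, hex'⟩)) p hp h.symm)
  by_cases h2 : Iy.card = 1
  · omega
  by_cases h3 : Ix.card = 1
  · omega
  have c1 := cross_pair hLxW hLyW (by omega) hc (by omega)
  have c2 := cross_pair hLyW hLxW (by omega) (fun p hp q hq h => hc q hq p hp h.symm) (by omega)
  omega

def StarH (H : Finset (Finset ℕ)) : Prop := ∀ A ∈ H, ∀ B ∈ H, Disjoint A B →
  (∀ e ∈ H, Disjoint e A → e = B) ∨ (∀ e ∈ H, Disjoint e B → e = A)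

lemma common_case {V : Finset ℕ} {I BB : Finset (Finset ℕ)} {x m : ℕ} (hV : V.card = m) (hm : 9 ≤ m)
    (hT : ThreeGraphOn V I) (hTB : ThreeGraphOn V BB) (hxV : x ∈ V) (hx : ∀ e ∈ I, x ∈ e)
    (hxB : ∀ b ∈ BB, x ∉ b) (hB : Itg BB)
    (h2 : ∀ e ∈ I, ∀ b ∈ BB, ∀ c ∈ BB, b ≠ c → Disjoint e b → Disjoint e c → False)
    (h3 : 3 ≤ BB.card) (h10 : BB.card ≤ 10) : I.card + BB.card ≤ bb m := by
  obtain ⟨b1, hb1, b2, hb2, b3, hb3, h12, h13, h23⟩ := two_lt_card.1 h3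
  let S : Finset ℕ → Finset ℕ → Finset ℕ := fun b c => (V.erase x) \ (b ∪ c)
  have hS : ∀ b ∈ BB, ∀ c ∈ BB, b ≠ c → ∀ e ∈ I, e.erase x ∉ powersetCard 2 (S b c) := by
    intro b hb c hc hbc e he hp
    rw [mem_powersetCard] at hp
    have key : ∀ z ∈ e, z ∉ b ∪ c := by
      intro z hz hzb
      by_cases hzx : z = x
      · subst hzx
        rcases mem_union.1 hzb with h | h
        · exact hxB b hb h
        · exact hxB c hc h
      · exact (mem_sdiff.1 (hp.1 (mem_erase.2 ⟨hzx, hz⟩))).2 hzb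
    refine h2 e he b hb c hc hbc ?_ ?_
    · rw [disjoint_left]; exact fun z hz h => key z hz (mem_union_left _ h)
    · rw [disjoint_left]; exact fun z hz h => key z hz (mem_union_right _ h)
  have hSs : ∀ b c, powersetCard 2 (S b c) ⊆ powersetCard 2 (V.erase x) :=
    fun b c => powersetCard_mono sdiff_subset
  have hSc : ∀ b ∈ BB, ∀ c ∈ BB, (S b c).card + (b ∪ c).card = m - 1 := by
    intro b hb c hc
    have hs : b ∪ c ⊆ V.erase x := by
      apply union_subset
      · exact subset_erase.2 ⟨(hTB b hb).1, hxB b hb⟩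
      · exact subset_erase.2 ⟨(hTB c hc).1, hxB c hc⟩
    have := card_sdiff_add_card_eq_card hs
    rwa [card_erase_of_mem hxV, hV] at this
  have hint : ∀ b ∈ BB, ∀ c ∈ BB, (b ∪ c).card + (b ∩ c).card = 6 ∧ 1 ≤ (b ∩ c).card := by
    intro b hb c hc
    refine ⟨by rw [card_union_add_card_inter, (hTB b hb).2, (hTB c hc).2], ?_⟩
    exact card_pos.2 (not_disjoint_iff_nonempty_inter.1 (hB b hb c hc))
  have one : ∀ b ∈ BB, ∀ c ∈ BB, b ≠ c → I.card + (S b c).card.choose 2 ≤ (m-1).choose 2 := by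
    intro b hb c hc hbc
    have := star_count hT hxV hx _ (hSs b c) (hS b hb c hc hbc)
    rwa [card_powersetCard, hV] at this
  have big : ∀ b ∈ BB, ∀ c ∈ BB, b ≠ c → 10 ≤ m → 5 ≤ (S b c).card → I.card + BB.card ≤ bb m := by
    intro b hb c hc hbc hm h5
    have h1 := one b hb c hc hbc
    have h2 := Nat.choose_le_choose 2 h5
    have h3 : Nat.choose 5 2 = 10 := by decide
    rw [bb10 hm]; omega
  have g12 := hSc b1 hb1 b2 hb2
  have i12 := hint b1 hb1 b2 hb2
  have g13 := hSc b1 hb1 b3 hb3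
  have i13 := hint b1 hb1 b3 hb3
  have g23 := hSc b2 hb2 b3 hb3
  have i23 := hint b2 hb2 b3 hb3
  rcases (by omega : m = 9 ∨ 10 ≤ m) with rfl | hm10
  · have h1 := one b1 hb1 b2 hb2 h12
    have h2 := Nat.choose_le_choose 2 (show 3 ≤ (S b1 b2).card by omega)
    have h3 : Nat.choose 3 2 = 3 := by decide
    have h4 : Nat.choose (9-1) 2 = 28 := by decide
    rw [bb9]; omega
  by_cases c12 : 5 ≤ (S b1 b2).card
  · exact big _ hb1 _ hb2 h12 hm10 c12
  by_cases c13 : 5 ≤ (S b1 b3).card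
  · exact big _ hb1 _ hb3 h13 hm10 c13
  by_cases c23 : 5 ≤ (S b2 b3).card
  · exact big _ hb2 _ hb3 h23 hm10 c23
  have hm' : m = 10 := by omega
  subst hm'
  have hM := star_count hT hxV hx (powersetCard 2 (S b1 b2) ∪ powersetCard 2 (S b1 b3))
    (union_subset (hSs _ _) (hSs _ _)) (by
      intro e he h
      rcases mem_union.1 h with h | h
      · exact hS _ hb1 _ hb2 h12 e he h
      · exact hS _ hb1 _ hb3 h13 e he h)
  have hui := card_union_add_card_inter (powersetCard 2 (S b1 b2)) (powersetCard 2 (S b1 b3))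
  have hsub : powersetCard 2 (S b1 b2) ∩ powersetCard 2 (S b1 b3) ⊆
      powersetCard 2 ((V.erase x) \ (b1 ∪ b2 ∪ b3)) := by
    intro p hp
    simp only [mem_inter, mem_powersetCard, S] at hp ⊢
    refine ⟨fun z hz => ?_, hp.1.2⟩
    have z1 := hp.1.1 hz
    have z2 := hp.2.1 hz
    simp only [mem_sdiff, mem_union] at z1 z2 ⊢
    tauto
  have hle := card_le_card hsub
  have hcu : (b1 ∪ b2 ∪ b3).card ≥ 6 := by
    have := card_union_add_card_inter (b1 ∪ b2) b3
    have h' : ((b1 ∪ b2) ∩ b3).card ≤ (b1 ∩ b3).card + (b2 ∩ b3).card := by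
      rw [union_inter_distrib_right]; exact card_union_le _ _
    have := (hTB b3 hb3).2
    omega
  have hs : b1 ∪ b2 ∪ b3 ⊆ V.erase x := by
    apply union_subset (union_subset _ _)
    · exact subset_erase.2 ⟨(hTB _ hb3).1, hxB _ hb3⟩
    · exact subset_erase.2 ⟨(hTB _ hb1).1, hxB _ hb1⟩
    · exact subset_erase.2 ⟨(hTB _ hb2).1, hxB _ hb2⟩
  have hsd := card_sdiff_add_card_eq_card hs
  rw [card_erase_of_mem hxV, hV] at hsd
  rw [card_powersetCard] at hle
  rw [card_powersetCard, card_powersetCard] at hui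
  have h2 := Nat.choose_le_choose 2 (show (V.erase x \ (b1 ∪ b2 ∪ b3)).card ≤ 3 by omega)
  have h3' : Nat.choose 3 2 = 3 := by decide
  have h4 : Nat.choose 4 2 = 6 := by decide
  have h5 := Nat.choose_le_choose 2 (show 4 ≤ (S b1 b2).card by omega)
  have h6 := Nat.choose_le_choose 2 (show 4 ≤ (S b1 b3).card by omega)
  rw [bb10 (le_refl _)]
  rw [hV] at hM
  omega

lemma star_stage {V : Finset ℕ} {H : Finset (Finset ℕ)} {m : ℕ} (hV : V.card = m) (hm : 9 ≤ m)
    (hT : ThreeGraphOn V H) (hS : StarH H) : H.card ≤ bb m := by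
  classical
  obtain ⟨I, hI, hmax⟩ := exists_max_image (H.powerset.filter Itg) card
    ⟨∅, by simp [Itg]⟩
  rw [mem_filter, mem_powerset] at hI
  obtain ⟨hIH, hI⟩ := hI
  have hne : ∀ e ∈ H, ¬ Disjoint e e := by
    intro e he h
    rw [disjoint_self_iff_empty] at h
    have := (hT e he).2; rw [h] at this; simp at this
  set BB := H \ I with hBB
  have hBH : BB ⊆ H := sdiff_subset
  have f1 : ∀ b, ∃ a, b ∈ BB → a ∈ I ∧ Disjoint a b := by
    intro b
    by_cases hb : b ∈ BB
    · by_contra hcon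
      push Not at hcon
      have hcon' : ∀ a ∈ I, ¬ Disjoint a b := fun a ha => (hcon a).2 ha
      have := hmax (insert b I) (by
        rw [mem_filter, mem_powerset]
        refine ⟨insert_subset (hBH hb) hIH, ?_⟩
        intro e he f hf
        rcases mem_insert.1 he with he1 | he1 <;> rcases mem_insert.1 hf with hf1 | hf1
        · rw [he1, hf1]; exact hne _ (hBH hb)
        · rw [he1]; exact fun h => hcon' f hf1 h.symm
        · rw [hf1]; exact hcon' e he1
        · exact hI e he1 f hf1)
      rw [card_insert_of_notMem (mem_sdiff.1 hb).2] at this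
      omega
    · exact ⟨∅, fun h => absurd h hb⟩
  choose a ha using f1
  have f2 : Itg BB := by
    intro b hb c hc hd
    rcases hS b (hBH hb) c (hBH hc) hd with h | h
    · have := h (a b) (hIH (ha b hb).1) (ha b hb).2
      exact (mem_sdiff.1 hc).2 (this ▸ (ha b hb).1)
    · have := h (a c) (hIH (ha c hc).1) (ha c hc).2
      exact (mem_sdiff.1 hb).2 (this ▸ (ha c hc).1)
  have f3 : ∀ e ∈ I, ∀ b ∈ BB, ∀ c ∈ BB, b ≠ c → Disjoint e b → Disjoint e c → False := by
    intro e he b hb c hc hbc h1 h2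
    have u1 : ∀ f ∈ H, Disjoint f b → f = e := by
      rcases hS e (hIH he) b (hBH hb) h1 with h | h
      · exact absurd (h c (hBH hc) h2.symm).symm hbc
      · exact h
    have u2 : ∀ f ∈ H, Disjoint f c → f = e := by
      rcases hS e (hIH he) c (hBH hc) h2 with h | h
      · exact absurd (h b (hBH hb) h1.symm) hbc
      · exact h
    have hbI := (mem_sdiff.1 hb).2
    have hcI := (mem_sdiff.1 hc).2
    have := hmax (insert b (insert c (I.erase e))) (by
      rw [mem_filter, mem_powerset]
      refine ⟨insert_subset (hBH hb) (insert_subset (hBH hc) ((erase_subset _ _).trans hIH)), ?_⟩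
      have hb' : ∀ f ∈ I.erase e, ¬ Disjoint f b := fun f hf h =>
        (mem_erase.1 hf).1 (u1 f (hIH (mem_erase.1 hf).2) h)
      have hc' : ∀ f ∈ I.erase e, ¬ Disjoint f c := fun f hf h =>
        (mem_erase.1 hf).1 (u2 f (hIH (mem_erase.1 hf).2) h)
      intro x hx y hy
      simp only [mem_insert] at hx hy
      rcases hx with rfl | rfl | hx <;> rcases hy with rfl | rfl | hy
      · exact f2 _ hb _ hb
      · exact f2 _ hb _ hc
      · exact fun h => hb' _ hy h.symm
      · exact f2 _ hc _ hb
      · exact f2 _ hc _ hc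
      · exact fun h => hc' _ hy h.symm
      · exact hb' _ hx
      · exact hc' _ hx
      · exact hI _ (mem_erase.1 hx).2 _ (mem_erase.1 hy).2)
    rw [card_insert_of_notMem, card_insert_of_notMem, card_erase_of_mem he] at this
    · have := card_pos.2 ⟨e, he⟩
      omega
    · exact fun h => hcI (mem_erase.1 h).2
    · intro h
      rcases mem_insert.1 h with h | h
      · exact hbc h
      · exact hbI (mem_erase.1 h).2
  have f4 : BB.card ≤ 10 := by
    have := bollobas3 (BB ×ˢ (univ : Finset Bool)) (fun p => if p.2 then a p.1 else p.1)
      (fun p => if p.2 then p.1 else a p.1) (by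
        rintro ⟨b, t⟩ hb
        have hb := (mem_product.1 hb).1
        cases t
        · exact (hT b (hBH hb)).2
        · exact (hT _ (hIH (ha b hb).1)).2) (by
        rintro ⟨b, t⟩ hb
        have hb := (mem_product.1 hb).1
        cases t
        · exact (hT _ (hIH (ha b hb).1)).2
        · exact (hT b (hBH hb)).2) (by
        rintro ⟨b, t⟩ hb
        have hb := (mem_product.1 hb).1
        cases t
        · exact (ha b hb).2.symm
        · exact (ha b hb).2) (by
        rintro ⟨b, t⟩ hb ⟨c, s⟩ hc hne'
        have hb := (mem_product.1 hb).1
        have hc := (mem_product.1 hc).1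
        cases t <;> cases s
        · intro h
          exact f3 (a c) (ha c hc).1 b hb c hc (fun h => hne' (by simp [h])) (by simpa using h.symm) (ha c hc).2
        · simpa using f2 b hb c hc
        · simpa using hI (a b) (ha b hb).1 (a c) (ha c hc).1
        · intro h
          exact f3 (a b) (ha b hb).1 b hb c hc (fun h => hne' (by simp [h])) (ha b hb).2 (by simpa using h))
    rw [card_product] at this
    simp at this
    omega
  have hsum : H.card = I.card + BB.card := by
    rw [hBB, add_comm, card_sdiff_add_card_eq_card hIH]
  have hTI := hT.mono hIH
  have hTB := hT.mono hBH
  by_cases hr : BB.card ≤ 2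
  · have := ekr hV (by omega) hTI hI
    have := bb_ge2 hm
    omega
  rw [hsum]
  by_cases hcm : ∃ x, ∀ e ∈ I, x ∈ e
  · obtain ⟨x, hx⟩ := hcm
    obtain ⟨b, hb⟩ := card_pos.1 (by omega : 0 < BB.card)
    exact common_case hV hm hTI hTB ((hTI _ (ha b hb).1).1 (hx _ (ha b hb).1)) hx
      (fun b hb hxb => disjoint_left.1 (ha b hb).2 (hx _ (ha b hb).1) hxb) f2 f3 (by omega) f4
  push Not at hcm
  by_cases h2c : ∃ x y, ∀ e ∈ I, x ∈ e ∨ y ∈ e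
  · obtain ⟨x, y, hxy⟩ := h2c
    have := two_cover hV (by omega) hTI hI hxy hcm
    have := (bb_ge hm).1
    omega
  push Not at h2c
  have := no_cover_bound (fun e he => (hTI e he).2) hI h2c
  have := (bb_ge hm).2
  omega


def com (P : Finset (Finset ℕ)) : Finset ℕ := (P.biUnion id).filter (fun v => ∀ k ∈ P, v ∈ k)

def SS (P : Finset (Finset ℕ)) : Finset (Finset ℕ) :=
  (powersetCard 2 (P.biUnion id)).filter (fun s => Disjoint s (com P) ∧ ∀ k ∈ P, ¬ Disjoint k s)

lemma mem_com {P : Finset (Finset ℕ)} (hP : P.Nonempty) {v : ℕ} : v ∈ com P ↔ ∀ k ∈ P, v ∈ k := by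
  obtain ⟨E, hE⟩ := hP
  simp only [com, mem_filter, mem_biUnion, id]
  exact ⟨fun h => h.2, fun h => ⟨⟨E, hE, h E hE⟩, h⟩⟩

lemma com_sub {P : Finset (Finset ℕ)} {k : Finset ℕ} (hk : k ∈ P) : com P ⊆ k := by
  intro v hv
  exact (mem_filter.1 hv).2 k hk

lemma exists_avoid {P : Finset (Finset ℕ)} (hP : P.Nonempty) {a : ℕ} (ha : a ∉ com P) :
    ∃ E ∈ P, a ∉ E := by
  rw [mem_com hP] at ha
  push Not at ha
  exact ha

lemma SS_card {P : Finset (Finset ℕ)} (hP : P.Nonempty) (h3 : ∀ k ∈ P, k.card = 3) :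
    (SS P).card ≤ (3 - (com P).card)^2 := by
  obtain ⟨E, hE⟩ := hP
  have hP : P.Nonempty := ⟨E, hE⟩
  have hav : ∀ a, ∃ F ∈ P, a ∉ com P → a ∉ F := by
    intro a
    by_cases ha : a ∈ com P
    · exact ⟨E, hE, fun h => absurd ha h⟩
    · obtain ⟨F, hF, haF⟩ := exists_avoid hP ha
      exact ⟨F, hF, fun _ => haF⟩
  choose F hF haF using hav
  have : SS P ⊆ (E \ com P).biUnion (fun a => (F a \ com P).image (fun b => {a, b})) := by
    intro s hs
    simp only [SS, mem_filter, mem_powersetCard] at hs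
    obtain ⟨⟨-, h2⟩, hd, hm⟩ := hs
    obtain ⟨a, haE, has⟩ := not_disjoint_iff.1 (hm E hE)
    have hac := disjoint_left.1 hd has
    obtain ⟨b, hbF, hbs⟩ := not_disjoint_iff.1 (hm _ (hF a))
    have hbc := disjoint_left.1 hd hbs
    have hab : a ≠ b := by rintro rfl; exact haF a hac hbF
    rw [mem_biUnion]
    exact ⟨a, mem_sdiff.2 ⟨haE, hac⟩, mem_image.2 ⟨b, mem_sdiff.2 ⟨hbF, hbc⟩, (pair_eq has hbs hab h2).symm⟩⟩
  have hc : ∀ k ∈ P, (k \ com P).card = 3 - (com P).card := by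
    intro k hk
    rw [card_sdiff_of_subset (com_sub hk), h3 k hk]
  refine (card_le_card this).trans ((card_biUnion_le_card_mul _ _ (3 - (com P).card) ?_).trans ?_)
  · intro a _
    exact card_image_le.trans (hc _ (hF a)).le
  · rw [hc E hE, sq]

lemma meet_two {V c d : Finset ℕ} {T : Finset (Finset ℕ)} (hc : c ⊆ V) (hd : d ⊆ V) (hcd : Disjoint c d)
    (hT : ∀ e ∈ T, e ⊆ V ∧ e.card = 3 ∧ ¬ Disjoint e c ∧ ¬ Disjoint e d) :
    T.card ≤ (c.card + d.card).choose 3 + c.card * d.card * (V.card - (c.card + d.card)) := by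
  have : T ⊆ powersetCard 3 (c ∪ d) ∪ ((c ×ˢ d) ×ˢ (V \ (c ∪ d))).image (fun z => {z.1.1, z.1.2, z.2}) := by
    intro e he
    obtain ⟨h1, h2, h3, h4⟩ := hT e he
    rw [mem_union]
    by_cases hs : e ⊆ c ∪ d
    · left; exact mem_powersetCard.2 ⟨hs, h2⟩
    · right
      obtain ⟨z, hz, hz'⟩ := not_subset.1 hs
      obtain ⟨a, ha, hac⟩ := not_disjoint_iff.1 h3
      obtain ⟨b, hb, hbd⟩ := not_disjoint_iff.1 h4
      rw [mem_image]
      refine ⟨((a, b), z), ?_, ?_⟩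
      · simp only [mem_product, mem_sdiff]; exact ⟨⟨hac, hbd⟩, h1 hz, hz'⟩
      · refine (triple_eq ha hb hz ?_ ?_ ?_ h2).symm
        · rintro rfl; exact disjoint_left.1 hcd hac hbd
        · rintro rfl; exact hz' (mem_union_left _ hac)
        · rintro rfl; exact hz' (mem_union_right _ hbd)
  refine (card_le_card this).trans ((card_union_le _ _).trans ?_)
  rw [card_powersetCard, card_union_of_disjoint hcd]
  gcongr
  refine card_image_le.trans ?_
  rw [card_product, card_product, card_sdiff_of_subset (union_subset hc hd), card_union_of_disjoint hcd]

lemma half_case {P Q : Finset (Finset ℕ)} {e : Finset ℕ} (hP : P.Nonempty) (hQ : Q.Nonempty)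
    (hdis : ∀ a ∈ P, ∀ b ∈ Q, Disjoint a b) (h3 : e.card = 3)
    (hmP : ∀ k ∈ P, ¬ Disjoint e k) (hmQ : ∀ k ∈ Q, ¬ Disjoint e k) (hc : Disjoint e (com P)) :
    e ∈ (com Q ×ˢ SS P).image (fun z => insert z.1 z.2) := by
  have hP' := hP
  obtain ⟨E, hE⟩ := hP'
  have hQ' := hQ
  obtain ⟨F, hF⟩ := hQ'
  obtain ⟨a, hae, haE⟩ := not_disjoint_iff.1 (hmP E hE)
  obtain ⟨E', hE', haE'⟩ := exists_avoid hP (disjoint_left.1 hc hae)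
  obtain ⟨b, hbe, hbE⟩ := not_disjoint_iff.1 (hmP E' hE')
  obtain ⟨w, hwe, hwF⟩ := not_disjoint_iff.1 (hmQ F hF)
  have hab : a ≠ b := by rintro rfl; exact haE' hbE
  have hwa : w ≠ a := by rintro rfl; exact disjoint_left.1 (hdis E hE F hF) haE hwF
  have hwb : w ≠ b := by rintro rfl; exact disjoint_left.1 (hdis E' hE' F hF) hbE hwF
  have he := triple_eq hwe hae hbe hwa hwb hab h3
  rw [mem_image]
  refine ⟨(w, {a, b}), mem_product.2 ⟨?_, ?_⟩, he.symm⟩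
  · rw [mem_com hQ]
    intro k hk
    obtain ⟨z, hz, hzk⟩ := not_disjoint_iff.1 (hmQ k hk)
    rw [he] at hz
    simp only [mem_insert, mem_singleton] at hz
    rcases hz with rfl | rfl | rfl
    · exact hzk
    · exact absurd hzk (disjoint_left.1 (hdis E hE k hk) haE)
    · exact absurd hzk (disjoint_left.1 (hdis E' hE' k hk) hbE)
  · simp only [SS, mem_filter, mem_powersetCard]
    refine ⟨⟨?_, card_pair hab⟩, ?_, ?_⟩
    · intro z hz
      rw [mem_biUnion]
      simp only [mem_insert, mem_singleton] at hz
      rcases hz with rfl | rfl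
      · exact ⟨E, hE, haE⟩
      · exact ⟨E', hE', hbE⟩
    · refine hc.mono_left ?_
      intro z hz
      simp only [mem_insert, mem_singleton] at hz
      rcases hz with rfl | rfl
      exacts [hae, hbe]
    · intro k hk
      obtain ⟨z, hz, hzk⟩ := not_disjoint_iff.1 (hmP k hk)
      rw [not_disjoint_iff]
      refine ⟨z, hzk, ?_⟩
      rw [he] at hz
      simp only [mem_insert, mem_singleton] at hz ⊢
      rcases hz with rfl | h
      · exact absurd hwF (disjoint_left.1 (hdis k hk F hF) hzk)
      · exact h

lemma R_count {V : Finset ℕ} {P Q R : Finset (Finset ℕ)} {m : ℕ} (hV : V.card = m) (hP : P.Nonempty) (hQ : Q.Nonempty)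
    (hTP : ThreeGraphOn V P) (hTQ : ThreeGraphOn V Q) (hTR : ThreeGraphOn V R)
    (hdis : ∀ a ∈ P, ∀ b ∈ Q, Disjoint a b)
    (hmP : ∀ e ∈ R, ∀ k ∈ P, ¬ Disjoint e k) (hmQ : ∀ e ∈ R, ∀ k ∈ Q, ¬ Disjoint e k) :
    R.card ≤ ((com P).card + (com Q).card).choose 3 +
      (com P).card * (com Q).card * (m - ((com P).card + (com Q).card)) +
      (com Q).card * (3 - (com P).card)^2 + (com P).card * (3 - (com Q).card)^2 := by
  have hsub : R ⊆ R.filter (fun e => ¬ Disjoint e (com P) ∧ ¬ Disjoint e (com Q)) ∪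
      (com Q ×ˢ SS P).image (fun z => insert z.1 z.2) ∪ (com P ×ˢ SS Q).image (fun z => insert z.1 z.2) := by
    intro e he
    rw [mem_union, mem_union]
    by_cases h1 : Disjoint e (com P)
    · left; right
      exact half_case hP hQ hdis (hTR e he).2 (hmP e he) (hmQ e he) h1
    by_cases h2 : Disjoint e (com Q)
    · right
      exact half_case hQ hP (fun a ha b hb => (hdis b hb a ha).symm) (hTR e he).2 (hmQ e he) (hmP e he) h2
    · left; left
      rw [mem_filter]; exact ⟨he, h1, h2⟩
  obtain ⟨E, hE⟩ := hP
  obtain ⟨F, hF⟩ := hQ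
  have hm2 := meet_two (V := V) (c := com P) (d := com Q)
    (T := R.filter (fun e => ¬ Disjoint e (com P) ∧ ¬ Disjoint e (com Q)))
    ((com_sub hE).trans (hTP E hE).1) ((com_sub hF).trans (hTQ F hF).1)
    ((hdis E hE F hF).mono (com_sub hE) (com_sub hF)) (by
      intro e he
      rw [mem_filter] at he
      exact ⟨(hTR e he.1).1, (hTR e he.1).2, he.2⟩)
  rw [hV] at hm2
  refine (card_le_card hsub).trans ((card_union_le _ _).trans ?_)
  gcongr
  · refine (card_union_le _ _).trans ?_
    gcongr
    refine card_image_le.trans ?_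
    rw [card_product]
    gcongr
    exact SS_card ⟨E, hE⟩ (fun k hk => (hTP k hk).2)
  · refine card_image_le.trans ?_
    rw [card_product]
    gcongr
    exact SS_card ⟨F, hF⟩ (fun k hk => (hTQ k hk).2)

/-- type bounds -/
lemma type2 {U : Finset ℕ} {P : Finset (Finset ℕ)} (hT : ThreeGraphOn U P) (hP : P.Nonempty)
    (h : (com P).card = 2) : P.card + 2 ≤ U.card := by
  obtain ⟨E, hE⟩ := hP
  have hcU : com P ⊆ U := (com_sub hE).trans (hT E hE).1
  have : P ⊆ (U \ com P).image (fun z => insert z (com P)) := by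
    intro e he
    have h1 : (e \ com P).card = 1 := by rw [card_sdiff_of_subset (com_sub he), (hT e he).2, h]
    obtain ⟨z, hz⟩ := card_eq_one.1 h1
    have hz' : z ∈ e \ com P := by rw [hz]; simp
    rw [mem_sdiff] at hz'
    rw [mem_image]
    refine ⟨z, mem_sdiff.2 ⟨(hT e he).1 hz'.1, hz'.2⟩, ?_⟩
    rw [← union_sdiff_of_subset (com_sub he), hz, union_comm]; rfl
  have h2 := (card_le_card this).trans card_image_le
  have h3 := card_sdiff_add_card_eq_card hcU
  omega

lemma type1 {U : Finset ℕ} {P : Finset (Finset ℕ)} (hT : ThreeGraphOn U P) (hP : P.Nonempty)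
    (h : (com P).card = 1) : P.card ≤ (U.card - 1).choose 2 := by
  obtain ⟨x, hx⟩ := card_eq_one.1 h
  obtain ⟨E, hE⟩ := hP
  have hx' : x ∈ com P := by rw [hx]; simp
  have := star_count hT ((hT E hE).1 (com_sub hE hx')) (fun e he => com_sub he hx') ∅ (by simp) (by simp)
  simpa using this

lemma com_card_le {U : Finset ℕ} {P : Finset (Finset ℕ)} (hT : ThreeGraphOn U P) (h2 : 2 ≤ P.card) :
    (com P).card ≤ 2 ∧ 4 ≤ U.card := by
  obtain ⟨e, he, f, hf, hne⟩ := one_lt_card.1 h2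
  have h1 : (e ∩ f).card < 3 := by
    by_contra hh
    apply hne
    have i1 : e ∩ f = e := eq_of_subset_of_card_le inter_subset_left (by have := (hT e he).2; omega)
    have i2 : e ∩ f = f := eq_of_subset_of_card_le inter_subset_right (by have := (hT f hf).2; omega)
    rw [← i1, i2]
  have h3 := card_le_card (subset_inter (com_sub he) (com_sub hf))
  have h4 := card_le_card (union_subset (hT e he).1 (hT f hf).1)
  have h5 := card_union_add_card_inter e f
  have := (hT e he).2
  have := (hT f hf).2
  omega

lemma type0_six {U : Finset ℕ} {P : Finset (Finset ℕ)} (hT : ThreeGraphOn U P) (h6 : U.card = 6)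
    {s : Finset ℕ} (hs : s ⊆ U) (hs2 : s.card = 2) (hm : ∀ k ∈ P, ¬ Disjoint k s) : P.card ≤ 16 := by
  have h1 : P ⊆ powersetCard 3 U \ powersetCard 3 (U \ s) := by
    intro k hk
    rw [mem_sdiff, mem_powersetCard, mem_powersetCard]
    refine ⟨hT k hk, fun h => hm k hk ?_⟩
    rw [disjoint_left]
    intro z hz hzs
    exact (mem_sdiff.1 (h.1 hz)).2 hzs
  have h2 := card_le_card h1
  rw [card_sdiff_of_subset (powersetCard_mono sdiff_subset), card_powersetCard, card_powersetCard,
    card_sdiff_of_subset hs, h6, hs2] at h2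
  exact h2.trans (by decide)


def bbc (m : ℕ) : ℕ :=
  if m ≤ 6 then m*(m-1)*(m-2)/6 else if m = 7 then 20 else if m = 8 then 28 else
  if m = 9 then 35 else (m-1)*(m-2)/2 + 2

lemma bb_eq (m : ℕ) : bb m = bbc m := by
  rcases Nat.lt_or_ge m 10 with h | h
  · interval_cases m <;> decide
  · rw [bb10 h, Nat.choose_two_right]
    unfold bbc
    rw [if_neg (by omega), if_neg (by omega), if_neg (by omega), if_neg (by omega)]
    rfl

/-- the bound for one side of a split with `j` common vertices -/
def ff (j p : ℕ) : ℕ :=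
  if j = 2 then p - 2 else if j = 1 then (p-1)*(p-2)/2 else if p = 6 then 16 else bbc p

def rr (a b m : ℕ) : ℕ :=
  (a+b).choose 3 + a*b*(m-(a+b)) + b*(3-a)^2 + a*(3-b)^2

lemma bbc_up {p : ℕ} (hp : 3 ≤ p) : 2 * bbc p ≤ (p-1)*(p-2) + 20 := by
  rcases Nat.lt_or_ge p 10 with h | h
  · interval_cases p <;> decide
  · rw [← bb_eq, bb_quad h]; omega

lemma ff_up {j p : ℕ} (hp : 3 ≤ p) : 2 * ff j p ≤ (p-1)*(p-2) + 20 := by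
  unfold ff
  split_ifs with h1 h2 h3
  · obtain ⟨k, rfl⟩ : ∃ k, p = k + 2 := ⟨p - 2, by omega⟩
    simp only [Nat.add_sub_cancel, show k + 2 - 1 = k + 1 by omega]
    nlinarith
  · have := Nat.mul_div_le ((p-1)*(p-2)) 2
    omega
  · subst h3; decide
  · exact bbc_up hp

set_option synthInstance.maxHeartbeats 400000 in
set_option synthInstance.maxSize 2000 in
lemma num_small : ∀ m < 30, ∀ p < m, ∀ q < m - p + 1, 9 ≤ m → 4 ≤ p → 4 ≤ q → ∀ a < 3, ∀ b < 3, 0 < a + b →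
    ff a p + ff b q + rr a b m ≤ bbc m := by decide +kernel

set_option synthInstance.maxHeartbeats 400000 in
set_option synthInstance.maxSize 2000 in
lemma num_small0 : ∀ m < 30, ∀ p < m, ∀ q < m - p + 1, 9 ≤ m → 3 ≤ p → 3 ≤ q →
    bbc p + bbc q ≤ bbc m := by decide +kernel

lemma rr_up {a b m : ℕ} (ha : a < 3) (hb : b < 3) (hm : 9 ≤ m) (h : ¬ (a = 2 ∧ b = 2)) :
    rr a b m ≤ 2 * m + 11 := by
  unfold rr
  interval_cases a <;> interval_cases b <;> simp [Nat.choose] at h ⊢ <;> omega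

lemma conv {p q m k : ℕ} (hp : k + 2 ≤ p) (hq : k + 2 ≤ q) (h : p + q ≤ m) :
    (p-1)*(p-2) + (q-1)*(q-2) ≤ (m-k-3)*(m-k-4) + (k+1)*k := by
  obtain ⟨x, rfl⟩ : ∃ x, p = x + (k + 2) := ⟨p - (k+2), by omega⟩
  obtain ⟨y, rfl⟩ : ∃ y, q = y + (k + 2) := ⟨q - (k+2), by omega⟩
  obtain ⟨z, rfl⟩ : ∃ z, m = x + y + z + (2*k + 4) := ⟨m - (x + y + (2*k+4)), by omega⟩
  have e1 : x + (k+2) - 1 = x + k + 1 := by omega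
  have e2 : x + (k+2) - 2 = x + k := by omega
  have e3 : y + (k+2) - 1 = y + k + 1 := by omega
  have e4 : y + (k+2) - 2 = y + k := by omega
  have e5 : x + y + z + (2*k + 4) - k - 3 = x + y + z + k + 1 := by omega
  have e6 : x + y + z + (2*k + 4) - k - 4 = x + y + z + k := by omega
  rw [e1, e2, e3, e4, e5, e6]
  nlinarith [Nat.zero_le (x*y), Nat.zero_le (x*z), Nat.zero_le (y*z), Nat.zero_le (z*z), Nat.zero_le (z*k)]

lemma num_a {m p q a b : ℕ} (hm : 9 ≤ m) (hp : 4 ≤ p) (hq : 4 ≤ q) (h : p + q ≤ m) (ha : a < 3) (hb : b < 3)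
    (hab : 0 < a + b) : ff a p + ff b q + rr a b m ≤ bb m := by
  rcases Nat.lt_or_ge m 30 with h1 | h1
  · rw [bb_eq]
    exact num_small m h1 p (by omega) q (by omega) hm hp hq a ha b hb hab
  · have hB := bb_quad (m := m) (by omega)
    obtain ⟨k, rfl⟩ : ∃ k, m = k + 30 := ⟨m - 30, by omega⟩
    by_cases h2 : a = 2 ∧ b = 2
    · obtain ⟨rfl, rfl⟩ := h2
      have e : rr 2 2 (k+30) = 4 * k + 112 := by
        unfold rr; simp [Nat.choose]; omega
      rw [e]
      simp only [ff, if_true]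
      simp only [show k + 30 - 1 = k + 29 by omega, show k + 30 - 2 = k + 28 by omega] at hB
      have : p - 2 + (q - 2) ≤ k + 26 := by omega
      nlinarith
    · have h3 := rr_up ha hb hm h2
      have h4 := ff_up (j := a) (p := p) (by omega)
      have h5 := ff_up (j := b) (p := q) (by omega)
      have h6 := conv (k := 2) hp hq h
      simp only [show k + 30 - 1 = k + 29 by omega, show k + 30 - 2 = k + 28 by omega,

        show k + 28 - 3 = k + 25 by omega, show k + 28 - 4 = k + 24 by omega] at hB h6
      nlinarith

lemma num_0 {m p q : ℕ} (hm : 9 ≤ m) (hp : 3 ≤ p) (hq : 3 ≤ q) (h : p + q ≤ m) : bb p + bb q ≤ bb m := by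
  rcases Nat.lt_or_ge m 30 with h1 | h1
  · rw [bb_eq, bb_eq, bb_eq]
    exact num_small0 m h1 p (by omega) q (by omega) hm hp hq
  · have hB := bb_quad (m := m) (by omega)
    have h4 := bbc_up hp
    have h5 := bbc_up hq
    rw [← bb_eq] at h4 h5
    have h6 := conv (k := 1) hp hq h
    obtain ⟨k, rfl⟩ : ∃ k, m = k + 30 := ⟨m - 30, by omega⟩
    simp only [show k + 30 - 1 = k + 29 by omega, show k + 30 - 2 = k + 28 by omega,
        show k + 29 - 3 = k + 26 by omega, show k + 29 - 4 = k + 25 by omega] at hB h6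
    nlinarith

lemma bb_mono {p q : ℕ} (h : p ≤ q) : bb p ≤ bb q := by
  induction q, h using Nat.le_induction with
  | base => rfl
  | succ n hn ih =>
    refine ih.trans ?_
    rcases Nat.lt_or_ge n 10 with h | h
    · rw [bb_eq, bb_eq]
      interval_cases n <;> decide
    · rw [bb10 h, bb10 (by omega)]
      have := Nat.choose_le_choose 2 (show n - 1 ≤ n + 1 - 1 by omega)
      omega

lemma num_b {m : ℕ} (hm : 9 ≤ m) : bb (m-3) + 10 ≤ bb m ∧ 4 * m - 2 ≤ bb m := by
  rcases Nat.lt_or_ge m 30 with h1 | h1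
  · rw [bb_eq, bb_eq]
    interval_cases m <;> decide
  · have hB := bb_quad (m := m) (by omega)
    have hC := bb_quad (m := m-3) (by omega)
    obtain ⟨k, rfl⟩ : ∃ k, m = k + 30 := ⟨m - 30, by omega⟩
    simp only [show k + 30 - 1 = k + 29 by omega, show k + 30 - 2 = k + 28 by omega,
      show k + 30 - 3 = k + 27 by omega, show k + 27 - 1 = k + 26 by omega, show k + 27 - 2 = k + 25 by omega] at hB hC ⊢
    constructor
    · nlinarith
    · have : 4 * (k + 30) - 2 = 4 * k + 118 := by omega
      nlinarith


lemma tg_un {V : Finset ℕ} {P : Finset (Finset ℕ)} (h : ThreeGraphOn V P) : ThreeGraphOn (P.biUnion id) P :=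
  fun e he => ⟨subset_biUnion_of_mem id he, (h e he).2⟩

lemma un_sub {V : Finset ℕ} {P : Finset (Finset ℕ)} (h : ThreeGraphOn V P) : P.biUnion id ⊆ V :=
  biUnion_subset.2 fun e he => (h e he).1

lemma un_disj {P Q : Finset (Finset ℕ)} (h : ∀ a ∈ P, ∀ b ∈ Q, Disjoint a b) :
    Disjoint (P.biUnion id) (Q.biUnion id) := by
  rw [disjoint_biUnion_left]
  intro a ha
  rw [disjoint_biUnion_right]
  exact fun b hb => h a ha b hb

lemma un_ge {V : Finset ℕ} {P : Finset (Finset ℕ)} (h : ThreeGraphOn V P) (hP : P.Nonempty) :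
    3 ≤ (P.biUnion id).card := by
  obtain ⟨e, he⟩ := hP
  rw [← (h e he).2]
  exact card_le_card (subset_biUnion_of_mem id he)

lemma un_sum {V : Finset ℕ} {P Q : Finset (Finset ℕ)} (hP : ThreeGraphOn V P) (hQ : ThreeGraphOn V Q)
    (h : ∀ a ∈ P, ∀ b ∈ Q, Disjoint a b) : (P.biUnion id).card + (Q.biUnion id).card ≤ V.card := by
  rw [← card_union_of_disjoint (un_disj h)]
  exact card_le_card (union_subset (un_sub hP) (un_sub hQ))

lemma side {V : Finset ℕ} {P Q : Finset (Finset ℕ)} {e : Finset ℕ} (hT : ThreeGraphOn V P) (hP : P.Nonempty) (hQ : Q.Nonempty)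
    (hdis : ∀ a ∈ P, ∀ b ∈ Q, Disjoint a b) (h3 : e.card = 3)
    (hmP : ∀ k ∈ P, ¬ Disjoint e k) (hmQ : ∀ k ∈ Q, ¬ Disjoint e k)
    (hj : (com P).card ≤ 2) (hb : P.card ≤ bb (P.biUnion id).card) :
    P.card ≤ ff (com P).card (P.biUnion id).card := by
  unfold ff
  split_ifs with h1 h2 h4
  · have := type2 (tg_un hT) hP h1; omega
  · have := type1 (tg_un hT) hP h2
    rwa [Nat.choose_two_right] at this
  · have h0 : com P = ∅ := by rw [← card_eq_zero]; omega
    have := half_case hP hQ hdis h3 hmP hmQ (by rw [h0]; exact disjoint_empty_right _)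
    rw [mem_image] at this
    obtain ⟨z, hz, -⟩ := this
    have hz2 := (mem_product.1 hz).2
    simp only [SS, mem_filter, mem_powersetCard] at hz2
    exact type0_six (tg_un hT) h4 hz2.1.1 hz2.1.2 hz2.2.2
  · rwa [← bb_eq]

def IHyp (m : ℕ) : Prop := ∀ (U : Finset ℕ) (K : Finset (Finset ℕ)), U.card < m → ThreeGraphOn U K → PF K →
  K.card ≤ bb U.card

lemma split_card {H P Q : Finset (Finset ℕ)} : H.card ≤ P.card + Q.card + (H \ (P ∪ Q)).card := by
  have h1 : H ⊆ (P ∪ Q) ∪ (H \ (P ∪ Q)) := by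
    intro x hx
    by_cases h : x ∈ P ∪ Q
    · exact mem_union_left _ h
    · exact mem_union_right _ (mem_sdiff.2 ⟨hx, h⟩)
  have := card_le_card h1
  have h2 := card_union_le (P ∪ Q) (H \ (P ∪ Q))
  have h3 := card_union_le P Q
  omega

lemma case_a {V : Finset ℕ} {H P Q : Finset (Finset ℕ)} {m : ℕ} (hV : V.card = m) (hm : 9 ≤ m)
    (hT : ThreeGraphOn V H) (hp : PF H) (ih : IHyp m) (hs : IsSplit H P Q)
    (h : (H \ (P ∪ Q)).Nonempty → 2 ≤ P.card ∧ 2 ≤ Q.card) : H.card ≤ bb m := by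
  have hTP := hT.mono hs.hP
  have hTQ := hT.mono hs.hQ
  have gP := un_ge hTP hs.neP
  have gQ := un_ge hTQ hs.neQ
  have gs := un_sum hTP hTQ hs.disj
  have iP := ih _ P (by omega) (tg_un hTP) (hp.mono hs.hP)
  have iQ := ih _ Q (by omega) (tg_un hTQ) (hp.mono hs.hQ)
  have hc := split_card (H := H) (P := P) (Q := Q)
  by_cases hR : (H \ (P ∪ Q)).Nonempty
  · obtain ⟨h2P, h2Q⟩ := h hR
    obtain ⟨e, he⟩ := hR
    have heH := (mem_sdiff.1 he).1
    have e3 := (hT e heH).2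
    obtain ⟨jP, fP⟩ := com_card_le (tg_un hTP) h2P
    obtain ⟨jQ, fQ⟩ := com_card_le (tg_un hTQ) h2Q
    have sP := side hTP hs.neP hs.neQ hs.disj e3 (hs.meetP e he) (hs.meetQ e he) jP iP
    have sQ := side hTQ hs.neQ hs.neP hs.symm.disj e3 (hs.meetQ e he) (hs.meetP e he) jQ iQ
    have hr := R_count hV hs.neP hs.neQ hTP hTQ (hT.mono sdiff_subset) hs.disj hs.meetP hs.meetQ
    have hn := num_a (a := (com P).card) (b := (com Q).card) hm fP fQ (by omega) (by omega) (by omega) (by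
      by_contra h0
      have h01 : com P = ∅ := by rw [← card_eq_zero]; omega
      have h02 : com Q = ∅ := by rw [← card_eq_zero]; omega
      have := half_case hs.neP hs.neQ hs.disj e3 (hs.meetP e he) (hs.meetQ e he) (by rw [h01]; exact disjoint_empty_right _)
      rw [h02] at this
      simp at this)
    unfold rr at hn
    omega
  · rw [not_nonempty_iff_eq_empty] at hR
    rw [hR, card_empty] at hc
    have := num_0 hm gP gQ (show _ ≤ m by omega)
    omega

lemma b2_form {B E F e : Finset ℕ} (hBE : Disjoint B E) (hBF : Disjoint B F) (hEF : Disjoint E F) (h3 : e.card = 3)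
    (hB : ¬ Disjoint e B) (hE : ¬ Disjoint e E) (hF : ¬ Disjoint e F) :
    ∃ b ∈ B, ∃ x ∈ E, ∃ y ∈ F, e = {b, x, y} := by
  obtain ⟨b, hbe, hb⟩ := not_disjoint_iff.1 hB
  obtain ⟨x, hxe, hx⟩ := not_disjoint_iff.1 hE
  obtain ⟨y, hye, hy⟩ := not_disjoint_iff.1 hF
  refine ⟨b, hb, x, hx, y, hy, triple_eq hbe hxe hye ?_ ?_ ?_ h3⟩
  · rintro rfl; exact disjoint_left.1 hBE hb hx
  · rintro rfl; exact disjoint_left.1 hBF hb hy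
  · rintro rfl; exact disjoint_left.1 hEF hx hy


lemma exists_idx {B : Finset ℕ} (hB : B.card = 3) :
    ∃ f : ℕ → ZMod 3, ∀ x ∈ B, ∀ y ∈ B, f x = f y → x = y := by
  obtain ⟨a, b, c, hab, hac, hbc, rfl⟩ := card_eq_three.1 hB
  refine ⟨fun z => if z = a then 0 else if z = b then 1 else 2, ?_⟩
  have h1 : (0 : ZMod 3) ≠ 1 := by decide
  have h2 : (0 : ZMod 3) ≠ 2 := by decide
  have h3 : (1 : ZMod 3) ≠ 2 := by decide
  intro x hx y hy
  simp only [mem_insert, mem_singleton] at hx hy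
  rcases hx with rfl | rfl | rfl <;> rcases hy with rfl | rfl | rfl <;>
    simp [hab.symm, hac.symm, hbc.symm, hab, hac, hbc, h1, h2, h3, h1.symm, h2.symm, h3.symm]

lemma b2_itg {B E F : Finset ℕ} {R : Finset (Finset ℕ)} (hBE : Disjoint B E) (hBF : Disjoint B F)
    (hEF : Disjoint E F) (cB : B.card = 3) (cE : E.card = 3) (cF : F.card = 3)
    (hR : ∀ e ∈ R, ∃ b ∈ B, ∃ x ∈ E, ∃ y ∈ F, e = {b, x, y}) (hI : Itg R) : R.card ≤ 9 := by
  obtain ⟨f, hf⟩ := exists_idx cB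
  obtain ⟨g, hg⟩ := exists_idx cE
  obtain ⟨h, hh⟩ := exists_idx cF
  have hR' : ∀ e, ∃ b x y, e ∈ R → b ∈ B ∧ x ∈ E ∧ y ∈ F ∧ e = {b, x, y} := by
    intro e
    by_cases he : e ∈ R
    · obtain ⟨b, hb, x, hx, y, hy, hh⟩ := hR e he
      exact ⟨b, x, y, fun _ => ⟨hb, hx, hy, hh⟩⟩
    · exact ⟨0, 0, 0, fun h => absurd h he⟩
  choose β ξ η hβ using hR'
  have : R.card ≤ (univ : Finset (ZMod 3 × ZMod 3)).card := by
    apply card_le_card_of_injOn (fun e => (g (ξ e) - f (β e), h (η e) - f (β e))) (fun _ _ => mem_coe.2 (mem_univ _))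
    intro e he e' he' heq
    obtain ⟨h1, h2, h3, h4⟩ := hβ e he
    obtain ⟨k1, k2, k3, k4⟩ := hβ e' he'
    simp only [Prod.mk.injEq] at heq
    obtain ⟨q1, q2⟩ := heq
    by_cases hb : β e = β e'
    · rw [hb] at q1 q2
      have e1 := hg _ h2 _ k2 (by simpa using q1)
      have e2 := hh _ h3 _ k3 (by simpa using q2)
      exact h4.trans ((by rw [hb, e1, e2] : _ = ({β e', ξ e', η e'} : Finset ℕ)).trans k4.symm)
    · exfalso
      have n1 : ξ e ≠ ξ e' := by
        intro hx; rw [hx] at q1; exact hb (hf _ h1 _ k1 (by simpa using q1))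
      have n2 : η e ≠ η e' := by
        intro hx; rw [hx] at q2; exact hb (hf _ h1 _ k1 (by simpa using q2))
      apply hI e he e' he'
      rw [disjoint_left] at hBE hBF hEF
      rw [h4, k4, disjoint_left]
      intro z hz hz'
      simp only [mem_insert, mem_singleton] at hz hz'
      grind
  simpa using this

lemma b2_count {B : Finset ℕ} {R : Finset (Finset ℕ)} {S : Finset (ℕ × ℕ)} (cB : B.card = 3)
    (hR : ∀ e ∈ R, ∃ b ∈ B, ∃ z ∈ S, e = {b, z.1, z.2}) : R.card ≤ 3 * S.card := by
  have : R ⊆ (B ×ˢ S).image (fun t => {t.1, t.2.1, t.2.2}) := by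
    intro e he
    obtain ⟨b, hb, z, hz, rfl⟩ := hR e he
    exact mem_image.2 ⟨(b, z), mem_product.2 ⟨hb, hz⟩, rfl⟩
  refine (card_le_card this).trans (card_image_le.trans ?_)
  rw [card_product, cB]

lemma b2_pairs {E F G : Finset ℕ} (hEF : Disjoint E F) (cE : E.card = 3) (cF : F.card = 3) (cG : G.card = 3)
    (hGE : G ≠ E) (hGF : G ≠ F) : (E ×ˢ F \ (E \ G) ×ˢ (F \ G)).card ≤ 7 := by
  rw [card_sdiff_of_subset (product_subset_product sdiff_subset sdiff_subset), card_product, card_product, cE, cF]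
  have k1 : (E \ G).card + (E ∩ G).card = 3 := by rw [card_sdiff_add_card_inter, cE]
  have k2 : (F \ G).card + (F ∩ G).card = 3 := by rw [card_sdiff_add_card_inter, cF]
  have k3 : (E ∩ G).card + (F ∩ G).card ≤ 3 := by
    rw [← cG, ← card_union_of_disjoint (hEF.mono inter_subset_left inter_subset_left)]
    exact card_le_card (union_subset inter_subset_right inter_subset_right)
  have k4 : 0 < (E \ G).card := by
    rw [card_pos, sdiff_nonempty]
    intro h
    exact hGE (eq_of_subset_of_card_le h (by omega)).symm
  have k5 : 0 < (F \ G).card := by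
    rw [card_pos, sdiff_nonempty]
    intro h
    exact hGF (eq_of_subset_of_card_le h (by omega)).symm
  generalize (E \ G).card = a at *
  generalize (F \ G).card = b at *
  have ha : a ≤ 3 := by omega
  have hb : b ≤ 3 := by omega
  interval_cases a <;> interval_cases b <;> omega

lemma case_b2 {V B E F : Finset ℕ} {H Q : Finset (Finset ℕ)} {m : ℕ} (hV : V.card = m) (hm : 9 ≤ m)
    (hT : ThreeGraphOn V H) (hp : PF H) (ih : IHyp m) (hs : IsSplit H {B} Q)
    (hE : E ∈ Q) (hF : F ∈ Q) (hEF : Disjoint E F) : H.card ≤ bb m := by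
  have hTP := hT.mono hs.hP
  have hTQ := hT.mono hs.hQ
  have gP := un_ge hTP hs.neP
  have gs := un_sum hTP hTQ hs.disj
  have iQ := ih _ Q (by omega) (tg_un hTQ) (hp.mono hs.hQ)
  have hc := split_card (H := H) (P := {B}) (Q := Q)
  have hBB : B ∈ ({B} : Finset (Finset ℕ)) := mem_singleton_self B
  have hBE := hs.disj B hBB E hE
  have hBF := hs.disj B hBB F hF
  have cB := (hTP B hBB).2
  have cE := (hTQ E hE).2
  have cF := (hTQ F hF).2
  have hRf : ∀ e ∈ H \ ({B} ∪ Q), ∃ b ∈ B, ∃ x ∈ E, ∃ y ∈ F, e = {b, x, y} := fun e he =>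
    b2_form hBE hBF hEF (hT e (mem_sdiff.1 he).1).2 (hs.meetP e he B hBB) (hs.meetQ e he E hE) (hs.meetQ e he F hF)
  have n1 := num_b hm
  have hsB : (({B} : Finset (Finset ℕ)).biUnion id).card = 3 := by simpa using cB
  rw [card_singleton] at hc
  by_cases hI : Itg (H \ ({B} ∪ Q))
  · have h9 := b2_itg hBE hBF hEF cB cE cF hRf hI
    have := bb_mono (show (Q.biUnion id).card ≤ m - 3 by omega)
    omega
  · unfold Itg at hI
    push Not at hI
    obtain ⟨C, hC, D, hD, hCD⟩ := hI
    obtain ⟨b, hb, x, hx, y, hy, hCe⟩ := hRf C hC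
    obtain ⟨b', hb', x', hx', y', hy', hDe⟩ := hRf D hD
    have hxy : x ≠ y := by rintro rfl; exact disjoint_left.1 hEF hx hy
    have hxy' : x' ≠ y' := by rintro rfl; exact disjoint_left.1 hEF hx' hy'
    have sE : E ⊆ Q.biUnion id := subset_biUnion_of_mem id hE
    have sF : F ⊆ Q.biUnion id := subset_biUnion_of_mem id hF
    have hq6 : 6 ≤ (Q.biUnion id).card := by
      have := card_le_card (union_subset sE sF)
      rw [card_union_of_disjoint hEF] at this
      omega
    have hcut : ∀ {β ξ η : ℕ} {k K : Finset ℕ}, β ∈ B → K = {β, ξ, η} → k ∈ Q → ¬ Disjoint K k →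
        ¬ Disjoint k {ξ, η} := by
      intro β ξ η k K hβ hK hk hn hd
      apply hn
      have := disjoint_left.1 (hs.disj B hBB k hk) hβ
      rw [hK, disjoint_insert_left]
      exact ⟨this, hd.symm⟩
    have hm2 := meet_two (V := Q.biUnion id) (c := {x, y}) (d := {x', y'}) (T := Q)
      (by intro z hz; simp only [mem_insert, mem_singleton] at hz; rcases hz with rfl | rfl; exacts [sE hx, sF hy])
      (by intro z hz; simp only [mem_insert, mem_singleton] at hz; rcases hz with rfl | rfl; exacts [sE hx', sF hy'])
      (by
        refine hCD.mono ?_ ?_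
        · rw [hCe]; exact subset_insert _ _
        · rw [hDe]; exact subset_insert _ _)
      (fun k hk => ⟨(tg_un hTQ k hk).1, (tg_un hTQ k hk).2, hcut hb hCe hk (hs.meetQ C hC k hk),
        hcut hb' hDe hk (hs.meetQ D hD k hk)⟩)
    rw [card_pair hxy, card_pair hxy'] at hm2
    have h43 : (2 + 2).choose 3 = 4 := by decide
    rw [h43] at hm2
    by_cases hq : Q.card ≤ 2
    · have h27 := b2_count (R := H \ ({B} ∪ Q)) (S := E ×ˢ F) cB (by
        intro e he
        obtain ⟨b, hb, x, hx, y, hy, h⟩ := hRf e he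
        exact ⟨b, hb, (x, y), mem_product.2 ⟨hx, hy⟩, h⟩)
      rw [card_product, cE, cF] at h27
      omega
    · obtain ⟨G, hG, hGn⟩ : ∃ G ∈ Q, G ∉ ({E, F} : Finset (Finset ℕ)) := by
        by_contra hh
        push Not at hh
        have := card_le_card (show Q ⊆ {E, F} from fun k hk => hh k hk)
        have := card_le_two (a := E) (b := F)
        omega
      simp only [mem_insert, mem_singleton, not_or] at hGn
      have h7 := b2_pairs hEF cE cF (hTQ G hG).2 hGn.1 hGn.2
      have h21 := b2_count (R := H \ ({B} ∪ Q)) (S := E ×ˢ F \ (E \ G) ×ˢ (F \ G)) cB (by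
        intro e he
        obtain ⟨b, hb, x, hx, y, hy, h⟩ := hRf e he
        refine ⟨b, hb, (x, y), ?_, h⟩
        have hn := hcut hb h hG (hs.meetQ e he G hG)
        rw [mem_sdiff, mem_product, mem_product, mem_sdiff, mem_sdiff]
        refine ⟨⟨hx, hy⟩, ?_⟩
        rintro ⟨⟨-, h1⟩, ⟨-, h2⟩⟩
        apply hn
        rw [disjoint_comm, disjoint_insert_left, disjoint_singleton_left]
        exact ⟨h1, h2⟩)
      omega

theorem G_main : ∀ (m : ℕ) (V : Finset ℕ) (H : Finset (Finset ℕ)), V.card = m → ThreeGraphOn V H → PF H →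
    H.card ≤ bb m := by
  intro m
  induction m using Nat.strong_induction_on with
  | _ m IH =>
  intro V H hV hT hp
  have ih : IHyp m := fun U K hU hK hpK => IH _ hU U K rfl hK hpK
  rcases Nat.lt_or_ge m 9 with h9 | h9
  · rcases Nat.lt_or_ge m 7 with h7 | h7
    · have := card_le_choose hT
      unfold bb
      rw [if_pos (by omega)]
      rwa [hV] at this
    · interval_cases m
      · exact m7' hV hT hp
      · exact m8 hV hT hp
  by_contra hcon
  have hna : ∀ {P Q : Finset (Finset ℕ)}, IsSplit H P Q → P.card = 1 ∨ Q.card = 1 := by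
    intro P Q hs
    by_contra hh
    have h1 := card_pos.2 hs.neP
    have h2 := card_pos.2 hs.neQ
    exact hcon (case_a hV h9 hT hp ih hs (fun _ => by omega))
  have hnb : ∀ {P Q : Finset (Finset ℕ)}, IsSplit H P Q → P.card = 1 → 
      ∃ B, P = {B} ∧ Itg Q := by
    intro P Q hs h1
    obtain ⟨B, rfl⟩ := card_eq_one.1 h1
    refine ⟨B, rfl, fun E hE F hF hEF => hcon (case_b2 hV h9 hT hp ih hs hE hF hEF)⟩
  have key : ∀ {P Q : Finset (Finset ℕ)} {A B : Finset ℕ}, IsSplit H P Q → P.card = 1 → A ∈ P ∪ Q → B ∈ P ∪ Q →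
      Disjoint A B → A ≠ B → (∀ e ∈ H, Disjoint e A → e = B) ∨ (∀ e ∈ H, Disjoint e B → e = A) := by
    intro P Q A B hs h1 hA hB hd hne
    obtain ⟨B', rfl, hI⟩ := hnb hs h1
    have mate : ∀ k ∈ Q, ∀ e ∈ H, Disjoint e k → e = B' := by
      intro k hk e he hek
      by_contra hn
      by_cases heQ : e ∈ Q
      · exact hI e heQ k hk hek
      · refine hs.meetQ e (mem_sdiff.2 ⟨he, ?_⟩) k hk hek
        rw [mem_union, mem_singleton]
        tauto
    rw [mem_union, mem_singleton] at hA hB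
    rcases hA with rfl | hA
    · rcases hB with rfl | hB
      · exact absurd rfl hne
      · exact Or.inr (mate B hB)
    · rcases hB with rfl | hB
      · exact Or.inl (mate A hA)
      · exact absurd hd (hI A hA B hB)
  have hS : StarH H := by
    intro A hA B hB hd
    have hne : A ≠ B := by
      rintro rfl
      rw [disjoint_self] at hd
      have := (hT A hA).2
      rw [hd] at this
      simp at this
    obtain ⟨P, Q, hs, h1, h2⟩ := split_exists hp hA hB hne hd
    rcases hna hs with h | h
    · exact key hs h h1 h2 hd hne
    · rw [union_comm] at h1 h2
      exact key hs.symm h h1 h2 hd hne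
  exact hcon (star_stage hV h9 hT hS)


def cc (u : ℕ) : ℕ := if u = 7 then 19 else bbc u

def tt (n : ℕ) : ℕ :=
  if n ≤ 9 then (n-3)*(n-4)*(n-5)/6 + 1 else if n ≤ 12 then (n-6)*(n-7)*(n-8)/6 + 20 else (n-4)*(n-5)/2+3

set_option synthInstance.maxHeartbeats 400000 in
lemma fin_small : ∀ n < 30, ∀ u < n, 3 ≤ u → 3 ≤ n - u → cc u + cc (n-u) ≤ tt n := by decide +kernel

lemma cc_le (u : ℕ) : cc u ≤ bb u := by
  rw [bb_eq]
  unfold cc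
  split_ifs with h
  · subst h; decide
  · rfl

lemma fin_all {n u w : ℕ} (hu : 3 ≤ u) (hw : 3 ≤ w) (h : u + w = n) : cc u + cc w ≤ tt n := by
  rcases Nat.lt_or_ge n 30 with h1 | h1
  · have := fin_small n h1 u (by omega) hu (by omega)
    rwa [show n - u = w by omega] at this
  · refine (Nat.add_le_add (cc_le u) (cc_le w)).trans ?_
    have ht : tt n = (n-4).choose 2 + 3 := by
      rw [Nat.choose_two_right]; unfold tt
      rw [if_neg (by omega), if_neg (by omega)]
      rfl
    rw [ht]
    have b3 : bb 3 = 1 := by decide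
    rcases Nat.lt_or_ge u 4 with hu4 | hu4
    · have : u = 3 := by omega
      subst this
      rw [b3, bb10 (by omega), show w - 1 = n - 4 by omega]
      omega
    rcases Nat.lt_or_ge w 4 with hw4 | hw4
    · have : w = 3 := by omega
      subst this
      rw [b3, bb10 (by omega), show u - 1 = n - 4 by omega]
    have h4 := bbc_up hu
    have h5 := bbc_up hw
    rw [← bb_eq] at h4 h5
    have h6 := conv (k := 2) hu4 hw4 h.le
    obtain ⟨k, rfl⟩ : ∃ k, n = k + 30 := ⟨n - 30, by omega⟩
    have := ch2 (k + 25)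
    simp only [show k + 30 - 2 = k + 28 by omega, show k + 30 - 4 = k + 26 by omega,
        show k + 28 - 3 = k + 25 by omega, show k + 28 - 4 = k + 24 by omega] at h6 ⊢
    rw [show k + 25 + 1 = k + 26 by omega] at this
    nlinarith

lemma part_bound {U : Finset ℕ} {K : Finset (Finset ℕ)} (hT : ThreeGraphOn U K) (hp : PF K)
    (hmin : ∀ v ∈ U, ∃ e ∈ K, v ∈ e) : K.card ≤ cc U.card := by
  unfold cc
  split_ifs with h
  · exact m7 h hT hp hmin
  · rw [← bb_eq]; exact G_main _ U K rfl hT hp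

lemma disc_bound {V : Finset ℕ} {H : Finset (Finset ℕ)} 
    (hH : ThreeGraphOn V H) (hfree : P4Free H)
    (hdisc : ¬ConnectedHG V H) (hmin : ∀ v ∈ V, ∃ e ∈ H, v ∈ e) : H.card ≤ tt V.card := by
  unfold ConnectedHG at hdisc
  push Not at hdisc
  obtain ⟨U, W, hUW, hd, hU, hW, hno⟩ := hdisc
  have hp := hfree.pf
  have hside : ∀ e ∈ H, e ⊆ U ∨ e ⊆ W := by
    intro e he
    have heV := (hH e he).1
    by_cases h : (e ∩ U).Nonempty
    · left
      have h2 := hno e he h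
      intro z hz
      have := heV hz
      rw [← hUW, mem_union] at this
      rcases this with h3 | h3
      · exact h3
      · exfalso
        have : z ∈ e ∩ W := mem_inter.2 ⟨hz, h3⟩
        rw [h2] at this
        simp at this
    · right
      rw [not_nonempty_iff_eq_empty] at h
      intro z hz
      have := heV hz
      rw [← hUW, mem_union] at this
      rcases this with h3 | h3
      · exfalso
        have : z ∈ e ∩ U := mem_inter.2 ⟨hz, h3⟩
        rw [h] at this
        simp at this
      · exact h3
  have gen : ∀ U W : Finset ℕ, U ⊆ V → Disjoint U W → U.Nonempty → (∀ e ∈ H, e ⊆ U ∨ e ⊆ W) →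
      (H.filter (· ⊆ U)).card ≤ cc U.card ∧ 3 ≤ U.card := by
    intro U W hUV hd hU hside
    have hm : ∀ v ∈ U, ∃ e ∈ H.filter (· ⊆ U), v ∈ e := by
      intro v hv
      obtain ⟨e, he, hve⟩ := hmin v (hUV hv)
      rcases hside e he with h | h
      · exact ⟨e, mem_filter.2 ⟨he, h⟩, hve⟩
      · exact absurd (h hve) (disjoint_left.1 hd hv)
    refine ⟨part_bound (fun e he => ⟨(mem_filter.1 he).2, (hH e (mem_filter.1 he).1).2⟩)
      (hp.mono (filter_subset _ _)) hm, ?_⟩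
    obtain ⟨v, hv⟩ := hU
    obtain ⟨e, he, -⟩ := hm v hv
    rw [mem_filter] at he
    rw [← (hH e he.1).2]
    exact card_le_card he.2
  obtain ⟨a1, a2⟩ := gen U W (hUW ▸ subset_union_left) hd hU hside
  obtain ⟨b1, b2⟩ := gen W U (hUW ▸ subset_union_right) hd.symm hW (fun e he => (hside e he).symm)
  have hc : U.card + W.card = V.card := by rw [← hUW, card_union_of_disjoint hd]
  have hle : H.card ≤ (H.filter (· ⊆ U)).card + (H.filter (· ⊆ W)).card := by
    refine le_trans (card_le_card ?_) (card_union_le _ _)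
    intro e he
    rw [mem_union, mem_filter, mem_filter]
    rcases hside e he with h | h
    · exact Or.inl ⟨he, h⟩
    · exact Or.inr ⟨he, h⟩
  have := fin_all a2 b2 hc
  omega

theorem lemma_disconnected (n : ℕ)
    (V : Finset ℕ) (H : Finset (Finset ℕ)) (hV : V.card = n)
    (hH : ThreeGraphOn V H) (hfree : P4Free H)
    (hdisc : ¬ConnectedHG V H) (hmin : ∀ v ∈ V, ∃ e ∈ H, v ∈ e) :
    (6 ≤ n → n ≤ 9 → H.card ≤ (n - 3).choose 3 + 1) ∧
    (10 ≤ n → n ≤ 12 → H.card ≤ (n - 6).choose 3 + 20) ∧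
    (13 ≤ n → H.card ≤ (n - 4).choose 2 + 3) := by
  have h := disc_bound hH hfree hdisc hmin
  rw [hV] at h
  refine ⟨fun h1 h2 => ?_, fun h1 h2 => ?_, fun h1 => ?_⟩
  · refine h.trans ?_
    clear h hV
    interval_cases n <;> decide
  · refine h.trans ?_
    clear h hV
    interval_cases n <;> decide
  · rw [Nat.choose_two_right]
    unfold tt at h
    rw [if_neg (by omega), if_neg (by omega)] at h
    exact h
end

section
/- Let R and B be graphs on the same 5-element vertex set V = {v,a,b,x,y} such that R ∪ B contains no rr-bb-path. Then |R| + |B| ≤ 13. Moreover, if |R| + |B| ≥ 12 and |R| ≥ |B|, then up to isomorphism (i.e., after a suitable relabeling of the five vertices) one of the following holds: (A) R ⊆ K₅ − {ab} and B ⊆ T ∪ {ab}, where T is the triangle on {v,x,y}; (B) R = K₅ and B = {ab, xy}; (C) R = B = K₄, the complete graph on {a,b,x,y}; (D) R = S₅ ∪ {ab, xy} and B = S₅ ∪ {ax, by}, where S₅ = {va, vb, vx, vy} is the 4-edge star centered at v. -/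
open Finset

/-- `G` is a (simple, 2-uniform) graph on the vertex set `V`: every edge is a
2-element subset of `V`. -/
def GraphOn (V : Finset ℕ) (G : Finset (Finset ℕ)) : Prop :=
  ∀ e ∈ G, e ⊆ V ∧ e.card = 2

/-- `R ∪ B` contains an rr-bb-path: a 4-edge path `v₁v₂v₃v₄v₅` whose first
two edges are in `R` and last two edges are in `B`. -/
def HasRRBB (R B : Finset (Finset ℕ)) : Prop :=
  ∃ v₁ v₂ v₃ v₄ v₅ : ℕ, ({v₁, v₂, v₃, v₄, v₅} : Finset ℕ).card = 5 ∧
    ({v₁, v₂} : Finset ℕ) ∈ R ∧ ({v₂, v₃} : Finset ℕ) ∈ R ∧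
    ({v₃, v₄} : Finset ℕ) ∈ B ∧ ({v₄, v₅} : Finset ℕ) ∈ B

namespace LF

def eid (i j : ℕ) : ℕ :=
  bif Nat.blt i j then j * (j - 1) / 2 + i else i * (i - 1) / 2 + j

def ends : List (ℕ × ℕ) :=
  [(0,1),(0,2),(1,2),(0,3),(1,3),(2,3),(0,4),(1,4),(2,4),(3,4)]

def E (k : ℕ) : ℕ × ℕ := ends.getD k (0, 0)

def tabl : List (List (ℕ × ℕ × ℕ × ℕ × ℕ)) :=
  [[],
   [(1, 0, 2, 3, 4)],
   [(0, 1, 2, 3, 4), (0, 2, 1, 3, 4)],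
   [(1, 0, 3, 2, 4), (2, 0, 3, 1, 4)],
   [(0, 1, 3, 2, 4), (2, 1, 3, 0, 4), (0, 3, 1, 2, 4)],
   [(0, 2, 3, 1, 4), (1, 2, 3, 0, 4), (0, 3, 2, 1, 4), (1, 3, 2, 0, 4)],
   [(1, 0, 4, 2, 3), (2, 0, 4, 1, 3), (3, 0, 4, 1, 2)],
   [(0, 1, 4, 2, 3), (2, 1, 4, 0, 3), (3, 1, 4, 0, 2), (0, 4, 1, 2, 3)],
   [(0, 2, 4, 1, 3), (1, 2, 4, 0, 3), (3, 2, 4, 0, 1), (0, 4, 2, 1, 3), (1, 4, 2, 0, 3)],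
   [(0, 3, 4, 1, 2), (1, 3, 4, 0, 2), (2, 3, 4, 0, 1), (0, 4, 3, 1, 2), (1, 4, 3, 0, 2), (2, 4, 3, 0, 1)]]

def has (R i j : ℕ) : Bool := R.testBit (eid i j)

def bad (R : ℕ) (q : ℕ × ℕ × ℕ × ℕ × ℕ) : Bool :=
  match q with
  | (u, _, t, s, z) =>
    has R s z && (has R s u || (has R z u || (has R s t || has R z t)))

def confl (R : ℕ) : List (ℕ × ℕ × ℕ × ℕ × ℕ) → ℕ
  | [] => 0
  | q :: l => bif bad R q then 2 ^ (eid q.1 q.2.1) ||| confl R l else confl R l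

def mask : List ℕ → ℕ
  | [] => 0
  | k :: l => 2 ^ k ||| mask l

def cfg (R B v a b x y : ℕ) : Bool :=
  (!(has R a b) && Nat.beq (B ||| mask [eid v x, eid v y, eid x y, eid a b])
      (mask [eid v x, eid v y, eid x y, eid a b])) ||
  ((Nat.beq R 1023 && Nat.beq B (mask [eid a b, eid x y])) ||
  ((Nat.beq R (mask [eid a b, eid a x, eid a y, eid b x, eid b y, eid x y]) && Nat.beq B R) ||
   (Nat.beq R (mask [eid v a, eid v b, eid v x, eid v y, eid a b, eid x y]) &&
    Nat.beq B (mask [eid v a, eid v b, eid v x, eid v y, eid a x, eid b y]))))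

def vs : List ℕ := [0, 1, 2, 3, 4]

def ne (a b : ℕ) : Bool := !(Nat.beq a b)

def anyCfg (R B : ℕ) : Bool :=
  vs.any fun a => vs.any fun b => ne a b && vs.any fun v => (ne v a && ne v b) &&
  vs.any fun x => (ne x a && (ne x b && ne x v)) &&
  vs.any fun y => (ne y a && (ne y b && (ne y v && ne y x))) && cfg R B v a b x y

def leaf (R rc B bc : ℕ) : Bool :=
  Nat.ble (rc + bc) 11 || (Nat.blt rc bc || (Nat.ble (rc + bc) 13 && anyCfg R B))

def go (R rc : ℕ) : List (List (ℕ × ℕ × ℕ × ℕ × ℕ)) → ℕ → ℕ → ℕ → Bool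
  | [], _, B, bc => leaf R rc B bc
  | t :: l, k, B, bc =>
    Nat.ble (rc + (bc + (l.length + 1))) 11 ||
      ((go R rc l (k + 1) B bc) &&
        (!(Nat.beq (B &&& confl R t) 0) || go R rc l (k + 1) (B ||| 2 ^ k) (bc + 1)))

def goR : ℕ → ℕ → ℕ → ℕ → Bool
  | 0, _, R, rc => Nat.ble rc 5 || go R rc tabl 0 0 0
  | n + 1, k, R, rc => goR n (k + 1) R rc && goR n (k + 1) (R ||| 2 ^ k) (rc + 1)

theorem core : goR 10 0 0 0 = true := by decide +kernel

def enc (f : ℕ → Bool) : ℕ → ℕ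
  | 0 => 0
  | n + 1 => bif f n then enc f n ||| 2 ^ n else enc f n

def cnt (f : ℕ → Bool) : ℕ → ℕ
  | 0 => 0
  | n + 1 => bif f n then cnt f n + 1 else cnt f n

theorem testBit_enc (f : ℕ → Bool) (n k : ℕ) :
    (enc f n).testBit k = true ↔ k < n ∧ f k = true := by
  induction n with
  | zero => simp [enc]
  | succ n ih =>
    rw [enc]
    cases h : f n
    · simp only [cond_false, ih]
      constructor
      · rintro ⟨h1, h2⟩; exact ⟨by omega, h2⟩
      · rintro ⟨h1, h2⟩
        refine ⟨?_, h2⟩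
        rcases Nat.lt_succ_iff_lt_or_eq.1 h1 with h3 | h3
        · exact h3
        · subst h3; simp [h] at h2
    · simp only [cond_true, Nat.testBit_or, Bool.or_eq_true, ih, Nat.testBit_two_pow,
        decide_eq_true_eq]
      constructor
      · rintro (⟨h1, h2⟩ | h1)
        · exact ⟨by omega, h2⟩
        · subst h1; exact ⟨by omega, h⟩
      · rintro ⟨h1, h2⟩
        rcases Nat.lt_succ_iff_lt_or_eq.1 h1 with h3 | h3
        · exact Or.inl ⟨h3, h2⟩
        · exact Or.inr h3.symm

theorem testBit_mask (l : List ℕ) (k : ℕ) : (mask l).testBit k = true ↔ k ∈ l := by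
  induction l with
  | nil => simp [mask]
  | cons a l ih =>
    simp only [mask, Nat.testBit_or, Bool.or_eq_true, ih, Nat.testBit_two_pow,
        decide_eq_true_eq, List.mem_cons]
    constructor <;> rintro (h | h) <;> simp [h]

theorem testBit_confl (R : ℕ) (l : List (ℕ × ℕ × ℕ × ℕ × ℕ)) (k : ℕ)
    (h : (confl R l).testBit k = true) : ∃ q ∈ l, bad R q = true ∧ k = eid q.1 q.2.1 := by
  induction l with
  | nil => simp [confl] at h
  | cons a l ih =>
    rw [confl] at h
    cases hb : bad R a
    · simp only [hb, cond_false] at h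
      obtain ⟨q, h1, h2⟩ := ih h
      exact ⟨q, by simp [h1], h2⟩
    · simp only [hb, cond_true, Nat.testBit_or, Bool.or_eq_true, Nat.testBit_two_pow,
        decide_eq_true_eq] at h
      rcases h with h | h
      · exact ⟨a, by simp, hb, h.symm⟩
      · obtain ⟨q, h1, h2⟩ := ih h
        exact ⟨q, by simp [h1], h2⟩

theorem cnt_le (f : ℕ → Bool) (k n : ℕ) : cnt f (k + n) ≤ cnt f k + n := by
  induction n with
  | zero => simp
  | succ n ih =>
    rw [← add_assoc, cnt]
    cases f (k + n) <;> simp <;> omega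

theorem goR_sound (f : ℕ → Bool) (n : ℕ) : ∀ k, goR n k (enc f k) (cnt f k) = true →
    (Nat.ble (cnt f (k + n)) 5 || go (enc f (k + n)) (cnt f (k + n)) tabl 0 0 0) = true := by
  induction n with
  | zero => intro k h; exact h
  | succ n ih =>
    intro k h
    rw [goR, Bool.and_eq_true] at h
    have := ih (k + 1)
    rw [enc, cnt, show k + 1 + n = k + (n + 1) by omega] at this
    apply this
    cases f k
    · exact h.1
    · exact h.2

theorem go_sound (R rc : ℕ) (f : ℕ → Bool) (l : List (List (ℕ × ℕ × ℕ × ℕ × ℕ))) :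
    ∀ k, (∀ i (hi : i < l.length), f (k + i) = true →
        enc f (k + i) &&& confl R (l[i]) = 0) →
      go R rc l k (enc f k) (cnt f k) = true →
      leaf R rc (enc f (k + l.length)) (cnt f (k + l.length)) = true := by
  induction l with
  | nil => intro k _ h; exact h
  | cons t l ih =>
    intro k hc h
    rw [go, Bool.or_eq_true] at h
    rcases h with h | h
    · have h1 := Nat.le_of_ble_eq_true h
      have h2 := cnt_le f k (l.length + 1)
      rw [leaf, Bool.or_eq_true]
      left
      apply Nat.ble_eq_true_of_le
      simp only [List.length_cons]
      omega
    · rw [Bool.and_eq_true] at h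
      have := ih (k + 1)
      rw [enc, cnt, show k + 1 + l.length = k + (t :: l).length by simp; omega] at this
      apply this
      · intro i hi hf
        have := hc (i + 1) (by simp; omega)
        rw [show k + (i + 1) = k + 1 + i by omega] at this
        exact this hf
      · cases hf : f k
        · exact h.1
        · have h0 := hc 0 (by simp) hf
          have h2 := h.2
          simp only [add_zero, List.getElem_cons_zero] at h0
          rw [h0] at h2
          simpa using h2

theorem tabl_ok : ∀ k < 10, ∀ q ∈ tabl.getD k [],
    (q.1 < 5 ∧ q.2.1 < 5 ∧ q.2.2.1 < 5 ∧ q.2.2.2.1 < 5 ∧ q.2.2.2.2 < 5) ∧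
    [q.1, q.2.1, q.2.2.1, q.2.2.2.1, q.2.2.2.2].Nodup ∧ k = eid q.2.1 q.2.2.1 := by
  decide +kernel

theorem E_eid : ∀ i < 5, ∀ j < 5, i ≠ j → eid i j < 10 ∧
    (E (eid i j) = (i, j) ∨ E (eid i j) = (j, i)) := by
  decide +kernel

theorem E_lt : ∀ k < 10, (E k).1 < 5 ∧ (E k).2 < 5 ∧ (E k).1 ≠ (E k).2 := by decide +kernel

theorem E_inj : ∀ k < 10, ∀ l < 10, (E k = E l ∨ (E k).1 = (E l).2 ∧ (E k).2 = (E l).1) →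
    k = l := by decide +kernel

def edge (p : ℕ → ℕ) (k : ℕ) : Finset ℕ := {p (E k).1, p (E k).2}

def Inj (p : ℕ → ℕ) : Prop := ∀ i < 5, ∀ j < 5, p i = p j → i = j

theorem edge_eid (p : ℕ → ℕ) {i j : ℕ} (hi : i < 5) (hj : j < 5) (h : i ≠ j) :
    edge p (eid i j) = {p i, p j} := by
  rcases (E_eid i hi j hj h).2 with h | h <;> simp [edge, h, Finset.pair_comm]

theorem edge_inj {p : ℕ → ℕ} (hp : Inj p) {k l : ℕ} (hk : k < 10) (hl : l < 10)
    (h : edge p k = edge p l) : k = l := by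
  apply E_inj k hk l hl
  obtain ⟨a1, a2, a3⟩ := E_lt k hk
  obtain ⟨b1, b2, b3⟩ := E_lt l hl
  unfold edge at h
  have c1 : p (E k).1 ∈ ({p (E l).1, p (E l).2} : Finset ℕ) := by rw [← h]; simp
  have c2 : p (E k).2 ∈ ({p (E l).1, p (E l).2} : Finset ℕ) := by rw [← h]; simp
  simp only [Finset.mem_insert, Finset.mem_singleton] at c1 c2
  rcases c1 with c1 | c1 <;> rcases c2 with c2 | c2
  · exact absurd ((hp _ a1 _ b1 c1).trans (hp _ a2 _ b1 c2).symm) a3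
  · exact Or.inl (Prod.ext (hp _ a1 _ b1 c1) (hp _ a2 _ b2 c2))
  · exact Or.inr ⟨hp _ a1 _ b2 c1, hp _ a2 _ b1 c2⟩
  · exact absurd ((hp _ a1 _ b2 c1).trans (hp _ a2 _ b2 c2).symm) a3

/-- indicator of the edges of a graph -/
def ind (p : ℕ → ℕ) (R : Finset (Finset ℕ)) (k : ℕ) : Bool := decide (edge p k ∈ R)

theorem graph_edge {p : ℕ → ℕ} {V : Finset ℕ} (hV : V = (Finset.range 5).image p) {e : Finset ℕ}
    (h1 : e ⊆ V) (h2 : e.card = 2) : ∃ k < 10, e = edge p k := by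
  obtain ⟨s, t, hst, rfl⟩ := Finset.card_eq_two.1 h2
  have hs : s ∈ V := h1 (by simp)
  have ht : t ∈ V := h1 (by simp)
  rw [hV] at hs ht
  simp only [Finset.mem_image, Finset.mem_range] at hs ht
  obtain ⟨i, hi, rfl⟩ := hs
  obtain ⟨j, hj, rfl⟩ := ht
  have hij : i ≠ j := by rintro rfl; exact hst rfl
  exact ⟨eid i j, (E_eid i hi j hj hij).1, (edge_eid p hi hj hij).symm⟩

theorem cnt_eq (f : ℕ → Bool) (n : ℕ) :
    cnt f n = ((Finset.range n).filter (fun k => f k = true)).card := by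
  induction n with
  | zero => simp [cnt]
  | succ n ih =>
    rw [cnt, Finset.range_add_one, Finset.filter_insert]
    cases h : f n <;> simp [ih]

theorem card_graph {p : ℕ → ℕ} (hp : Inj p) {V : Finset ℕ} (hV : V = (Finset.range 5).image p)
    {R : Finset (Finset ℕ)} (hR : GraphOn V R) : R.card = cnt (ind p R) 10 := by
  rw [cnt_eq]
  symm
  have : R = ((Finset.range 10).filter (fun k => ind p R k = true)).image (edge p) := by
    ext e
    simp only [Finset.mem_image, Finset.mem_filter, Finset.mem_range, ind, decide_eq_true_eq]
    constructor
    · intro he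
      obtain ⟨k, hk, rfl⟩ := graph_edge hV (hR e he).1 (hR e he).2
      exact ⟨k, ⟨hk, he⟩, rfl⟩
    · rintro ⟨k, ⟨_, h⟩, rfl⟩; exact h
  conv_rhs => rw [this]
  rw [Finset.card_image_of_injOn]
  intro k hk l hl h
  simp only [Finset.coe_filter, Finset.mem_range, Set.mem_ofPred_eq] at hk hl
  exact edge_inj hp hk.1 hl.1 h

theorem sub_mask {p : ℕ → ℕ} {V : Finset ℕ} (hV : V = (Finset.range 5).image p)
    {R : Finset (Finset ℕ)} (hR : GraphOn V R) (l : List ℕ)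
    (h : enc (ind p R) 10 ||| mask l = mask l) : ∀ e ∈ R, ∃ k ∈ l, e = edge p k := by
  intro e he
  obtain ⟨k, hk, rfl⟩ := graph_edge hV (hR e he).1 (hR e he).2
  refine ⟨k, ?_, rfl⟩
  rw [← testBit_mask, ← h, Nat.testBit_or, Bool.or_eq_true]
  left
  rw [testBit_enc]
  exact ⟨hk, by simp [ind, he]⟩

theorem eq_mask {p : ℕ → ℕ} {V : Finset ℕ} (hV : V = (Finset.range 5).image p)
    {R : Finset (Finset ℕ)} (hR : GraphOn V R) (l : List ℕ)
    (h : enc (ind p R) 10 = mask l) : R = l.toFinset.image (edge p) := by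
  ext e
  simp only [Finset.mem_image, List.mem_toFinset]
  constructor
  · intro he
    obtain ⟨k, hk, h⟩ := sub_mask hV hR l (by rw [h, Nat.or_self]) e he
    exact ⟨k, hk, h.symm⟩
  · rintro ⟨k, hk, rfl⟩
    rw [← testBit_mask, ← h, testBit_enc] at hk
    simpa [ind] using hk.2

theorem ps4 {a b x y : ℕ} (h1 : a ≠ b) (h2 : a ≠ x) (h3 : a ≠ y) (h4 : b ≠ x) (h5 : b ≠ y)
    (h6 : x ≠ y) : ({a, b, x, y} : Finset ℕ).powersetCard 2 =
      {{a, b}, {a, x}, {a, y}, {b, x}, {b, y}, {x, y}} := by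
  ext e
  simp only [Finset.mem_powersetCard, Finset.mem_insert, Finset.mem_singleton]
  constructor
  · rintro ⟨hs, hc⟩
    obtain ⟨s, t, hst, rfl⟩ := Finset.card_eq_two.1 hc
    have hs' : s ∈ ({a, b, x, y} : Finset ℕ) := hs (by simp)
    have ht' : t ∈ ({a, b, x, y} : Finset ℕ) := hs (by simp)
    simp only [Finset.mem_insert, Finset.mem_singleton] at hs' ht'
    rcases hs' with rfl | rfl | rfl | rfl <;> rcases ht' with rfl | rfl | rfl | rfl <;>
      first
      | exact absurd rfl hst
      | simp
      | (rw [Finset.pair_comm]; simp)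
  · rintro (rfl | rfl | rfl | rfl | rfl | rfl) <;>
      refine ⟨by intro z; simp; tauto, Finset.card_pair ?_⟩ <;> assumption

theorem has_iff (p : ℕ → ℕ) (R : Finset (Finset ℕ)) {i j : ℕ} (hi : i < 5) (hj : j < 5)
    (h : i ≠ j) : has (enc (ind p R) 10) i j = true ↔ {p i, p j} ∈ R := by
  rw [has, testBit_enc, ind, edge_eid p hi hj h, decide_eq_true_eq]
  exact ⟨fun h => h.2, fun h' => ⟨(E_eid i hi j hj h).1, h'⟩⟩

theorem card5 {p : ℕ → ℕ} (hp : Inj p) {v a b x y : ℕ} (hv : v < 5) (ha : a < 5) (hb : b < 5)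
    (hx : x < 5) (hy : y < 5) (h : [v, a, b, x, y].Nodup) :
    ({p v, p a, p b, p x, p y} : Finset ℕ).card = 5 := by
  have : ({p v, p a, p b, p x, p y} : Finset ℕ) = ([v, a, b, x, y].map p).toFinset := by
    simp
  rw [this, List.toFinset_card_of_nodup]
  · simp
  · apply List.Nodup.map_on _ h
    have hh : ∀ z ∈ [v, a, b, x, y], z < 5 := by simp [*]
    intro s hs t ht h
    exact hp s (hh s hs) t (hh t ht) h

theorem mainp {p : ℕ → ℕ} (hp : Inj p) (V : Finset ℕ) (hV : V = (Finset.range 5).image p)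
    (R B : Finset (Finset ℕ))
    (hR : GraphOn V R) (hB : GraphOn V B) (hP : ¬HasRRBB R B) :
    leaf (enc (ind p R) 10) R.card (enc (ind p B) 10) B.card = true := by
  have h1 := goR_sound (ind p R) 10 0 core
  rw [Nat.zero_add] at h1
  rw [card_graph hp hV hR, card_graph hp hV hB]
  rw [Bool.or_eq_true] at h1
  rcases h1 with h1 | h1
  · have h2 := Nat.le_of_ble_eq_true h1
    rw [leaf, Bool.or_eq_true, Bool.or_eq_true]
    by_cases h3 : cnt (ind p B) 10 ≤ cnt (ind p R) 10
    · left
      apply Nat.ble_eq_true_of_le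
      omega
    · right; left
      apply Nat.ble_eq_true_of_le
      omega
  · refine go_sound (enc (ind p R) 10) (cnt (ind p R) 10) (ind p B) tabl 0 ?_ h1
    intro k hk hf
    rw [Nat.zero_add] at hf ⊢
    have hk' : k < 10 := hk
    by_contra hne
    obtain ⟨j, hj⟩ := Nat.exists_testBit_of_ne_zero hne
    rw [Nat.testBit_and, Bool.and_eq_true] at hj
    obtain ⟨hj1, hj2⟩ := hj
    obtain ⟨⟨u, w, t, s, z⟩, hq, hbad, hjq⟩ := testBit_confl _ _ _ hj2
    have hq' : (u, w, t, s, z) ∈ tabl.getD k [] := by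
      rw [List.getD_eq_getElem _ _ hk]; exact hq
    obtain ⟨⟨hu, hw, ht, hs, hz⟩, hnd, hkq⟩ := tabl_ok k hk' _ hq'
    simp only at hjq hkq hu hw ht hs hz hnd
    have hB1 : ({p w, p t} : Finset ℕ) ∈ B := by
      have : w ≠ t := by rintro rfl; simp at hnd
      rw [hkq, ind, edge_eid p hw ht this] at hf
      simpa using hf
    have hB2 : ({p u, p w} : Finset ℕ) ∈ B := by
      have : u ≠ w := by rintro rfl; simp at hnd
      have hj3 := ((testBit_enc _ _ _).1 hj1).2
      rw [hjq, ind, edge_eid p hu hw this] at hj3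
      simpa using hj3
    have hsz : s ≠ z := by rintro rfl; simp at hnd
    have hsu : s ≠ u := by rintro rfl; simp at hnd
    have hzu : z ≠ u := by rintro rfl; simp at hnd
    have hst : s ≠ t := by rintro rfl; simp at hnd
    have hzt : z ≠ t := by rintro rfl; simp at hnd
    simp only [bad, Bool.and_eq_true, Bool.or_eq_true, has_iff p R hs hz hsz,
      has_iff p R hs hu hsu, has_iff p R hz hu hzu, has_iff p R hs ht hst,
      has_iff p R hz ht hzt] at hbad
    obtain ⟨hr1, hr2⟩ := hbad
    have hr1' := hr1
    rw [Finset.pair_comm] at hr1'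
    have hB1' := hB1
    rw [Finset.pair_comm] at hB1'
    have hB2' := hB2
    rw [Finset.pair_comm] at hB2'
    apply hP
    simp only [List.nodup_cons, List.mem_cons, List.not_mem_nil, not_or] at hnd
    rcases hr2 with h | h | h | h
    · exact ⟨p z, p s, p u, p w, p t, card5 hp hz hs hu hw ht (by simp; omega),
        hr1', h, hB2, hB1⟩
    · exact ⟨p s, p z, p u, p w, p t, card5 hp hs hz hu hw ht (by simp; omega),
        hr1, h, hB2, hB1⟩
    · exact ⟨p z, p s, p t, p w, p u, card5 hp hz hs ht hw hu (by simp; omega),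
        hr1', h, hB1', hB2'⟩
    · exact ⟨p s, p z, p t, p w, p u, card5 hp hs hz ht hw hu (by simp; omega),
        hr1, h, hB1', hB2'⟩

theorem exists_p (V : Finset ℕ) (hV : V.card = 5) :
    ∃ p : ℕ → ℕ, Inj p ∧ V = (Finset.range 5).image p := by
  let q := V.orderEmbOfFin hV
  refine ⟨fun i => if h : i < 5 then q ⟨i, h⟩ else 0, ?_, ?_⟩
  · intro i hi j hj h
    simp only [hi, hj, dif_pos] at h
    have := q.injective h
    simpa using this
  · ext e
    rw [← Finset.mem_coe, ← Finset.range_orderEmbOfFin V hV]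
    simp only [Set.mem_range, Finset.mem_image, Finset.mem_range]
    constructor
    · rintro ⟨i, rfl⟩
      exact ⟨i, i.2, by simp [q]⟩
    · rintro ⟨i, hi, rfl⟩
      exact ⟨⟨i, hi⟩, by simp [hi, q]⟩

theorem hasRRBB_swap {R B : Finset (Finset ℕ)} (h : HasRRBB R B) : HasRRBB B R := by
  obtain ⟨a, b, c, d, e, h0, h1, h2, h3, h4⟩ := h
  refine ⟨e, d, c, b, a, ?_, ?_, ?_, ?_, ?_⟩
  · rw [← h0]; congr 1; ext z; simp; tauto
  · rwa [Finset.pair_comm]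
  · rwa [Finset.pair_comm]
  · rwa [Finset.pair_comm]
  · rwa [Finset.pair_comm]

theorem vs_lt {a : ℕ} (h : a ∈ vs) : a < 5 := by
  simp [vs] at h; omega

theorem ne_iff (a b : ℕ) : ne a b = true ↔ a ≠ b := by
  rw [ne, Ne, ← Nat.beq_eq]; cases Nat.beq a b <;> decide

theorem le13 (V : Finset ℕ) (R B : Finset (Finset ℕ)) (hV : V.card = 5)
    (hR : GraphOn V R) (hB : GraphOn V B) (hP : ¬HasRRBB R B) (hle : B.card ≤ R.card) :
    R.card + B.card ≤ 13 := by
  obtain ⟨p, hp, hVp⟩ := exists_p V hV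
  have h := mainp hp V hVp R B hR hB hP
  rw [leaf, Bool.or_eq_true, Bool.or_eq_true, Bool.and_eq_true] at h
  rcases h with h | h | ⟨h, -⟩
  · have := Nat.le_of_ble_eq_true h; omega
  · have := Nat.le_of_ble_eq_true h; omega
  · exact Nat.le_of_ble_eq_true h

end LF

/-- Lemma 4.3: if `R, B` are graphs on the same 5-element vertex set with no
rr-bb-path, then `|R| + |B| ≤ 13`; moreover, if `|R| + |B| ≥ 12` and
`|R| ≥ |B|`, then after a suitable relabeling `V = {v, a, b, x, y}` one of the
configurations (A)–(D) holds. -/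
theorem lemma_five (V : Finset ℕ) (R B : Finset (Finset ℕ)) (hV : V.card = 5)
    (hR : GraphOn V R) (hB : GraphOn V B) (hP : ¬HasRRBB R B) :
    R.card + B.card ≤ 13 ∧
    (12 ≤ R.card + B.card → B.card ≤ R.card →
      ∃ v a b x y : ℕ, ({v, a, b, x, y} : Finset ℕ) = V ∧
        -- (A) R ⊆ K₅ - {ab}, B ⊆ T ∪ {ab} with T the triangle on {v,x,y}
        ((R ⊆ (V.powersetCard 2).erase {a, b} ∧
            B ⊆ ({{v, x}, {v, y}, {x, y}, {a, b}} : Finset (Finset ℕ))) ∨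
        -- (B) R = K₅, B = {ab, xy}
         (R = V.powersetCard 2 ∧
            B = ({{a, b}, {x, y}} : Finset (Finset ℕ))) ∨
        -- (C) R = B = K₄ on {a,b,x,y}
         (R = ({a, b, x, y} : Finset ℕ).powersetCard 2 ∧ B = R) ∨
        -- (D) R = S₅ ∪ {ab, xy}, B = S₅ ∪ {ax, by} with S₅ the star at v
         (R = ({{v, a}, {v, b}, {v, x}, {v, y}, {a, b}, {x, y}} :
                Finset (Finset ℕ)) ∧
            B = ({{v, a}, {v, b}, {v, x}, {v, y}, {a, x}, {b, y}} :
                Finset (Finset ℕ))))) := by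
  refine ⟨?_, ?_⟩
  · rcases le_total B.card R.card with h | h
    · exact LF.le13 V R B hV hR hB hP h
    · have := LF.le13 V B R hV hB hR (fun h => hP (LF.hasRRBB_swap h)) h
      omega
  intro h12 hle
  obtain ⟨p, hp, hVp⟩ := LF.exists_p V hV
  have h := LF.mainp hp V hVp R B hR hB hP
  rw [LF.leaf, Bool.or_eq_true, Bool.or_eq_true, Bool.and_eq_true] at h
  rcases h with h | h | ⟨-, h⟩
  · have := Nat.le_of_ble_eq_true h; omega
  · have := Nat.le_of_ble_eq_true h; omega
  simp only [LF.anyCfg, List.any_eq_true, Bool.and_eq_true, LF.ne_iff] at h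
  obtain ⟨a, ha, b, hb, hab, v, hv, ⟨hva, hvb⟩, x, hx, ⟨hxa, hxb, hxv⟩, y, hy,
    ⟨hya, hyb, hyv, hyx⟩, h⟩ := h
  replace ha := LF.vs_lt ha
  replace hb := LF.vs_lt hb
  replace hv := LF.vs_lt hv
  replace hx := LF.vs_lt hx
  replace hy := LF.vs_lt hy
  have nd : ∀ {i j : ℕ}, i < 5 → j < 5 → i ≠ j → p i ≠ p j :=
    fun hi hj h h' => h (hp _ hi _ hj h')
  have e1 := LF.edge_eid p hv ha hva
  have e2 := LF.edge_eid p hv hb hvb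
  have e3 := LF.edge_eid p hv hx hxv.symm
  have e4 := LF.edge_eid p hv hy hyv.symm
  have e5 := LF.edge_eid p ha hb hab
  have e6 := LF.edge_eid p ha hx hxa.symm
  have e7 := LF.edge_eid p ha hy hya.symm
  have e8 := LF.edge_eid p hb hx hxb.symm
  have e9 := LF.edge_eid p hb hy hyb.symm
  have e10 := LF.edge_eid p hx hy hyx.symm
  refine ⟨p v, p a, p b, p x, p y, ?_, ?_⟩
  · apply Finset.eq_of_subset_of_card_le
    · rw [hVp]
      intro z hz
      simp only [Finset.mem_insert, Finset.mem_singleton] at hz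
      simp only [Finset.mem_image, Finset.mem_range]
      rcases hz with rfl | rfl | rfl | rfl | rfl
      exacts [⟨v, hv, rfl⟩, ⟨a, ha, rfl⟩, ⟨b, hb, rfl⟩, ⟨x, hx, rfl⟩, ⟨y, hy, rfl⟩]
    · rw [hV, LF.card5 hp hv ha hb hx hy (by simp; omega)]
  simp only [LF.cfg, Bool.or_eq_true, Bool.and_eq_true, Nat.beq_eq] at h
  rcases h with ⟨h1, h2⟩ | ⟨h1, h2⟩ | ⟨h1, h2⟩ | ⟨h1, h2⟩
  · left
    constructor
    · intro e he
      rw [Finset.mem_erase, Finset.mem_powersetCard]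
      refine ⟨?_, hR e he⟩
      rintro rfl
      rw [← LF.has_iff p R ha hb hab] at he
      simp [he] at h1
    · intro e he
      obtain ⟨k, hk, rfl⟩ := LF.sub_mask hVp hB _ h2 e he
      simp only [List.mem_cons, List.not_mem_nil, or_false] at hk
      rcases hk with rfl | rfl | rfl | rfl
      · rw [e3]; simp
      · rw [e4]; simp
      · rw [e10]; simp
      · rw [e5]; simp
  · right; left
    constructor
    · ext e
      rw [Finset.mem_powersetCard]
      refine ⟨fun he => hR e he, ?_⟩
      rintro ⟨hs, hc⟩
      obtain ⟨k, hk, rfl⟩ := LF.graph_edge hVp hs hc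
      have : (LF.enc (LF.ind p R) 10).testBit k = true := by
        rw [h1]
        interval_cases k <;> decide
      rw [LF.testBit_enc] at this
      simpa [LF.ind] using this.2
    · rw [LF.eq_mask hVp hB _ h2]
      simp [Finset.image_insert, e5, e10]
  · right; right; left
    have hR6 := LF.eq_mask hVp hR _ h1
    simp only [List.toFinset_cons, List.toFinset_nil, Finset.image_insert, insert_empty_eq,
      Finset.image_singleton, e5, e6, e7, e8, e9, e10] at hR6
    have hB6 := LF.eq_mask hVp hB _ (h2.trans h1)
    simp only [List.toFinset_cons, List.toFinset_nil, Finset.image_insert, insert_empty_eq,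
      Finset.image_singleton, e5, e6, e7, e8, e9, e10] at hB6
    refine ⟨?_, hB6.trans hR6.symm⟩
    rw [LF.ps4 (nd ha hb hab) (nd ha hx hxa.symm) (nd ha hy hya.symm) (nd hb hx hxb.symm)
      (nd hb hy hyb.symm) (nd hx hy hyx.symm)]
    exact hR6
  · right; right; right
    have hR6 := LF.eq_mask hVp hR _ h1
    have hB6 := LF.eq_mask hVp hB _ h2
    simp only [List.toFinset_cons, List.toFinset_nil, Finset.image_insert, insert_empty_eq,
      Finset.image_singleton, e1, e2, e3, e4, e5, e6, e9, e10] at hR6 hB6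
    exact ⟨hR6, hB6⟩
end

section
/- Let R and B be graphs on the same 5-element vertex set such that R ∪ B contains no rr-bb-path. If the maximum degrees satisfy Δ(R) ≤ 3 and Δ(B) ≤ 3, and at least three vertices have degree at most 2 in R and at least three vertices have degree at most 2 in B, then |R| + |B| ≤ 10. -/
open Finset

/-- The degree of a vertex `v` in the graph `G`. -/
def degOf (G : Finset (Finset ℕ)) (v : ℕ) : ℕ :=
  (G.filter (fun e => v ∈ e)).card

namespace RRBB

def pp : Fin 10 → Fin 5 := ![0,0,0,0,1,1,1,2,2,3]
def qq : Fin 10 → Fin 5 := ![1,2,3,4,2,3,4,3,4,4]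
def idx (i j : Fin 5) : Fin 10 :=
  (![![0,0,1,2,3],![0,0,4,5,6],![1,4,0,7,8],![2,5,7,0,9],![3,6,8,9,0]] : Fin 5 → Fin 5 → Fin 10) i j

theorem idx_spec : ∀ i j : Fin 5, i ≠ j →
    (pp (idx i j) = i ∧ qq (idx i j) = j) ∨ (pp (idx i j) = j ∧ qq (idx i j) = i) := by decide

theorem pq_ne : ∀ i, pp i ≠ qq i := by decide

theorem pq_inj : ∀ i j, (pp i = pp j ∧ qq i = qq j) ∨ (pp i = qq j ∧ qq i = pp j) → i = j := by
  decide

def t (m i : ℕ) : ℕ := (m.testBit i).toNat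

def cnt (m : ℕ) : ℕ := t m 0 + t m 1 + t m 2 + t m 3 + t m 4 + t m 5 + t m 6 + t m 7 + t m 8 + t m 9
def d0 (m : ℕ) : ℕ := t m 0 + t m 1 + t m 2 + t m 3
def d1 (m : ℕ) : ℕ := t m 0 + t m 4 + t m 5 + t m 6
def d2 (m : ℕ) : ℕ := t m 1 + t m 4 + t m 7 + t m 8
def d3 (m : ℕ) : ℕ := t m 2 + t m 5 + t m 7 + t m 9
def d4 (m : ℕ) : ℕ := t m 3 + t m 6 + t m 8 + t m 9

def low (n : ℕ) : ℕ := (Nat.ble n 2).toNat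

def good (m : ℕ) : Bool :=
  Nat.ble 5 (cnt m) && Nat.ble (d0 m) 3 && Nat.ble (d1 m) 3 && Nat.ble (d2 m) 3 && Nat.ble (d3 m) 3
    && Nat.ble (d4 m) 3
    && Nat.ble 3 (low (d0 m) + low (d1 m) + low (d2 m) + low (d3 m) + low (d4 m))

def goods : List ℕ := (List.range 1024).filter good

def fives : List (Fin 5) := [0,1,2,3,4]

/-- all orderings of the five vertices -/
def paths : List (Fin 5 × Fin 5 × Fin 5 × Fin 5 × Fin 5) :=
  fives.flatMap fun a => (fives.filter (fun b => b != a)).flatMap fun b =>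
  (fives.filter (fun c => c != a && c != b)).flatMap fun c =>
  (fives.filter (fun d => d != a && d != b && d != c)).flatMap fun d =>
  (fives.filter (fun e => e != a && e != b && e != c && e != d)).map fun e => (a,b,c,d,e)

theorem paths_nodup : ∀ p ∈ paths, [p.1, p.2.1, p.2.2.1, p.2.2.2.1, p.2.2.2.2].Nodup := by
  intro p hp
  simp only [paths, List.mem_flatMap, List.mem_filter, List.mem_map, Bool.and_eq_true,
    bne_iff_ne] at hp
  obtain ⟨a, -, b, ⟨-, hb⟩, c, ⟨-, hc⟩, d, ⟨-, hd⟩, e, ⟨-, he⟩, rfl⟩ := hp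
  simp only [List.nodup_cons, List.mem_cons, List.not_mem_nil, or_false, not_or]
  grind

def msk (i j : Fin 10) : ℕ := 2 ^ (i : ℕ) ||| 2 ^ (j : ℕ)

theorem msk_spec : ∀ i j : Fin 10, (msk i j).testBit i = true ∧ (msk i j).testBit j = true := by
  decide +kernel

theorem testBit_of_msk (m : ℕ) (i j : Fin 10) (h : Nat.beq (m &&& msk i j) (msk i j) = true) :
    m.testBit i = true ∧ m.testBit j = true := by
  have h := Nat.eq_of_beq_eq_true h
  obtain ⟨h1, h2⟩ := msk_spec i j
  rw [← h, Nat.testBit_and, Bool.and_eq_true] at h1 h2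
  exact ⟨h1.1, h2.1⟩

/-- edge masks of all potential paths -/
def masks : List (ℕ × ℕ) :=
  [(17, 640), (17, 768), (33, 384), (33, 768), (65, 384), (65, 640), (18, 544), (18, 576), (130,
  96), (130, 576), (258, 96), (258, 544), (36, 272), (36, 320), (132, 80), (132, 320), (516,
  80), (516, 272), (72, 144), (72, 160), (264, 48), (264, 160), (520, 48), (520, 144), (3, 640),
  (3, 768), (5, 384), (5, 768), (9, 384), (9, 640), (18, 516), (18, 520), (144, 12), (144, 520),
  (272, 12), (272, 516), (36, 258), (36, 264), (160, 10), (160, 264), (544, 10), (544, 258),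
  (72, 130), (72, 132), (320, 6), (320, 132), (576, 6), (576, 130), (3, 544), (3, 576), (6, 96),
  (6, 576), (10, 96), (10, 544), (17, 516), (17, 520), (48, 12), (48, 520), (80, 12), (80, 516),
  (132, 65), (132, 72), (160, 9), (160, 72), (640, 9), (640, 65), (264, 33), (264, 36), (320,
  5), (320, 36), (768, 5), (768, 33), (5, 272), (5, 320), (6, 80), (6, 320), (12, 80), (12,
  272), (33, 258), (33, 264), (48, 10), (48, 264), (96, 10), (96, 258), (130, 65), (130, 72),
  (144, 9), (144, 72), (384, 9), (384, 65), (520, 17), (520, 18), (576, 3), (576, 18), (768, 3),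
  (768, 17), (9, 144), (9, 160), (10, 48), (10, 160), (12, 48), (12, 144), (65, 130), (65, 132),
  (80, 6), (80, 132), (96, 6), (96, 130), (258, 33), (258, 36), (272, 5), (272, 36), (384, 5),
  (384, 33), (516, 17), (516, 18), (544, 3), (544, 18), (640, 3), (640, 17)]

theorem masks_eq : paths.map (fun p => (msk (idx p.1 p.2.1) (idx p.2.1 p.2.2.1),
    msk (idx p.2.2.1 p.2.2.2.1) (idx p.2.2.2.1 p.2.2.2.2))) = masks := by
  decide +kernel

def six : List ℕ :=
  [126, 221, 222, 235, 238, 250, 252, 317, 318, 359, 366, 374, 380, 413, 427, 429, 441, 444,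
  455, 461, 469, 476, 483, 485, 486, 489, 490, 492, 571, 574, 599, 606, 630, 634, 667, 669, 683,
  697, 698, 711, 715, 723, 725, 726, 729, 730, 732, 739, 746, 791, 797, 807, 811, 819, 821, 822,
  825, 826, 828, 839, 853, 854, 867, 870, 917, 921, 931, 937, 963, 965]

def five : List ℕ :=
  [55, 59, 61, 62, 87, 91, 93, 94, 103, 107, 109, 110, 118, 122, 124, 151, 155, 157, 158, 167,
  171, 173, 174, 179, 181, 182, 185, 186, 188, 199, 203, 205, 206, 211, 213, 214, 217, 218, 220,
  227, 229, 230, 233, 234, 236, 242, 244, 248, 279, 283, 285, 286, 295, 299, 301, 302, 307, 309,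
  310, 313, 314, 316, 327, 331, 333, 334, 339, 341, 342, 345, 346, 348, 355, 357, 358, 361, 362,
  364, 370, 372, 376, 391, 395, 397, 398, 405, 409, 412, 419, 421, 422, 425, 426, 428, 433, 436,
  440, 451, 453, 454, 457, 458, 460, 465, 468, 472, 481, 482, 484, 488, 496, 535, 539, 541, 542,
  551, 555, 557, 558, 563, 565, 566, 569, 570, 572, 583, 587, 589, 590, 595, 597, 598, 601, 602,
  604, 611, 613, 614, 617, 618, 620, 626, 628, 632, 647, 651, 653, 654, 659, 661, 662, 665, 666,
  668, 675, 681, 682, 689, 690, 696, 707, 709, 710, 713, 714, 716, 721, 722, 724, 728, 737, 738,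
  744, 752, 775, 779, 781, 782, 787, 789, 790, 793, 794, 796, 803, 805, 806, 809, 810, 812, 817,
  818, 820, 824, 835, 837, 838, 849, 850, 852, 865, 866, 868, 880, 899, 901, 902, 905, 906, 908,
  913, 916, 920, 929, 930, 936, 944, 961, 962, 964, 976, 992]

theorem goods_six : goods.filter (fun m => Nat.ble 6 (cnt m)) = six := by decide +kernel
theorem goods_five : goods.filter (fun m => !Nat.ble 6 (cnt m)) = five := by decide +kernel

def sub (m x : ℕ) : Bool := Nat.beq (m &&& x) x

def bad (r b : ℕ) : Bool := masks.any fun q => sub r q.1 && sub b q.2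

theorem chk66 : (six.all fun r => six.all fun b => bad r b) = true := by decide +kernel
theorem chk65 : (six.all fun r => five.all fun b => bad r b) = true := by decide +kernel
theorem chk56 : (five.all fun r => six.all fun b => bad r b) = true := by decide +kernel

theorem core (r b : ℕ) (hr : r < 1024) (hb : b < 1024) (gr : good r = true) (gb : good b = true)
    (h : 6 ≤ cnt r ∨ 6 ≤ cnt b) : ∃ v₁ v₂ v₃ v₄ v₅ : Fin 5, [v₁, v₂, v₃, v₄, v₅].Nodup ∧
      r.testBit (idx v₁ v₂) = true ∧ r.testBit (idx v₂ v₃) = true ∧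
      b.testBit (idx v₃ v₄) = true ∧ b.testBit (idx v₄ v₅) = true := by
  have m6 : ∀ m < 1024, good m = true → 6 ≤ cnt m → m ∈ six := by
    intro m h1 h2 h3
    rw [← goods_six, List.mem_filter]
    exact ⟨by simp [goods, h1, h2], Nat.ble_eq_true_of_le h3⟩
  have m5 : ∀ m < 1024, good m = true → ¬ 6 ≤ cnt m → m ∈ five := by
    intro m h1 h2 h3
    rw [← goods_five, List.mem_filter]
    refine ⟨by simp [goods, h1, h2], ?_⟩
    rw [Bool.not_eq_true', ← Bool.not_eq_true, Nat.ble_eq]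
    exact h3
  have hbad : bad r b = true := by
    by_cases h6 : 6 ≤ cnt r
    · by_cases h7 : 6 ≤ cnt b
      · exact List.all_eq_true.1 (List.all_eq_true.1 chk66 r (m6 r hr gr h6)) b (m6 b hb gb h7)
      · exact List.all_eq_true.1 (List.all_eq_true.1 chk65 r (m6 r hr gr h6)) b (m5 b hb gb h7)
    · have h7 : 6 ≤ cnt b := h.resolve_left h6
      exact List.all_eq_true.1 (List.all_eq_true.1 chk56 r (m5 r hr gr h6)) b (m6 b hb gb h7)
  rw [bad, List.any_eq_true, ← masks_eq] at hbad
  obtain ⟨q, hq, hq2⟩ := hbad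
  obtain ⟨p, hp, rfl⟩ := List.mem_map.1 hq
  rw [Bool.and_eq_true] at hq2
  have a := testBit_of_msk r _ _ hq2.1
  have c := testBit_of_msk b _ _ hq2.2
  exact ⟨_, _, _, _, _, paths_nodup p hp, a.1, a.2, c.1, c.2⟩

def ed (f : Fin 5 → ℕ) (i : Fin 10) : Finset ℕ := {f (pp i), f (qq i)}

theorem ed_idx (f : Fin 5 → ℕ) (i j : Fin 5) (h : i ≠ j) : ed f (idx i j) = {f i, f j} := by
  unfold ed
  rcases idx_spec i j h with ⟨h1, h2⟩ | ⟨h1, h2⟩ <;> rw [h1, h2]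
  exact Finset.pair_comm _ _

theorem ed_inj (f : Fin 5 → ℕ) (hf : Function.Injective f) : Function.Injective (ed f) := by
  intro i j h
  apply pq_inj
  unfold ed at h
  have hi := hf.ne (pq_ne i)
  have a1 : f (pp i) ∈ ({f (pp j), f (qq j)} : Finset ℕ) := by rw [← h]; simp
  have a2 : f (qq i) ∈ ({f (pp j), f (qq j)} : Finset ℕ) := by rw [← h]; simp
  simp only [Finset.mem_insert, Finset.mem_singleton, hf.eq_iff] at a1 a2
  have := pq_ne i
  grind

theorem card_eq (f : Fin 5 → ℕ) (hf : Function.Injective f) (G : Finset (Finset ℕ))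
    (hG : GraphOn (univ.image f) G) (Q : Finset ℕ → Prop) [DecidablePred Q] (m : ℕ)
    (hm : ∀ i : Fin 10, m.testBit i = decide (ed f i ∈ G)) :
    (G.filter Q).card = ∑ i : Fin 10, if Q (ed f i) then t m i else 0 := by
  have h1 : G.filter Q = (univ.filter (fun i => ed f i ∈ G ∧ Q (ed f i))).image (ed f) := by
    ext e
    simp only [Finset.mem_filter, Finset.mem_image, Finset.mem_univ, true_and]
    constructor
    · rintro ⟨he, hq⟩
      obtain ⟨hs, hc⟩ := hG e he
      obtain ⟨x, y, hxy, rfl⟩ := Finset.card_eq_two.1 hc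
      have hx := hs (Finset.mem_insert_self x _)
      have hy : y ∈ univ.image f := hs (by simp)
      simp only [Finset.mem_image, Finset.mem_univ, true_and] at hx hy
      obtain ⟨i, rfl⟩ := hx
      obtain ⟨j, rfl⟩ := hy
      have hij : i ≠ j := fun h => hxy (by rw [h])
      refine ⟨idx i j, ?_, ed_idx f i j hij⟩
      rw [ed_idx f i j hij]
      exact ⟨he, hq⟩
    · rintro ⟨i, hi, rfl⟩
      exact hi
  rw [h1, Finset.card_image_of_injective _ (ed_inj f hf), Finset.card_filter]
  apply Finset.sum_congr rfl
  intro i _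
  unfold t
  rw [hm i]
  by_cases h1 : ed f i ∈ G <;> by_cases h2 : Q (ed f i) <;> simp [h1, h2]

theorem exists_mask (f : Fin 5 → ℕ) (hf : Function.Injective f) (G : Finset (Finset ℕ))
    (hG : GraphOn (univ.image f) G) : ∃ m < 1024,
      (∀ i : Fin 10, m.testBit i = decide (ed f i ∈ G)) ∧ G.card = cnt m ∧
      degOf G (f 0) = d0 m ∧ degOf G (f 1) = d1 m ∧ degOf G (f 2) = d2 m ∧
      degOf G (f 3) = d3 m ∧ degOf G (f 4) = d4 m := by
  have hm : ∀ i : Fin 10, (Nat.ofBits (fun i : Fin 10 => decide (ed f i ∈ G))).testBit i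
      = decide (ed f i ∈ G) := by
    intro i
    rw [Nat.testBit_ofBits_lt _ _ i.2]
  refine ⟨Nat.ofBits (fun i : Fin 10 => decide (ed f i ∈ G)), Nat.ofBits_lt_two_pow _, hm, ?_⟩
  generalize Nat.ofBits (fun i : Fin 10 => decide (ed f i ∈ G)) = m at hm
  have key := fun (v : Fin 5) => card_eq f hf G hG (fun e => f v ∈ e) m hm
  have key2 := card_eq f hf G hG (fun e => True) m hm
  simp only [ed, Finset.mem_insert, Finset.mem_singleton, hf.eq_iff] at key
  refine ⟨?_, ?_, ?_, ?_, ?_, ?_⟩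
  · simpa [Fin.sum_univ_succ, cnt, add_assoc] using key2
  · refine (key 0).trans ?_
    simp [Fin.sum_univ_succ, d0, add_assoc, pp, qq]
  · refine (key 1).trans ?_
    simp [Fin.sum_univ_succ, d1, add_assoc, pp, qq]
  · refine (key 2).trans ?_
    simp [Fin.sum_univ_succ, d2, add_assoc, pp, qq]
  · refine (key 3).trans ?_
    simp [Fin.sum_univ_succ, d3, add_assoc, pp, qq]
  · refine (key 4).trans ?_
    simp [Fin.sum_univ_succ, d4, add_assoc, pp, qq]

theorem low_eq (n : ℕ) : low n = if n ≤ 2 then 1 else 0 := by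
  unfold low
  by_cases h : n ≤ 2
  · simp [h]
  · have h2 : Nat.ble n 2 = false := by
      rw [← Bool.not_eq_true, Nat.ble_eq]; exact h
    rw [h2, if_neg h]; rfl

theorem card_low (f : Fin 5 → ℕ) (hf : Function.Injective f) (g : ℕ → ℕ) :
    ((univ.image f).filter (fun v => g v ≤ 2)).card =
      low (g (f 0)) + low (g (f 1)) + low (g (f 2)) + low (g (f 3)) + low (g (f 4)) := by
  rw [Finset.filter_image, Finset.card_image_of_injective _ hf, Finset.card_filter]
  simp only [low_eq, Fin.sum_univ_five]

end RRBB

open RRBB in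
theorem lemma_degree (V : Finset ℕ) (R B : Finset (Finset ℕ)) (hV : V.card = 5)
    (hR : GraphOn V R) (hB : GraphOn V B) (hP : ¬HasRRBB R B)
    (hdR : ∀ v ∈ V, degOf R v ≤ 3) (hdB : ∀ v ∈ V, degOf B v ≤ 3)
    (h3R : 3 ≤ (V.filter (fun v => degOf R v ≤ 2)).card)
    (h3B : 3 ≤ (V.filter (fun v => degOf B v ≤ 2)).card) :
    R.card + B.card ≤ 10 := by
  obtain ⟨f, hf, rfl⟩ : ∃ f : Fin 5 → ℕ, Function.Injective f ∧ univ.image f = V :=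
    ⟨V.orderEmbOfFin hV, (V.orderEmbOfFin hV).injective, by
      apply Finset.coe_injective
      simp⟩
  obtain ⟨r, hr, tr, cr, r0, r1, r2, r3, r4⟩ := exists_mask f hf R hR
  obtain ⟨b, hb, tb, cb, b0, b1, b2, b3, b4⟩ := exists_mask f hf B hB
  rw [card_low f hf, r0, r1, r2, r3, r4] at h3R
  rw [card_low f hf, b0, b1, b2, b3, b4] at h3B
  have mem : ∀ i, f i ∈ univ.image f := fun i => Finset.mem_image_of_mem f (Finset.mem_univ i)
  have R0 := hdR _ (mem 0)
  have R1 := hdR _ (mem 1)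
  have R2 := hdR _ (mem 2)
  have R3 := hdR _ (mem 3)
  have R4 := hdR _ (mem 4)
  have B0 := hdB _ (mem 0)
  have B1 := hdB _ (mem 1)
  have B2 := hdB _ (mem 2)
  have B3 := hdB _ (mem 3)
  have B4 := hdB _ (mem 4)
  rw [r0] at R0
  rw [r1] at R1
  rw [r2] at R2
  rw [r3] at R3
  rw [r4] at R4
  rw [b0] at B0
  rw [b1] at B1
  rw [b2] at B2
  rw [b3] at B3
  rw [b4] at B4
  rw [cr, cb]
  by_contra hc
  have bound : ∀ m, 3 ≤ low (d0 m) + low (d1 m) + low (d2 m) + low (d3 m) + low (d4 m) →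
      d0 m ≤ 3 → d1 m ≤ 3 → d2 m ≤ 3 → d3 m ≤ 3 → d4 m ≤ 3 → cnt m ≤ 6 := by
    intro m h h0 h1 h2 h3 h4
    have hs : d0 m + d1 m + d2 m + d3 m + d4 m = 2 * cnt m := by
      unfold d0 d1 d2 d3 d4 cnt
      ring
    have hl : ∀ n ≤ 3, n + low n ≤ 3 := by decide
    have := hl _ h0
    have := hl _ h1
    have := hl _ h2
    have := hl _ h3
    have := hl _ h4
    omega
  have br := bound r h3R R0 R1 R2 R3 R4
  have bb := bound b h3B B0 B1 B2 B3 B4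
  have gr : good r = true := by
    simp only [good, Bool.and_eq_true, Nat.ble_eq]
    exact ⟨⟨⟨⟨⟨⟨by omega, R0⟩, R1⟩, R2⟩, R3⟩, R4⟩, h3R⟩
  have gb : good b = true := by
    simp only [good, Bool.and_eq_true, Nat.ble_eq]
    exact ⟨⟨⟨⟨⟨⟨by omega, B0⟩, B1⟩, B2⟩, B3⟩, B4⟩, h3B⟩
  obtain ⟨v₁, v₂, v₃, v₄, v₅, hn, e1, e2, e3, e4⟩ := core r b hr hb gr gb (by omega)
  apply hP
  have hn' := hn
  simp only [List.nodup_cons, List.mem_cons, List.not_mem_nil, not_or, or_false] at hn'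
  obtain ⟨⟨n12, -⟩, ⟨n23, -⟩, ⟨n34, -⟩, n45, -⟩ := hn'
  rw [tr, decide_eq_true_eq, ed_idx f _ _ (by assumption)] at e1 e2
  rw [tb, decide_eq_true_eq, ed_idx f _ _ (by assumption)] at e3 e4
  refine ⟨f v₁, f v₂, f v₃, f v₄, f v₅, ?_, e1, e2, e3, e4⟩
  have := List.toFinset_card_of_nodup (hn.map hf)
  simpa using this
end
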